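/- Let n ≥ 1, δ > (n-1)/2, q ∈ (0,1], p ∈ [q,∞), and assume 2n/(n+1+2δ) ≤ q. Then there exists a constant C > 0 such that for every Schwartz function f on ℝ^n, ‖B^δ_*(f)‖_{WM^p_q} ≤ C ‖M(f,Φ)‖_{M^p_q}; that is, the maximal Bochner–Riesz means of order δ is bounded from the Hardy–Morrey space HM^p_q(ℝ^n) to the weak Morrey space WM^p_q(ℝ^n). -/

import Mathlib

noncomputable section

open MeasureTheory Real Set
open scoped ENNReal NNReal

abbrev En (n : ℕ) : Type := EuclideanSpace ℝ (Fin n)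

/-- The Bochner–Riesz kernel of order `δ`: the Fourier transform of `ξ ↦ ((1-|ξ|²)⁺)^δ`. -/
def brKernel (n : ℕ) (δ : ℝ) (x : En n) : ℂ :=
  ∫ ξ : En n, (((max (1 - ‖ξ‖ ^ 2) 0) ^ δ : ℝ) : ℂ) *
    Complex.exp (-(2 * Real.pi) * Complex.I * ((∑ i, x i * ξ i : ℝ) : ℂ))

/-- The dilated kernel `φ_ε(x) = ε^{-n} φ(x/ε)`. -/
def brKernelDil (n : ℕ) (δ ε : ℝ) (x : En n) : ℂ :=
  (ε ^ n)⁻¹ • brKernel n δ (ε⁻¹ • x)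

/-- The Bochner–Riesz means `B^δ_{1/ε} f = f * φ_ε`. -/
def brMeans (n : ℕ) (δ ε : ℝ) (f : En n → ℂ) (x : En n) : ℂ :=
  ∫ y, f y * brKernelDil n δ ε (x - y)

/-- The maximal Bochner–Riesz means `B^δ_* f`. -/
def brMax (n : ℕ) (δ : ℝ) (f : En n → ℂ) (x : En n) : ℝ≥0∞ :=
  ⨆ (ε : ℝ) (_ : 0 < ε), (‖brMeans n δ ε f x‖₊ : ℝ≥0∞)

/-- The radial maximal function `M(f,Φ)(x) = sup_{t>0} |(Φ_t * f)(x)|`. -/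
def radMax (n : ℕ) (Φ : En n → ℂ) (f : En n → ℂ) (x : En n) : ℝ≥0∞ :=
  ⨆ (t : ℝ) (_ : 0 < t), (‖∫ y, (t ^ n)⁻¹ • Φ (t⁻¹ • (x - y)) * f y‖₊ : ℝ≥0∞)

/-- The Morrey quasinorm `‖g‖_{M^p_q}` of a nonnegative function. -/
def morreyQ (n : ℕ) (p q : ℝ) (g : En n → ℝ≥0∞) : ℝ≥0∞ :=
  ⨆ (x : En n) (r : ℝ) (_ : 0 < r),
    (volume (Metric.ball x r)) ^ (1/p - 1/q) *
      (∫⁻ y in Metric.ball x r, g y ^ q) ^ (1/q)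

/-- The weak Morrey quasinorm `‖g‖_{WM^p_q}`. -/
def morreyWQ (n : ℕ) (p q : ℝ) (g : En n → ℝ≥0∞) : ℝ≥0∞ :=
  ⨆ (β : ℝ≥0) (_ : 0 < β),
    (β : ℝ≥0∞) * morreyQ n p q ({x | (β : ℝ≥0∞) < g x}.indicator 1)

section P1body
open MeasureTheory Real Set
open scoped ENNReal NNReal

lemma osc_slit {z : ℂ} (hz : z ∈ ((uIcc (-1:ℝ) 1) ×ℂ (uIcc (0:ℝ) 1))) (h0 : 1 - z^2 ≠ 0) :
    1 - z^2 ∈ Complex.slitPlane := by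
  rw [Complex.mem_reProdIm, uIcc_of_le (by norm_num), uIcc_of_le (by norm_num)] at hz
  obtain ⟨⟨h1, h2⟩, h3, h4⟩ := hz
  rw [Complex.mem_slitPlane_iff]
  have hre : (1 - z^2).re = 1 - z.re^2 + z.im^2 := by
    simp [pow_two]; ring
  by_contra hcon
  push Not at hcon
  obtain ⟨ha, hb⟩ := hcon
  rw [hre] at ha
  apply h0
  apply Complex.ext
  · rw [hre]; simp; nlinarith
  · simpa using hb

lemma osc_cont (μ lam : ℝ) (hμ : 0 < μ) :
    ContinuousOn (fun z : ℂ => (1 - z^2) ^ (μ:ℂ) * Complex.exp (Complex.I * lam * z))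
      ((uIcc (-1:ℝ) 1) ×ℂ (uIcc (0:ℝ) 1)) := by
  apply ContinuousOn.mul _ (by fun_prop)
  intro z hz
  apply ContinuousAt.continuousWithinAt
  have hc : ContinuousAt (fun z : ℂ => 1 - z^2) z := by fun_prop
  by_cases h0 : 1 - z^2 = 0
  · have := Complex.continuousAt_cpow_zero_of_re_pos (z := (μ:ℂ)) (by simpa using hμ)
    have h2 : ContinuousAt (fun z : ℂ => ((1 - z^2, (μ:ℂ)) : ℂ × ℂ)) z := by fun_prop
    have h3 : ContinuousAt (fun p : ℂ × ℂ => p.1 ^ p.2) ((1 - z^2, (μ:ℂ)) : ℂ × ℂ) := by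
      rw [h0]; exact this
    exact ContinuousAt.comp (f := fun z : ℂ => ((1 - z^2, (μ:ℂ)) : ℂ × ℂ)) h3 h2
  · exact hc.cpow continuousAt_const (osc_slit hz h0)

lemma osc_side (μ lam : ℝ) (hμ : 0 < μ) (hl : 1 ≤ lam) (s : ℝ) (hs : s = 1 ∨ s = -1) :
    ‖∫ y in (0:ℝ)..1, (1 - ((s:ℂ) + y * Complex.I)^2) ^ (μ:ℂ) *
      Complex.exp (Complex.I * lam * ((s:ℂ) + y * Complex.I))‖
      ≤ 3 ^ μ * (Gamma (μ+1) * lam ^ (-(μ+1))) := by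
  have hlam : 0 < lam := by linarith
  have hpt : ∀ y ∈ Ioc (0:ℝ) 1, ‖(1 - ((s:ℂ) + y * Complex.I)^2) ^ (μ:ℂ) *
      Complex.exp (Complex.I * lam * ((s:ℂ) + y * Complex.I))‖
      ≤ 3 ^ μ * (y ^ ((μ + 1) - 1) * rexp (-(lam * y))) := by
    intro y hy
    rw [norm_mul, Complex.norm_exp]
    have e1 : (1 - ((s:ℂ) + y * Complex.I)^2) = y * (y - 2 * s * Complex.I) := by
      have : (s:ℂ)^2 = 1 := by rcases hs with h | h <;> simp [h]
      linear_combination -this - (y:ℂ)^2 * Complex.I_sq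
    have e2 : (Complex.I * lam * ((s:ℂ) + y * Complex.I)).re = -(lam * y) := by
      simp
    have hs1 : |s| = 1 := by rcases hs with h | h <;> simp [h]
    rw [e2, ← mul_assoc]
    gcongr
    rw [e1]
    have h1 : ‖(y:ℂ) * (y - 2 * s * Complex.I)‖ ≤ 3 * y := by
      rw [norm_mul]
      have : ‖((y:ℂ) - 2 * s * Complex.I)‖ ≤ 3 := by
        refine (norm_sub_le _ _).trans ?_
        simp [hs1, abs_of_pos hy.1]
        linarith [hy.2]
      have h2 : ‖(y:ℂ)‖ = y := by simp [abs_of_pos hy.1]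
      rw [h2]; nlinarith [hy.1]
    rw [Complex.norm_cpow_real, add_sub_cancel_right, ← Real.mul_rpow (by norm_num) hy.1.le]
    exact Real.rpow_le_rpow (norm_nonneg _) h1 hμ.le
  have hIntg0 := Real.integral_rpow_mul_exp_neg_mul_Ioi (a := μ + 1) (r := lam) (by linarith) hlam
  have hintg : IntegrableOn (fun y : ℝ => y ^ ((μ + 1) - 1) * rexp (-(lam * y))) (Ioi 0) := by
    by_contra hcon
    rw [integral_undef hcon] at hIntg0
    have : 0 < (1/lam) ^ (μ+1) * Gamma (μ+1) := by
      have := Real.Gamma_pos_of_pos (s := μ+1) (by linarith)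
      positivity
    linarith
  rw [intervalIntegral.integral_of_le (by norm_num)]
  have hsub : Ioc (0:ℝ) 1 ⊆ Ioi 0 := fun y hy => hy.1
  calc _ ≤ ∫ y in Ioc (0:ℝ) 1, 3 ^ μ * (y ^ ((μ + 1) - 1) * rexp (-(lam * y))) := by
        apply norm_integral_le_of_norm_le
        · exact (hintg.mono_set hsub).const_mul _
        · exact (ae_restrict_iff' measurableSet_Ioc).2 (Filter.Eventually.of_forall hpt)
    _ = 3 ^ μ * ∫ y in Ioc (0:ℝ) 1, (y ^ ((μ + 1) - 1) * rexp (-(lam * y))) :=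
        integral_const_mul _ _
    _ ≤ 3 ^ μ * ∫ y in Ioi (0:ℝ), (y ^ ((μ + 1) - 1) * rexp (-(lam * y))) := by
        refine mul_le_mul_of_nonneg_left ?_ (by positivity)
        apply setIntegral_mono_set hintg
        · refine (ae_restrict_iff' measurableSet_Ioi).2 (Filter.Eventually.of_forall ?_)
          intro y hy
          have : (0:ℝ) < y := hy
          positivity
        · exact Filter.Eventually.of_forall hsub
    _ = _ := by
        rw [hIntg0, mul_comm (Gamma _), one_div, Real.inv_rpow hlam.le, Real.rpow_neg hlam.le]

lemma osc_top (μ : ℝ) (hμ : 0 < μ) :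
    ∃ C : ℝ, 0 ≤ C ∧ ∀ lam : ℝ, 1 ≤ lam → ‖∫ x in (-1:ℝ)..1, (1 - ((x:ℂ) + Complex.I)^2) ^ (μ:ℂ) *
      Complex.exp (Complex.I * lam * ((x:ℂ) + Complex.I))‖
      ≤ C * lam ^ (-(μ+1)) := by
  -- e^{-lam} ≤ C lam^{-(μ+1)}
  obtain ⟨k, hk⟩ := exists_nat_ge (μ + 1)
  refine ⟨5 ^ μ * (k.factorial) * 2, by positivity, fun lam hl => ?_⟩
  have hlam : 0 < lam := by linarith
  have hexp : rexp (-lam) ≤ k.factorial * lam ^ (-(μ+1)) := by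
    rw [Real.exp_neg, Real.rpow_neg hlam.le, ← div_eq_mul_inv,
      inv_le_comm₀ (exp_pos _) (by positivity), inv_div]
    have := Real.pow_div_factorial_le_exp lam hlam.le k
    refine le_trans ?_ this
    gcongr
    rw [← Real.rpow_natCast]
    exact Real.rpow_le_rpow_of_exponent_le hl hk
  have := intervalIntegral.norm_integral_le_of_norm_le_const (a := (-1:ℝ)) (b := 1)
    (C := 5 ^ μ * (k.factorial * lam ^ (-(μ+1))))
    (f := fun x : ℝ => (1 - ((x:ℂ) + Complex.I)^2) ^ (μ:ℂ) *
      Complex.exp (Complex.I * lam * ((x:ℂ) + Complex.I))) ?_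
  · refine this.trans (le_of_eq ?_)
    norm_num
    ring
  · intro x hx
    rw [uIoc_of_le (by norm_num)] at hx
    rw [norm_mul, Complex.norm_exp]
    have e2 : (Complex.I * lam * ((x:ℂ) + Complex.I)).re = -lam := by simp
    rw [e2]
    gcongr
    rw [Complex.norm_cpow_real]
    apply Real.rpow_le_rpow (norm_nonneg _) _ hμ.le
    have hx1 : |x| ≤ 1 := abs_le.2 ⟨hx.1.le, hx.2⟩
    have : ‖(x:ℂ) + Complex.I‖ ≤ 2 := by
      refine (norm_add_le _ _).trans ?_
      simp; linarith
    calc _ ≤ ‖(1:ℂ)‖ + ‖((x:ℂ) + Complex.I)^2‖ := norm_sub_le _ _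
      _ ≤ 1 + 2^2 := by rw [norm_pow]; simp only [norm_one]; gcongr
      _ = 5 := by norm_num

lemma osc_main (μ : ℝ) (hμ : 0 < μ) :
    ∃ C : ℝ, 0 ≤ C ∧ ∀ lam : ℝ, 1 ≤ lam →
      ‖∫ x in (-1:ℝ)..1, (((1 - x^2) ^ μ : ℝ) : ℂ) * Complex.exp (-(Complex.I * lam * x))‖
      ≤ C * lam ^ (-(μ+1)) := by
  obtain ⟨C, hC, h⟩ := osc_top μ hμ
  refine ⟨C + 3 ^ μ * Gamma (μ+1) + 3 ^ μ * Gamma (μ+1), ?_, fun lam hl => ?_⟩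
  · have := Real.Gamma_pos_of_pos (s := μ+1) (by linarith)
    positivity
  have h1 := osc_side μ lam hμ hl 1 (Or.inl rfl)
  have h2 := osc_side μ lam hμ hl (-1) (Or.inr rfl)
  have h3 := h lam hl
  have key := Complex.integral_boundary_rect_eq_zero_of_continuousOn_of_differentiableOn
    (fun z : ℂ => (1 - z^2) ^ (μ:ℂ) * Complex.exp (Complex.I * lam * z)) (-1) (1 + Complex.I)
    (by simpa using osc_cont μ lam hμ) ?_
  · simp only [Complex.neg_re, Complex.one_re, Complex.add_re, Complex.I_re, add_zero,
      Complex.neg_im, Complex.one_im, neg_zero, Complex.ofReal_zero, zero_mul, Complex.add_im,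
      Complex.I_im, zero_add, Complex.ofReal_one, one_mul] at key
    have e : ∫ x in (-1:ℝ)..1, (((1 - x^2) ^ μ : ℝ) : ℂ) * Complex.exp (-(Complex.I * lam * x))
      = ∫ x in (-1:ℝ)..1, (1 - (x:ℂ)^2) ^ (μ:ℂ) * Complex.exp (Complex.I * lam * x) := by
      have hneg := intervalIntegral.integral_comp_neg (a := -1) (b := 1)
        (fun x : ℝ => (1 - (x:ℂ)^2) ^ (μ:ℂ) * Complex.exp (Complex.I * lam * x))
      rw [neg_neg] at hneg
      rw [← hneg]
      apply intervalIntegral.integral_congr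
      intro x hx
      rw [uIcc_of_le (by norm_num)] at hx
      simp only
      rw [Complex.ofReal_cpow (by nlinarith [hx.1, hx.2])]
      push_cast
      congr 2
      · ring
      · ring
    rw [e]
    set A := ∫ x in (-1:ℝ)..1, (1 - (x:ℂ)^2) ^ (μ:ℂ) * Complex.exp (Complex.I * lam * x)
    set T := ∫ x in (-1:ℝ)..1, (1 - ((x:ℂ) + Complex.I)^2) ^ (μ:ℂ) *
      Complex.exp (Complex.I * lam * ((x:ℂ) + Complex.I))
    set S1 := ∫ y in (0:ℝ)..1, (1 - (((1:ℝ):ℂ) + y * Complex.I)^2) ^ (μ:ℂ) *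
      Complex.exp (Complex.I * lam * (((1:ℝ):ℂ) + y * Complex.I)) with hS1
    set S2 := ∫ y in (0:ℝ)..1, (1 - (((-1:ℝ):ℂ) + y * Complex.I)^2) ^ (μ:ℂ) *
      Complex.exp (Complex.I * lam * (((-1:ℝ):ℂ) + y * Complex.I)) with hS2
    have key2 : A = T - Complex.I * S1 + Complex.I * S2 := by
      rw [hS1]
      simp only [smul_eq_mul, Complex.ofReal_one] at key ⊢
      linear_combination key
    rw [key2]
    calc _ ≤ ‖T‖ + ‖Complex.I * S1‖ + ‖Complex.I * S2‖ :=
          (norm_add_le _ _).trans (by gcongr; exact norm_sub_le _ _)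
      _ = ‖T‖ + ‖S1‖ + ‖S2‖ := by simp
      _ ≤ _ := by linarith
  · intro z hz
    simp only [Complex.neg_re, Complex.one_re, Complex.add_re, Complex.I_re, add_zero,
      Complex.neg_im, Complex.one_im, neg_zero, Complex.add_im, Complex.I_im, zero_add] at hz
    have hz' : z ∈ ((uIcc (-1:ℝ) 1) ×ℂ (uIcc (0:ℝ) 1)) := by
      rw [Complex.mem_reProdIm] at hz ⊢
      rw [uIcc_of_le (by norm_num), uIcc_of_le (by norm_num)]
      norm_num at hz
      exact ⟨⟨hz.1.1.le, hz.1.2.le⟩, hz.2.1.le, hz.2.2.le⟩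
    have hne : 1 - z^2 ≠ 0 := by
      intro h0
      rw [Complex.mem_reProdIm] at hz
      norm_num at hz
      have := congrArg Complex.re h0
      simp [pow_two] at this
      nlinarith [hz.1.1, hz.1.2, hz.2.1]
    apply DifferentiableAt.differentiableWithinAt
    apply DifferentiableAt.mul _ (by fun_prop)
    exact DifferentiableAt.cpow (by fun_prop) (by fun_prop) (osc_slit hz' hne)
end P1body

section P2body
open MeasureTheory Real Set
open scoped ENNReal NNReal FourierTransform

/-- The multiplier. -/
def brW (n : ℕ) (δ : ℝ) (ξ : En n) : ℝ := (max (1 - ‖ξ‖ ^ 2) 0) ^ δ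

lemma brW_cont (n : ℕ) {δ : ℝ} (hδ : 0 < δ) : Continuous (brW n δ) := by
  unfold brW
  exact Continuous.rpow_const (by fun_prop) (fun x => Or.inr hδ.le)

lemma brW_zero (n : ℕ) {δ : ℝ} (hδ : 0 < δ) {ξ : En n} (h : 1 ≤ ‖ξ‖) : brW n δ ξ = 0 := by
  unfold brW
  rw [max_eq_right (by nlinarith), Real.zero_rpow hδ.ne']

lemma brW_supp (n : ℕ) {δ : ℝ} (hδ : 0 < δ) : HasCompactSupport (brW n δ) := by
  apply HasCompactSupport.of_support_subset_isCompact (isCompact_closedBall (0 : En n) 1)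
  intro ξ hξ
  by_contra h
  apply hξ
  apply brW_zero n hδ
  simp at h
  exact h.le

lemma brW_int (n : ℕ) {δ : ℝ} (hδ : 0 < δ) : Integrable (fun ξ => (brW n δ ξ : ℂ)) :=
  ((brW_cont n hδ).integrable_of_hasCompactSupport (brW_supp n hδ)).ofReal

lemma brKernel_eq (n : ℕ) (δ : ℝ) (x : En n) :
    brKernel n δ x = 𝓕 (fun ξ => (brW n δ ξ : ℂ)) x := by
  rw [Real.fourier_eq', brKernel]
  congr 1
  ext ξ
  rw [smul_eq_mul, mul_comm]
  congr 2
  simp only [PiLp.inner_apply, RCLike.inner_apply, conj_trivial]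
  push_cast
  ring

lemma brKernel_rot (n : ℕ) (δ : ℝ) (x y : En n) (h : ‖x‖ = ‖y‖) :
    brKernel n δ x = brKernel n δ y := by
  rw [brKernel_eq, brKernel_eq]
  have := Real.fourier_comp_linearIsometry ((ℝ ∙ (x - y))ᗮ.reflection)
    (fun ξ => (brW n δ ξ : ℂ)) x
  rw [Submodule.reflection_sub h] at this
  rw [← this]
  have h2 : (fun ξ => (brW n δ ξ : ℂ)) ∘ ⇑((ℝ ∙ (x - y))ᗮ.reflection) =
      (fun ξ => (brW n δ ξ : ℂ)) := by
    funext ξ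
    simp [brW, LinearIsometryEquiv.norm_map]
  rw [h2]

/-- the slicing equivalence -/
def sliceEq (m : ℕ) : En (m+1) ≃ᵐ ℝ × (Fin m → ℝ) :=
  (MeasurableEquiv.toLp 2 (Fin (m+1) → ℝ)).symm.trans
    (MeasurableEquiv.piFinSuccAbove (fun _ => ℝ) 0)

lemma sliceEq_mp (m : ℕ) : MeasurePreserving (sliceEq m) := by
  unfold sliceEq
  exact (PiLp.volume_preserving_ofLp (Fin (m+1))).trans
    (volume_preserving_piFinSuccAbove (fun _ => ℝ) 0)

lemma brKernel_slice (m : ℕ) {δ : ℝ} (hδ : 0 < δ) (lam : ℝ) :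
    brKernel (m+1) δ (EuclideanSpace.single 0 lam) =
     ∫ s : ℝ, ∫ v : Fin m → ℝ, (((max (1 - s ^ 2 - ∑ i, v i ^ 2) 0) ^ δ : ℝ) : ℂ) *
       Complex.exp (-(2 * Real.pi) * Complex.I * ((lam * s : ℝ) : ℂ)) := by
  set G : ℝ × (Fin m → ℝ) → ℂ := fun z => (((max (1 - z.1 ^ 2 - ∑ i, z.2 i ^ 2) 0) ^ δ : ℝ) : ℂ) *
       Complex.exp (-(2 * Real.pi) * Complex.I * ((lam * z.1 : ℝ) : ℂ)) with hG
  have hfun : ∀ ξ : En (m+1), G (sliceEq m ξ) = (brW (m+1) δ ξ : ℂ) *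
       Complex.exp (-(2 * Real.pi) * Complex.I *
        ((∑ i, (EuclideanSpace.single (0 : Fin (m+1)) lam : En (m+1)) i * ξ i : ℝ) : ℂ)) := by
    intro ξ
    have h1 : (sliceEq m ξ).1 = ξ 0 := rfl
    have h2 : ∀ i, (sliceEq m ξ).2 i = ξ i.succ := fun i => rfl
    simp only [hG, h1, h2, brW, EuclideanSpace.real_norm_sq_eq, Fin.sum_univ_succ]
    congr 4
    · ring_nf
    · simp
  have hGi : Integrable G := by
    rw [← (sliceEq_mp m).integrable_comp_emb (sliceEq m).measurableEmbedding]
    have : G ∘ (sliceEq m) = fun ξ => (brW (m+1) δ ξ : ℂ) *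
       Complex.exp (-(2 * Real.pi) * Complex.I *
        ((∑ i, (EuclideanSpace.single (0 : Fin (m+1)) lam : En (m+1)) i * ξ i : ℝ) : ℂ)) := by
      ext ξ; exact hfun ξ
    rw [this]
    refine (brW_int (m+1) hδ).mul_bdd (c := 1) ?_ ?_
    · apply Continuous.aestronglyMeasurable
      fun_prop
    · refine Filter.Eventually.of_forall fun ξ => ?_
      rw [Complex.norm_exp]
      simp
  have h3 := (sliceEq_mp m).integral_comp' G
  unfold brKernel
  rw [← integral_prod (f := G) hGi]
  refine Eq.trans ?_ h3
  congr 1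
  ext ξ
  rw [hfun]
  rfl

lemma slice_inner (m : ℕ) {δ : ℝ} (hδ : 0 < δ) (a : ℝ) :
    ∫ v : Fin m → ℝ, ((max (a - ∑ i, v i ^ 2) 0) ^ δ : ℝ) =
      (max a 0) ^ (δ + m / 2) * ∫ v : En m, brW m δ v := by
  have h1 : ∫ v : Fin m → ℝ, ((max (a - ∑ i, v i ^ 2) 0) ^ δ : ℝ) =
      ∫ v : En m, ((max (a - ‖v‖ ^ 2) 0) ^ δ : ℝ) := by
    rw [← (PiLp.volume_preserving_ofLp (Fin m)).integral_comp
      (MeasurableEquiv.toLp 2 (Fin m → ℝ)).symm.measurableEmbedding]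
    simp only [EuclideanSpace.real_norm_sq_eq]
  rw [h1]
  rcases le_or_gt a 0 with ha | ha
  · rw [max_eq_right ha, Real.zero_rpow (by positivity), zero_mul]
    apply integral_eq_zero_of_ae
    refine Filter.Eventually.of_forall fun v => ?_
    simp only [Pi.zero_apply]
    rw [max_eq_right (by nlinarith [sq_nonneg ‖v‖]), Real.zero_rpow hδ.ne']
  · rw [max_eq_left ha.le]
    have h2 := Measure.integral_comp_smul (volume : Measure (En m))
      (fun v : En m => ((max (a - ‖v‖ ^ 2) 0) ^ δ : ℝ)) (√a)
    have h3 : ∀ v : En m, ((max (a - ‖√a • v‖ ^ 2) 0) ^ δ : ℝ) = a ^ δ * brW m δ v := by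
      intro v
      rw [norm_smul, mul_pow, Real.norm_eq_abs, abs_of_nonneg (Real.sqrt_nonneg _),
        Real.sq_sqrt ha.le, brW, ← Real.mul_rpow ha.le (le_max_right _ _),
        mul_max_of_nonneg _ _ ha.le]
      ring_nf
    simp only [h3, integral_const_mul] at h2
    have h4 : |(√a ^ Module.finrank ℝ (En m))⁻¹| = (a ^ ((m:ℝ)/2))⁻¹ := by
      rw [abs_of_nonneg (by positivity), finrank_euclideanSpace, Fintype.card_fin,
        Real.sqrt_eq_rpow, ← Real.rpow_natCast, ← Real.rpow_mul ha.le]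
      ring_nf
    rw [h4, smul_eq_mul] at h2
    have hp : 0 < a ^ ((m:ℝ)/2) := by positivity
    rw [Real.rpow_add ha, mul_right_comm, h2]
    field_simp

lemma brKernel_decay (n : ℕ) (hn : 1 ≤ n) {δ : ℝ} (hδ : 0 < δ) :
    ∃ C : ℝ, 0 < C ∧ ∀ x, ‖brKernel n δ x‖ ≤ C * (1 + ‖x‖) ^ (-(((n:ℝ)+1)/2 + δ)) := by
  obtain ⟨m, rfl⟩ : ∃ m, n = m + 1 := ⟨n - 1, by omega⟩
  set μ : ℝ := δ + m / 2 with hμ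
  have hμ0 : 0 < μ := by positivity
  have hN : (((m+1:ℕ):ℝ)+1)/2 + δ = μ + 1 := by push_cast; rw [hμ]; ring
  rw [hN]
  set c : ℝ := ∫ v : En m, brW m δ v
  obtain ⟨C, hC, hosc⟩ := osc_main μ hμ0
  have hform : ∀ lam : ℝ, brKernel (m+1) δ (EuclideanSpace.single 0 lam) =
      c * ∫ x in (-1:ℝ)..1, (((1 - x^2) ^ μ : ℝ) : ℂ) *
        Complex.exp (-(Complex.I * ((2 * π * lam : ℝ) : ℂ) * x)) := by
    intro lam
    rw [brKernel_slice m hδ lam]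
    have h1 : ∀ s : ℝ, ∫ v : Fin m → ℝ, (((max (1 - s ^ 2 - ∑ i, v i ^ 2) 0) ^ δ : ℝ) : ℂ) *
       Complex.exp (-(2 * Real.pi) * Complex.I * ((lam * s : ℝ) : ℂ)) =
        c * ((((max (1 - s^2) 0) ^ μ : ℝ) : ℂ) *
          Complex.exp (-(Complex.I * ((2 * π * lam : ℝ) : ℂ) * s))) := by
      intro s
      rw [integral_mul_const, integral_complex_ofReal, slice_inner m hδ (1 - s^2)]
      push_cast
      rw [show -(2 * (π:ℂ)) * Complex.I * (lam * s) = -(Complex.I * (2 * π * lam) * s) by ring]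
      ring
    simp only [h1]
    rw [integral_const_mul]
    congr 1
    rw [intervalIntegral.integral_of_le (by norm_num), ← integral_indicator measurableSet_Ioc]
    congr 1
    ext s
    by_cases hs : s ∈ Ioc (-1:ℝ) 1
    · rw [indicator_of_mem hs, max_eq_left (by nlinarith [hs.1, hs.2])]
    · rw [indicator_of_notMem hs, max_eq_right, Real.zero_rpow hμ0.ne']
      · simp
      · by_contra hcon
        push Not at hcon
        apply hs
        have := abs_le.1 (abs_le_one_iff_mul_self_le_one.2 (by nlinarith : s * s ≤ 1))
        refine ⟨lt_of_le_of_ne this.1 ?_, this.2⟩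
        rintro rfl
        norm_num at hcon
  have hrad : ∀ x : En (m+1), brKernel (m+1) δ x =
      brKernel (m+1) δ (EuclideanSpace.single 0 ‖x‖) := by
    intro x
    apply brKernel_rot
    simp
  set D := ∫ ξ : En (m+1), ‖(brW (m+1) δ ξ : ℂ)‖
  have hD : 0 ≤ D := integral_nonneg fun _ => norm_nonneg _
  have hbd : ∀ x, ‖brKernel (m+1) δ x‖ ≤ D := by
    intro x
    rw [brKernel_eq]
    exact VectorFourier.norm_fourierIntegral_le_integral_norm _ _ _ _ _
  refine ⟨(|c| * C + D + 1) * 2 ^ (μ+1), by positivity, fun x => ?_⟩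
  rcases le_total ‖x‖ 1 with hx | hx
  · calc _ ≤ D := hbd x
      _ ≤ (|c| * C + D + 1) * 1 := by nlinarith [mul_nonneg (abs_nonneg c) hC]
      _ = (|c| * C + D + 1) * 2 ^ (μ+1) * 2 ^ (-(μ+1)) := by
          rw [mul_assoc, ← Real.rpow_add (by norm_num)]; simp
      _ ≤ _ := by
        gcongr ?_ * ?_
        apply Real.rpow_le_rpow_of_nonpos (by positivity) (by linarith) (by linarith)
  · rw [hrad, hform, norm_mul]
    have hl : 1 ≤ 2 * π * ‖x‖ := by nlinarith [Real.pi_gt_three]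
    have h1 := hosc _ hl
    calc _ ≤ |c| * (C * (2 * π * ‖x‖) ^ (-(μ+1))) := by
          gcongr
          simp
      _ ≤ |c| * (C * (2⁻¹ * (1 + ‖x‖)) ^ (-(μ+1))) := by
          gcongr ?_ * (?_ * ?_)
          apply Real.rpow_le_rpow_of_nonpos (by positivity) _ (by linarith)
          nlinarith [Real.pi_gt_three]
      _ = |c| * C * 2 ^ (μ+1) * (1 + ‖x‖) ^ (-(μ+1)) := by
          rw [Real.mul_rpow (by norm_num) (by positivity), Real.inv_rpow (by norm_num),
            Real.rpow_neg (by norm_num : (0:ℝ) ≤ 2), inv_inv]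
          ring
      _ ≤ _ := by
          gcongr
          linarith
end P2body

section P3body
open MeasureTheory Real Set
open scoped ENNReal NNReal FourierTransform SchwartzMap

/-- the model kernel `t^{-n}(1+|x|/t)^{-a}` -/
def ker (n : ℕ) (a t : ℝ) (x : En n) : ℝ≥0∞ :=
  ENNReal.ofReal ((t ^ n)⁻¹ * (1 + ‖x‖ / t) ^ (-a))

lemma ker_cont (n : ℕ) (a : ℝ) {t : ℝ} (ht : 0 < t) : Continuous (ker n a t) := by
  unfold ker
  apply ENNReal.continuous_ofReal.comp
  apply Continuous.mul continuous_const
  apply Continuous.rpow_const (by fun_prop)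
  intro x; left; positivity

lemma ker_meas (n : ℕ) (a : ℝ) {t : ℝ} (ht : 0 < t) : Measurable (ker n a t) :=
  (ker_cont n a ht).measurable

lemma ker_neg (n : ℕ) (a t : ℝ) (x : En n) : ker n a t (-x) = ker n a t x := by
  simp [ker]

lemma ker_sub_comm (n : ℕ) (a t : ℝ) (x y : En n) : ker n a t (x - y) = ker n a t (y - x) := by
  rw [← ker_neg, neg_sub]

/-- the total mass -/
def kerMass (n : ℕ) (a : ℝ) : ℝ≥0∞ := ∫⁻ x : En n, ENNReal.ofReal ((1 + ‖x‖) ^ (-a))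

lemma kerMass_lt_top (n : ℕ) {a : ℝ} (ha : n < a) : kerMass n a < ⊤ := by
  apply finite_integral_one_add_norm
  simpa using ha

lemma lintegral_smul_comp (n : ℕ) {r : ℝ} (hr : 0 < r) (F : En n → ℝ≥0∞) (hF : Measurable F) :
    ∫⁻ x, F (r • x) = ENNReal.ofReal ((r ^ n)⁻¹) * ∫⁻ x, F x := by
  have h := Measure.map_addHaar_smul (volume : Measure (En n)) hr.ne'
  have h2 : ∫⁻ x, F (r • x) = ∫⁻ x, F x ∂(Measure.map (r • ·) volume) := by
    rw [lintegral_map hF (measurable_const_smul r)]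
  rw [h2, h, lintegral_smul_measure, finrank_euclideanSpace, Fintype.card_fin,
    abs_of_pos (by positivity), smul_eq_mul]

lemma ker_lint (n : ℕ) (a : ℝ) {t : ℝ} (ht : 0 < t) :
    ∫⁻ x, ker n a t x = kerMass n a := by
  have h := lintegral_smul_comp n (inv_pos.2 ht)
    (fun x : En n => ENNReal.ofReal ((1 + ‖x‖) ^ (-a))) (by
      apply ENNReal.measurable_ofReal.comp
      apply Continuous.measurable
      apply Continuous.rpow_const (by fun_prop)
      intro x; left; positivity)
  unfold ker
  have h1 : ∀ x : En n, ENNReal.ofReal ((t ^ n)⁻¹ * (1 + ‖x‖ / t) ^ (-a)) =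
     ENNReal.ofReal ((t ^ n)⁻¹) * ENNReal.ofReal ((1 + ‖t⁻¹ • x‖) ^ (-a)) := by
    intro x
    rw [ENNReal.ofReal_mul (by positivity), norm_smul, Real.norm_eq_abs,
      abs_of_pos (inv_pos.2 ht), div_eq_inv_mul]
  simp only [h1]
  rw [lintegral_const_mul', h, ← mul_assoc, ← ENNReal.ofReal_mul (by positivity), inv_pow, inv_inv,
    inv_mul_cancel₀ (by positivity), ENNReal.ofReal_one, one_mul, kerMass]
  exact ENNReal.ofReal_ne_top

lemma ker_lint_sub (n : ℕ) (a : ℝ) {t : ℝ} (ht : 0 < t) (x : En n) :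
    ∫⁻ y, ker n a t (x - y) = kerMass n a := by
  rw [← ker_lint n a ht]
  exact lintegral_sub_left_eq_self (fun y => ker n a t y) x

lemma ker_triangle {n : ℕ} {t : ℝ} (ht : 0 < t) (x y z : En n) :
    1 + ‖x - y‖ / t ≤ (1 + ‖x - z‖ / t) * (1 + ‖z - y‖ / t) := by
  have h1 : ‖x - y‖ / t ≤ ‖x - z‖ / t + ‖z - y‖ / t := by
    rw [← add_div]; gcongr; exact norm_sub_le_norm_sub_add_norm_sub x z y
  have : 0 ≤ ‖x - z‖ / t * (‖z - y‖ / t) := by positivity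
  nlinarith

/-- `(1+|z-w|/t)^{-a} ≤ (1+|z-y|/t)^{-a} (1+|w-y|/t)^a`. -/
lemma ker_peetre {n : ℕ} {a t : ℝ} (ha : 0 ≤ a) (ht : 0 < t) (z w y : En n) :
    (1 + ‖z - w‖ / t) ^ (-a) ≤ (1 + ‖z - y‖ / t) ^ (-a) * (1 + ‖w - y‖ / t) ^ a := by
  have h1 := ker_triangle ht z y w
  have p1 : 0 < 1 + ‖z - w‖ / t := by positivity
  have p2 : 0 < 1 + ‖z - y‖ / t := by positivity
  have p3 : 0 < 1 + ‖w - y‖ / t := by positivity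
  have h2 := Real.rpow_le_rpow p2.le h1 ha
  rw [Real.mul_rpow p1.le p3.le] at h2
  rw [Real.rpow_neg p1.le, Real.rpow_neg p2.le, inv_mul_eq_div, inv_eq_one_div,
    div_le_div_iff₀ (by positivity) (by positivity)]
  linarith

lemma ker_mul_ker {n : ℕ} {a t s : ℝ} (ha : 0 ≤ a) (hs : 0 < s) (hst : s ≤ t) (b : ℝ)
    (z w y : En n) :
    ker n a t (z - w) * ker n (a + b) s (w - y) ≤ ker n a t (z - y) * ker n b s (w - y) := by
  have ht : 0 < t := hs.trans_le hst
  unfold ker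
  rw [← ENNReal.ofReal_mul (by positivity), ← ENNReal.ofReal_mul (by positivity)]
  apply ENNReal.ofReal_le_ofReal
  have h1 := ker_peetre ha ht z w y
  have h2 : (1 + ‖w - y‖ / t) ^ a ≤ (1 + ‖w - y‖ / s) ^ a := by gcongr
  have p3 : 0 < 1 + ‖w - y‖ / s := by positivity
  have h3 : (1 + ‖w - y‖ / s) ^ (-(a + b)) =
      (1 + ‖w - y‖ / s) ^ (-b) * ((1 + ‖w - y‖ / s) ^ a)⁻¹ := by
    rw [neg_add_rev, Real.rpow_add p3, Real.rpow_neg p3.le a]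
  rw [h3]
  have p4 : 0 < (1 + ‖w - y‖ / s) ^ a := by positivity
  calc _ ≤ (t ^ n)⁻¹ * ((1 + ‖z - y‖ / t) ^ (-a) * (1 + ‖w - y‖ / s) ^ a) *
      ((s ^ n)⁻¹ * ((1 + ‖w - y‖ / s) ^ (-b) * ((1 + ‖w - y‖ / s) ^ a)⁻¹)) := by
        gcongr
        exact h1.trans (by gcongr)
    _ = _ := by field_simp

lemma ker_conv {n : ℕ} {a t s : ℝ} (ha : 0 ≤ a) (hs : 0 < s) (hst : s ≤ t) (b : ℝ)
    (F : En n → ℝ≥0∞) (hF : Measurable F) (z : En n) :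
    ∫⁻ w, ker n a t (z - w) * ∫⁻ y, ker n (a + b) s (w - y) * F y ≤
      kerMass n b * ∫⁻ y, ker n a t (z - y) * F y := by
  have ht : 0 < t := hs.trans_le hst
  have m1 : Measurable fun w => ker n a t (z - w) :=
    (ker_meas n a ht).comp (measurable_const.sub measurable_id)
  have m2 : Measurable (fun p : En n × En n => ker n (a+b) s (p.1 - p.2)) :=
    (ker_meas n _ hs).comp (measurable_fst.sub measurable_snd)
  have m3 : ∀ w, Measurable fun y => ker n (a+b) s (w - y) := fun w =>
    (ker_meas n _ hs).comp (measurable_const.sub measurable_id)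
  calc _ = ∫⁻ w, ∫⁻ y, ker n a t (z - w) * (ker n (a + b) s (w - y) * F y) := by
        congr 1; ext w
        exact (lintegral_const_mul _ (show Measurable fun y => ker n (a + b) s (w - y) * F y from (m3 w).mul hF)).symm
    _ = ∫⁻ y, ∫⁻ w, ker n a t (z - w) * (ker n (a + b) s (w - y) * F y) := by
        apply lintegral_lintegral_swap
        apply Measurable.aemeasurable
        exact (m1.comp measurable_fst).mul (m2.mul (hF.comp measurable_snd))
    _ ≤ ∫⁻ y, ∫⁻ w, (ker n a t (z - y) * F y) * ker n b s (y - w) := by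
        apply lintegral_mono; intro y
        apply lintegral_mono; intro w
        dsimp only
        rw [← mul_assoc, ker_sub_comm n b s y w, mul_right_comm (ker n a t (z - y))]
        exact mul_le_mul' (ker_mul_ker ha hs hst b z w y) le_rfl
    _ = ∫⁻ y, kerMass n b * (ker n a t (z - y) * F y) := by
        congr 1; ext y
        rw [lintegral_const_mul, ker_lint_sub n b hs, mul_comm]
        exact (ker_meas n _ hs).comp (measurable_const.sub measurable_id)
    _ = _ := by
        rw [lintegral_const_mul]
        exact ((ker_meas n a ht).comp (measurable_const.sub measurable_id)).mul hF
end P3body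

section P4body
open MeasureTheory Real Set
open scoped ENNReal NNReal FourierTransform SchwartzMap Convolution

/-- dilation of a Schwartz function -/
def sdil {n : ℕ} (A : 𝓢(En n, ℂ)) (t : ℝ) : 𝓢(En n, ℂ) :=
  if ht : t ≠ 0 then
    ((t ^ n)⁻¹ : ℝ) • (SchwartzMap.compCLMOfContinuousLinearEquiv ℂ
      (ContinuousLinearEquiv.smulLeft (Units.mk0 t⁻¹ (inv_ne_zero ht)) : En n ≃L[ℝ] En n) A)
  else 0

lemma sdil_apply {n : ℕ} (A : 𝓢(En n, ℂ)) {t : ℝ} (ht : 0 < t) (x : En n) :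
    sdil A t x = (t ^ n)⁻¹ • A (t⁻¹ • x) := by
  simp [sdil, ht.ne']

lemma sdil_fourier {n : ℕ} (A : 𝓢(En n, ℂ)) {t : ℝ} (ht : 0 < t) (ξ : En n) :
    𝓕 (sdil A t) ξ = 𝓕 A (t • ξ) := by
  rw [SchwartzMap.fourier_coe, SchwartzMap.fourier_coe, Real.fourier_eq, Real.fourier_eq]
  have h := Measure.integral_comp_smul (volume : Measure (En n))
    (fun v => 𝐞 (-inner ℝ v (t • ξ)) • A v) t⁻¹
  simp only [finrank_euclideanSpace, Fintype.card_fin] at h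
  have h1 : ∀ v : En n, 𝐞 (-inner ℝ v ξ) • sdil A t v =
      (t ^ n)⁻¹ • (𝐞 (-inner ℝ (t⁻¹ • v) (t • ξ)) • A (t⁻¹ • v)) := by
    intro v
    rw [sdil_apply A ht, inner_smul_left, inner_smul_right]
    have : (starRingEnd ℝ) t⁻¹ * (t * inner ℝ v ξ) = inner ℝ v ξ := by
      simp; field_simp
    rw [this, smul_comm]
  simp only [h1]
  rw [integral_smul, h, smul_smul]
  have : (t ^ n)⁻¹ * |((t⁻¹) ^ n)⁻¹| = 1 := by
    rw [inv_pow, inv_inv, abs_of_pos (by positivity)]; field_simp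
  rw [this, one_smul]

/-- convolution with a dilated Schwartz function -/
def cv {n : ℕ} (A : 𝓢(En n, ℂ)) (t : ℝ) (f : 𝓢(En n, ℂ)) : 𝓢(En n, ℂ) :=
  SchwartzMap.convolution (ContinuousLinearMap.mul ℂ ℂ) (sdil A t) f

lemma cv_apply {n : ℕ} (A : 𝓢(En n, ℂ)) (t : ℝ) (f : 𝓢(En n, ℂ)) (x : En n) :
    cv A t f x = ∫ y, sdil A t (x - y) * f y := by
  unfold cv
  rw [SchwartzMap.convolution_apply, ← convolution_flip]
  rfl

lemma cv_fourier {n : ℕ} (A : 𝓢(En n, ℂ)) {t : ℝ} (ht : 0 < t) (f : 𝓢(En n, ℂ)) (ξ : En n) :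
    𝓕 (cv A t f) ξ = 𝓕 A (t • ξ) * 𝓕 f ξ := by
  unfold cv
  rw [SchwartzMap.fourier_convolution, SchwartzMap.pairing_apply_apply, sdil_fourier A ht]
  rfl

lemma schwartz_ext_fourier {n : ℕ} {f g : 𝓢(En n, ℂ)} (h : ∀ ξ, 𝓕 f ξ = 𝓕 g ξ) : f = g := by
  have : 𝓕 f = 𝓕 g := by ext ξ; exact h ξ
  have h2 : 𝓕⁻ (𝓕 f) = 𝓕⁻ (𝓕 g) := by rw [this]
  simpa using h2

lemma radMax_eq {n : ℕ} (Φ f : 𝓢(En n, ℂ)) (x : En n) :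
    radMax n Φ f x = ⨆ (t : ℝ) (_ : 0 < t), ‖cv Φ t f x‖ₑ := by
  unfold radMax
  congr 1; ext t
  congr 1; ext ht
  rw [cv_apply]
  simp only [sdil_apply Φ ht]
  rfl

lemma schwartz_decay {n : ℕ} (A : 𝓢(En n, ℂ)) (a : ℝ) :
    ∃ C : ℝ≥0, ∀ t : ℝ, 0 < t → ∀ x, ‖sdil A t x‖ₑ ≤ C * ker n a t x := by
  obtain ⟨k, hk⟩ := exists_nat_ge a
  have h := fun x => SchwartzMap.one_add_le_sup_seminorm_apply (𝕜 := ℝ) (m := (k, 0)) (k := k) (n := 0)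
    le_rfl le_rfl A x
  set S := 2 ^ (k, 0).1 * ((Finset.Iic (k, 0)).sup fun m ↦ SchwartzMap.seminorm ℝ m.1 m.2) A with hS
  have hS0 : 0 ≤ S := by positivity
  refine ⟨S.toNNReal, fun t ht x => ?_⟩
  rw [sdil_apply A ht, ← ofReal_norm]
  unfold ker
  rw [show ((S.toNNReal : ℝ≥0) : ℝ≥0∞) = ENNReal.ofReal S from rfl,
    ← ENNReal.ofReal_mul hS0]
  apply ENNReal.ofReal_le_ofReal
  have h1 := h (t⁻¹ • x)
  simp only [norm_iteratedFDeriv_zero] at h1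
  rw [norm_smul t⁻¹ x, Real.norm_eq_abs, abs_of_pos (inv_pos.2 ht), ← div_eq_inv_mul] at h1
  have p : 1 ≤ 1 + ‖x‖ / t := by have : 0 ≤ ‖x‖ / t := by positivity
                                 linarith
  rw [norm_smul, Real.norm_eq_abs, abs_of_pos (by positivity), mul_left_comm]
  gcongr
  have h2 : (1 + ‖x‖ / t) ^ (-(k:ℝ)) ≤ (1 + ‖x‖ / t) ^ (-a) :=
    Real.rpow_le_rpow_of_exponent_le p (by linarith)
  refine le_trans ?_ (mul_le_mul_of_nonneg_left h2 hS0)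
  rw [Real.rpow_neg (by linarith), Real.rpow_natCast, ← div_eq_mul_inv, le_div_iff₀ (by positivity)]
  linarith

lemma cv_le {n : ℕ} (A : 𝓢(En n, ℂ)) (a : ℝ) :
    ∃ C : ℝ≥0, ∀ t : ℝ, 0 < t → ∀ (f : 𝓢(En n, ℂ)) z,
      ‖cv A t f z‖ₑ ≤ C * ∫⁻ y, ker n a t (z - y) * ‖f y‖ₑ := by
  obtain ⟨C, hC⟩ := schwartz_decay A a
  refine ⟨C, fun t ht f z => ?_⟩
  rw [cv_apply]
  refine (enorm_integral_le_lintegral_enorm _).trans ?_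
  rw [← lintegral_const_mul' _ _ ENNReal.coe_ne_top]
  apply lintegral_mono; intro y
  dsimp only
  rw [enorm_mul, ← mul_assoc]
  exact mul_le_mul' (hC t ht _) le_rfl

lemma cv_cv_le {n : ℕ} (A B : 𝓢(En n, ℂ)) {a : ℝ} (ha : 0 ≤ a) :
    ∃ C : ℝ≥0, ∀ s t : ℝ, 0 < s → s ≤ t → ∀ (f : 𝓢(En n, ℂ)) z,
      ‖cv A t (cv B s f) z‖ₑ ≤ C * ∫⁻ y, ker n a t (z - y) * ‖f y‖ₑ := by
  obtain ⟨C, hC⟩ := cv_le A a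
  obtain ⟨D, hD⟩ := cv_le B (a + (n + 1))
  have hm : kerMass n ((n:ℝ) + 1) < ⊤ := kerMass_lt_top n (by linarith)
  refine ⟨C * D * (kerMass n ((n:ℝ) + 1)).toNNReal, fun s t hs hst f z => ?_⟩
  have ht := hs.trans_le hst
  rw [ENNReal.coe_mul, ENNReal.coe_mul, ENNReal.coe_toNNReal hm.ne]
  refine (hC t ht _ z).trans ?_
  rw [mul_assoc, mul_assoc]
  gcongr
  calc _ ≤ ∫⁻ w, D * (ker n a t (z - w) * ∫⁻ y, ker n (a + (n+1)) s (w - y) * ‖f y‖ₑ) := by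
        apply lintegral_mono; intro w
        dsimp only
        rw [mul_left_comm]
        exact mul_le_mul' le_rfl (hD s hs f w)
    _ = D * ∫⁻ w, (ker n a t (z - w) * ∫⁻ y, ker n (a + (n+1)) s (w - y) * ‖f y‖ₑ) :=
        lintegral_const_mul' _ _ ENNReal.coe_ne_top
    _ ≤ _ := by
        gcongr
        exact ker_conv ha hs hst _ _ f.continuous.enorm.measurable z
end P4body

section P5body
open MeasureTheory Real Set
open scoped ENNReal NNReal FourierTransform SchwartzMap Convolution

/-- the frequency cutoff -/
def chiB (n : ℕ) : ContDiffBump (0 : En n) := ⟨1, 2, by norm_num, by norm_num⟩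

def chi (n : ℕ) (ξ : En n) : ℂ := ((chiB n ξ : ℝ) : ℂ)

lemma chi_smooth (n : ℕ) : ContDiff ℝ (⊤ : ℕ∞) (chi n) :=
  Complex.ofRealCLM.contDiff.comp (chiB n).contDiff

lemma chi_one {n : ℕ} {ξ : En n} (h : ‖ξ‖ ≤ 1) : chi n ξ = 1 := by
  unfold chi
  rw [(chiB n).one_of_mem_closedBall (by simpa [chiB] using h)]; simp

lemma chi_zero {n : ℕ} {ξ : En n} (h : 2 ≤ ‖ξ‖) : chi n ξ = 0 := by
  unfold chi
  rw [(chiB n).zero_of_le_dist (by simpa [chiB] using h)]; simp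

lemma chi_norm_le {n : ℕ} (ξ : En n) : ‖chi n ξ‖ ≤ 1 := by
  unfold chi
  rw [Complex.norm_real, Real.norm_eq_abs, abs_of_nonneg (chiB n).nonneg]
  exact (chiB n).le_one

lemma supp_of_zero {n : ℕ} {F : En n → ℂ} (h : ∀ ξ, 2 ≤ ‖ξ‖ → F ξ = 0) : HasCompactSupport F := by
  apply HasCompactSupport.intro (isCompact_closedBall (0 : En n) 2)
  intro x hx
  apply h
  simp at hx
  exact hx.le

/-- a Schwartz function with prescribed smooth Fourier transform supported in the ball -/
lemma exists_fourier {n : ℕ} {F : En n → ℂ} (h : ∀ ξ, 2 ≤ ‖ξ‖ → F ξ = 0)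
    (hs : ContDiff ℝ (⊤ : ℕ∞) F) : ∃ A : 𝓢(En n, ℂ), ∀ ξ, 𝓕 A ξ = F ξ := by
  refine ⟨𝓕⁻ ((supp_of_zero h).toSchwartzMap hs), fun ξ => ?_⟩
  simp

lemma exists_eta (n : ℕ) : ∃ A : 𝓢(En n, ℂ), ∀ ξ, 𝓕 A ξ = chi n ξ :=
  exists_fourier (fun _ => chi_zero) (chi_smooth n)

lemma fourier_smooth {n : ℕ} (Φ : 𝓢(En n, ℂ)) : ContDiff ℝ (⊤ : ℕ∞) (fun ξ => 𝓕 Φ ξ) :=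
  (𝓕 Φ).smooth'

lemma exists_theta {n : ℕ} (Φ : 𝓢(En n, ℂ)) (hΦ : ∀ ξ, ‖ξ‖ ≤ 2 → 𝓕 Φ ξ ≠ 0) :
    ∃ A : 𝓢(En n, ℂ), ∀ ξ, chi n ξ = 𝓕 A ξ * 𝓕 Φ ξ := by
  obtain ⟨A, hA⟩ := exists_fourier (n := n) (F := fun ξ => chi n ξ * (𝓕 Φ ξ)⁻¹)
    (fun ξ h => by rw [chi_zero h, zero_mul]) (by
      rw [contDiff_iff_contDiffAt]
      intro ξ
      rcases le_or_gt ‖ξ‖ 2 with h | h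
      · exact (chi_smooth n).contDiffAt.mul ((fourier_smooth Φ).contDiffAt.inv (hΦ ξ h))
      · have : (fun ξ => chi n ξ * (𝓕 Φ ξ)⁻¹) =ᶠ[nhds ξ] fun _ => 0 := by
          filter_upwards [(isOpen_lt continuous_const continuous_norm).mem_nhds h] with x hx
          rw [chi_zero (le_of_lt hx), zero_mul]
        exact contDiffAt_const.congr_of_eventuallyEq this)
  refine ⟨A, fun ξ => ?_⟩
  rw [hA]
  rcases le_or_gt ‖ξ‖ 2 with h | h
  · rw [mul_assoc, inv_mul_cancel₀ (hΦ ξ h), mul_one]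
  · rw [chi_zero h.le, zero_mul, zero_mul]

lemma exists_lambda {n : ℕ} (Φ : 𝓢(En n, ℂ)) (hΦ : ∀ ξ, ‖ξ‖ ≤ 2 → 𝓕 Φ ξ ≠ 0) (L : ℕ) :
    ∃ A : 𝓢(En n, ℂ), ∀ ξ, chi n ξ - chi n ((2:ℝ) • ξ) = 𝓕 A ξ * 𝓕 Φ ξ * ((‖ξ‖ ^ 2) ^ L : ℝ) := by
  have hz1 : ∀ ξ : En n, ‖ξ‖ < 1/2 → chi n ξ - chi n ((2:ℝ) • ξ) = 0 := by
    intro ξ h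
    rw [chi_one (by linarith), chi_one (by rw [norm_smul]; norm_num; linarith), sub_self]
  have hz2 : ∀ ξ : En n, 2 ≤ ‖ξ‖ → chi n ξ - chi n ((2:ℝ) • ξ) = 0 := by
    intro ξ h
    rw [chi_zero h, chi_zero (by rw [norm_smul]; norm_num; linarith), sub_self]
  have hsm : ContDiff ℝ (⊤ : ℕ∞) (fun ξ => chi n ξ - chi n ((2:ℝ) • ξ)) :=
    (chi_smooth n).sub ((chi_smooth n).comp (contDiff_const_smul (2:ℝ)))
  have hn2 : ContDiff ℝ (⊤ : ℕ∞) (fun ξ : En n => (((‖ξ‖ ^ 2) ^ L : ℝ) : ℂ)) :=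
    Complex.ofRealCLM.contDiff.comp ((contDiff_norm_sq ℝ).pow L)
  obtain ⟨A, hA⟩ := exists_fourier (n := n)
    (F := fun ξ => (chi n ξ - chi n ((2:ℝ) • ξ)) * (𝓕 Φ ξ * ((‖ξ‖ ^ 2) ^ L : ℝ))⁻¹)
    (fun ξ h => by rw [hz2 ξ h, zero_mul]) (by
      rw [contDiff_iff_contDiffAt]
      intro ξ
      rcases le_or_gt ‖ξ‖ 2 with h | h
      · rcases lt_or_ge ‖ξ‖ (1/2) with h' | h'
        · have : (fun ξ => (chi n ξ - chi n ((2:ℝ) • ξ)) * (𝓕 Φ ξ * ((‖ξ‖ ^ 2) ^ L : ℝ))⁻¹)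
              =ᶠ[nhds ξ] fun _ => 0 := by
            filter_upwards [(isOpen_lt continuous_norm continuous_const).mem_nhds h'] with x hx
            rw [hz1 x hx, zero_mul]
          exact contDiffAt_const.congr_of_eventuallyEq this
        · refine hsm.contDiffAt.mul (((fourier_smooth Φ).contDiffAt.mul hn2.contDiffAt).inv ?_)
          apply mul_ne_zero (hΦ ξ h)
          have : 0 < ‖ξ‖ := by linarith
          exact_mod_cast (by positivity : ((‖ξ‖ ^ 2) ^ L : ℝ) ≠ 0)
      · have : (fun ξ => (chi n ξ - chi n ((2:ℝ) • ξ)) * (𝓕 Φ ξ * ((‖ξ‖ ^ 2) ^ L : ℝ))⁻¹)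
              =ᶠ[nhds ξ] fun _ => 0 := by
          filter_upwards [(isOpen_lt continuous_const continuous_norm).mem_nhds h] with x hx
          rw [hz2 x (le_of_lt hx), zero_mul]
        exact contDiffAt_const.congr_of_eventuallyEq this)
  refine ⟨A, fun ξ => ?_⟩
  rw [hA]
  rcases le_or_gt ‖ξ‖ 2 with h | h
  · rcases lt_or_ge ‖ξ‖ (1/2) with h' | h'
    · rw [hz1 ξ h']; simp
    · have h1 := hΦ ξ h
      have : 0 < ‖ξ‖ := by linarith
      have h2 : (((‖ξ‖ ^ 2) ^ L : ℝ) : ℂ) ≠ 0 := by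
        exact_mod_cast (by positivity : ((‖ξ‖ ^ 2) ^ L : ℝ) ≠ 0)
      rw [mul_assoc, mul_assoc, inv_mul_cancel₀ (mul_ne_zero h1 h2), mul_one]
  · rw [hz2 ξ h.le]; simp

lemma exists_phi' {n : ℕ} (Φ : 𝓢(En n, ℂ)) (L : ℕ) :
    ∃ A : 𝓢(En n, ℂ), ∀ ξ, 𝓕 A ξ = ((‖ξ‖ ^ 2) ^ L : ℝ) * 𝓕 Φ ξ := by
  have hg : Function.HasTemperateGrowth (fun ξ : En n => ((‖ξ‖ ^ 2) ^ L : ℝ)) :=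
    (Function.hasTemperateGrowth_norm_sq (En n)).pow L
  refine ⟨𝓕⁻ (SchwartzMap.smulLeftCLM ℂ (fun ξ : En n => ((‖ξ‖ ^ 2) ^ L : ℝ)) (𝓕 Φ)), fun ξ => ?_⟩
  simp [SchwartzMap.smulLeftCLM_apply_apply hg]

/-- approximate identity -/
lemma cv_tendsto {n : ℕ} (η f : 𝓢(En n, ℂ)) (hη : ∀ ξ, 𝓕 η ξ = chi n ξ) (A : 𝓢(En n, ℂ)) {t : ℝ}
    (ht : 0 < t) (z : En n) :
    Filter.Tendsto (fun J : ℕ => cv A t (cv η (t / 2 ^ J) f) z) Filter.atTop (nhds (cv A t f z)) := by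
  have key : ∀ g : 𝓢(En n, ℂ), g z = ∫ v, 𝐞 (inner ℝ v z) • 𝓕 g v := by
    intro g
    have : g z = 𝓕⁻ (𝓕 g) z := by simp
    rw [this, SchwartzMap.fourierInv_coe, Real.fourierInv_eq]
  rw [key]
  simp only [key (cv A t (cv η _ f))]
  apply tendsto_integral_of_dominated_convergence (fun v => ‖𝓕 (cv A t f) v‖)
  · intro J
    exact ((continuous_fourierChar.comp (by fun_prop)).smul
      (𝓕 (cv A t (cv η (t / 2 ^ J) f))).continuous).aestronglyMeasurable
  · exact (𝓕 (cv A t f)).integrable.norm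
  · intro J
    filter_upwards with v
    rw [Circle.norm_smul, cv_fourier _ ht, cv_fourier _ (by positivity), cv_fourier _ ht, hη,
      norm_mul, norm_mul, norm_mul]
    gcongr
    calc _ ≤ 1 * ‖𝓕 f v‖ := by gcongr; exact chi_norm_le _
      _ = _ := one_mul _
  · filter_upwards with v
    apply tendsto_const_nhds.congr'
    have h1 : Filter.Tendsto (fun J : ℕ => (t * ‖v‖) / 2 ^ J) Filter.atTop (nhds 0) :=
      tendsto_const_nhds.div_atTop (tendsto_pow_atTop_atTop_of_one_lt (by norm_num))
    filter_upwards [h1.eventually (gt_mem_nhds (zero_lt_one))] with J hJ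
    rw [cv_fourier _ ht, cv_fourier _ ht, cv_fourier _ (by positivity), hη, chi_one, one_mul]
    rw [norm_smul, Real.norm_eq_abs, abs_of_pos (by positivity), div_mul_eq_mul_div]
    exact hJ.le
end P5body

section P6body
open MeasureTheory Real Set
open scoped ENNReal NNReal FourierTransform SchwartzMap Convolution

lemma cv_eta_eq {n : ℕ} {Φ η Θ : 𝓢(En n, ℂ)} (hη : ∀ ξ, 𝓕 η ξ = chi n ξ)
    (hΘ : ∀ ξ, chi n ξ = 𝓕 Θ ξ * 𝓕 Φ ξ) {t : ℝ} (ht : 0 < t) (f : 𝓢(En n, ℂ)) :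
    cv η t f = cv Θ t (cv Φ t f) := by
  apply schwartz_ext_fourier
  intro ξ
  rw [cv_fourier _ ht, cv_fourier _ ht, cv_fourier _ ht, hη, hΘ, mul_assoc]

lemma repro {n : ℕ} (Φ : 𝓢(En n, ℂ)) (hΦ : ∀ ξ, ‖ξ‖ ≤ 2 → 𝓕 Φ ξ ≠ 0) (L : ℕ) :
    ∃ C : ℝ≥0, ∀ (f : 𝓢(En n, ℂ)) (t : ℝ), 0 < t → ∀ z,
      ‖cv Φ t f z‖ₑ ≤ C * ∑' j : ℕ, (((4:ℝ≥0∞) ^ L)⁻¹) ^ j *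
        ∫⁻ y, ker n L t (z - y) * ‖cv Φ (t / 2 ^ j) f y‖ₑ := by
  obtain ⟨η, hη⟩ := exists_eta n
  obtain ⟨Θ, hΘ⟩ := exists_theta Φ hΦ
  obtain ⟨Λ, hΛ⟩ := exists_lambda Φ hΦ L
  obtain ⟨Ψ, hΨ⟩ := exists_phi' Φ L
  obtain ⟨C, hC⟩ := cv_cv_le Φ Θ (a := L) (by positivity)
  obtain ⟨D, hD⟩ := cv_cv_le Ψ Λ (a := L) (by positivity)
  refine ⟨C + D, fun f t ht z => ?_⟩
  set T : ℕ → ℝ≥0∞ := fun j => (((4:ℝ≥0∞) ^ L)⁻¹) ^ j *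
        ∫⁻ y, ker n L t (z - y) * ‖cv Φ (t / 2 ^ j) f y‖ₑ with hT
  have step : ∀ j : ℕ, cv Φ t (cv η (t / 2 ^ (j+1)) f) = cv Φ t (cv η (t / 2 ^ j) f) +
      ((((4:ℝ) ^ L)⁻¹) ^ (j+1) : ℝ) • cv Ψ t (cv Λ (t / 2 ^ (j+1)) (cv Φ (t / 2 ^ (j+1)) f)) := by
    intro j
    apply schwartz_ext_fourier
    intro ξ
    have hp : 0 < t / 2 ^ (j+1) := by positivity
    have hp' : 0 < t / 2 ^ j := by positivity
    rw [FourierTransform.fourier_add, FourierTransform.fourier_smul]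
    rw [add_apply, smul_apply]
    rw [cv_fourier _ ht, cv_fourier _ ht, cv_fourier _ ht, cv_fourier _ hp, cv_fourier _ hp',
      cv_fourier _ hp, cv_fourier _ hp, hη, hη, hΨ]
    have h1 := hΛ ((t / 2 ^ (j+1)) • ξ)
    rw [smul_smul, show 2 * (t / 2 ^ (j+1)) = t / 2 ^ j by rw [pow_succ]; field_simp] at h1
    have h2 : ((‖(t / 2 ^ (j+1)) • ξ‖ ^ 2) ^ L : ℝ) = (((4:ℝ) ^ L)⁻¹) ^ (j+1) * (‖t • ξ‖ ^ 2) ^ L := by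
      rw [norm_smul, norm_smul, norm_div, norm_pow, div_mul_eq_mul_div, div_pow, div_pow,
        Real.norm_two, ← inv_pow, ← pow_mul, ← pow_mul, ← pow_mul, ← pow_mul,
        show (4:ℝ) = 2 ^ 2 by norm_num, inv_pow, ← pow_mul, div_eq_inv_mul]
      congr 3; ring
    rw [h2] at h1
    have h3 := sub_eq_iff_eq_add.1 h1
    rw [h3, Complex.real_smul]
    push_cast
    ring
  have h0 : cv Φ t (cv η (t / 2 ^ 0) f) = cv Φ t (cv Θ t (cv Φ t f)) := by
    rw [pow_zero, div_one, cv_eta_eq hη hΘ ht]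
  have hind : ∀ J : ℕ, ‖cv Φ t (cv η (t / 2 ^ J) f) z‖ₑ ≤ (C + D) * ∑ j ∈ Finset.range (J+1), T j := by
    intro J
    induction J with
    | zero =>
      rw [h0]
      refine (hC t t ht le_rfl _ z).trans ?_
      simp only [hT, zero_add, Finset.range_one, Finset.sum_singleton, pow_zero, one_mul, div_one]
      gcongr
      exact le_self_add
    | succ J ih =>
      rw [step, add_apply, Finset.sum_range_succ, mul_add]
      refine (enorm_add_le _ _).trans ?_
      refine add_le_add ih ?_
      rw [smul_apply, enorm_smul]
      have hp : 0 < t / 2 ^ (J+1) := by positivity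
      have h5 := hD (t / 2 ^ (J+1)) t hp (div_le_self ht.le (one_le_pow₀ (by norm_num)))
        (cv Φ (t / 2 ^ (J+1)) f) z
      have h6 : ‖((((4:ℝ) ^ L)⁻¹) ^ (J+1) : ℝ)‖ₑ = (((4:ℝ≥0∞) ^ L)⁻¹) ^ (J+1) := by
        rw [enorm_pow, enorm_inv (by positivity), enorm_pow]
        congr 3
        rw [Real.enorm_eq_ofReal (by norm_num)]; norm_num
      rw [h6, hT]
      dsimp only
      rw [mul_left_comm]
      gcongr
      refine h5.trans ?_
      gcongr
      exact le_add_self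
  have hlim := (continuous_enorm.tendsto _).comp (cv_tendsto η f hη Φ ht z)
  apply le_of_tendsto hlim
  filter_upwards with J
  refine (hind J).trans ?_
  push_cast
  gcongr
  exact ENNReal.sum_le_tsum _

/-- rescaling the test function -/
lemma cv_sdil {n : ℕ} (Φ f : 𝓢(En n, ℂ)) {c t : ℝ} (hc : 0 < c) (ht : 0 < t) :
    cv (sdil Φ c) t f = cv Φ (c * t) f := by
  apply schwartz_ext_fourier
  intro ξ
  rw [cv_fourier _ ht, sdil_fourier _ hc, cv_fourier _ (by positivity), smul_smul]

lemma exists_rescale {n : ℕ} (Φ : 𝓢(En n, ℂ)) (hΦ : (∫ x, Φ x) ≠ 0) :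
    ∃ Φ₁ : 𝓢(En n, ℂ), (∀ ξ, ‖ξ‖ ≤ 2 → 𝓕 Φ₁ ξ ≠ 0) ∧
      ∀ (f : 𝓢(En n, ℂ)) (t : ℝ), 0 < t → ∀ x, ‖cv Φ₁ t f x‖ₑ ≤ radMax n Φ f x := by
  have h0 : 𝓕 Φ 0 ≠ 0 := by
    rw [SchwartzMap.fourier_coe, Real.fourier_eq]
    simpa using hΦ
  have hev := (𝓕 Φ).continuous.continuousAt.eventually_ne h0
  obtain ⟨r, hr, hball⟩ := Metric.eventually_nhds_iff.1 hev
  have hc : 0 < r / 3 := by positivity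
  refine ⟨sdil Φ (r / 3), fun ξ hξ => ?_, fun f t ht x => ?_⟩
  · rw [sdil_fourier _ hc]
    apply hball
    rw [dist_zero_right, norm_smul, Real.norm_eq_abs, abs_of_pos hc]
    nlinarith
  · rw [cv_sdil _ _ hc ht, radMax_eq]
    exact le_iSup₂_of_le (r / 3 * t) (by positivity) le_rfl

lemma brKernel_cont (n : ℕ) {δ : ℝ} (hδ : 0 < δ) : Continuous (brKernel n δ) := by
  have : brKernel n δ = 𝓕 (fun ξ => (brW n δ ξ:ℂ)) := by ext x; exact brKernel_eq n δ x
  rw [this]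
  exact VectorFourier.fourierIntegral_continuous continuous_fourierChar continuous_inner
    (brW_int n hδ)

lemma brKernelDil_cont (n : ℕ) {δ : ℝ} (hδ : 0 < δ) (ε : ℝ) : Continuous (brKernelDil n δ ε) := by
  unfold brKernelDil
  exact Continuous.const_smul ((brKernel_cont n hδ).comp (continuous_const_smul ε⁻¹)) ((ε ^ n)⁻¹ : ℝ)

lemma brKernelDil_le (n : ℕ) (hn : 1 ≤ n) {δ : ℝ} (hδ : 0 < δ) :
    ∃ C : ℝ≥0, ∀ ε : ℝ, 0 < ε → ∀ x, ‖brKernelDil n δ ε x‖ₑ ≤ C * ker n (((n:ℝ)+1)/2+δ) ε x := by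
  obtain ⟨C, hC, h⟩ := brKernel_decay n hn hδ
  refine ⟨C.toNNReal, fun t ht x => ?_⟩
  unfold brKernelDil ker
  rw [← ofReal_norm, show ((C.toNNReal : ℝ≥0) : ℝ≥0∞) = ENNReal.ofReal C from rfl,
    ← ENNReal.ofReal_mul hC.le]
  apply ENNReal.ofReal_le_ofReal
  have h1 := h (t⁻¹ • x)
  rw [norm_smul t⁻¹ x, Real.norm_eq_abs, abs_of_pos (inv_pos.2 ht), ← div_eq_inv_mul] at h1
  rw [norm_smul, Real.norm_eq_abs, abs_of_pos (by positivity), mul_left_comm]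
  gcongr

lemma brKernelDil_int (n : ℕ) (hn : 1 ≤ n) {δ : ℝ} (hδ : 0 < δ) (hδ' : ((n : ℝ) - 1) / 2 < δ)
    {ε : ℝ} (hε : 0 < ε) : Integrable (brKernelDil n δ ε) := by
  obtain ⟨C, hC⟩ := brKernelDil_le n hn hδ
  refine ⟨?_, ?_⟩
  · apply Continuous.aestronglyMeasurable
    exact brKernelDil_cont n hδ ε
  · refine lt_of_le_of_lt (lintegral_mono (hC ε hε)) ?_
    rw [lintegral_const_mul' _ _ ENNReal.coe_ne_top, ker_lint _ _ hε]
    exact ENNReal.mul_lt_top ENNReal.coe_lt_top (kerMass_lt_top n (by linarith))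

lemma brKernelDil_fourier (n : ℕ) (hn : 1 ≤ n) {δ : ℝ} (hδ : 0 < δ) (hδ' : ((n : ℝ) - 1) / 2 < δ)
    {ε : ℝ} (hε : 0 < ε) (ξ : En n) : 𝓕 (brKernelDil n δ ε) ξ = brW n δ (ε • ξ) := by
  have hIntg0 : Integrable (brKernel n δ) := by
    have := brKernelDil_int n hn hδ hδ' one_pos
    have h1 : brKernelDil n δ 1 = brKernel n δ := by ext x; simp [brKernelDil]
    rwa [h1] at this
  have hfun : brKernel n δ = 𝓕 (fun ξ => (brW n δ ξ:ℂ)) := by ext x; exact brKernel_eq n δ x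
  have hinv : 𝓕⁻ (brKernel n δ) = fun ξ => (brW n δ ξ:ℂ) := by
    rw [hfun]
    apply Continuous.fourierInv_fourier_eq (Complex.continuous_ofReal.comp (brW_cont n hδ))
      (brW_int n hδ)
    exact hfun ▸ hIntg0
  have h := Measure.integral_comp_smul (volume : Measure (En n))
    (fun v => 𝐞 (-inner ℝ v (ε • ξ)) • brKernel n δ v) ε⁻¹
  simp only [finrank_euclideanSpace, Fintype.card_fin] at h
  rw [Real.fourier_eq]
  have h1 : ∀ v : En n, 𝐞 (-inner ℝ v ξ) • brKernelDil n δ ε v =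
      (ε ^ n)⁻¹ • (𝐞 (-inner ℝ (ε⁻¹ • v) (ε • ξ)) • brKernel n δ (ε⁻¹ • v)) := by
    intro v
    rw [brKernelDil, inner_smul_left, inner_smul_right]
    have : (starRingEnd ℝ) ε⁻¹ * (ε * inner ℝ v ξ) = inner ℝ v ξ := by
      simp; field_simp
    rw [this, smul_comm]
  simp only [h1]
  rw [integral_smul, h, smul_smul]
  have : (ε ^ n)⁻¹ * |((ε⁻¹) ^ n)⁻¹| = 1 := by
    rw [inv_pow, inv_inv, abs_of_pos (by positivity)]; field_simp
  rw [this, one_smul]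
  have h2 := congrFun hinv (-(ε • ξ))
  rw [Real.fourierInv_eq] at h2
  simp only [inner_neg_right] at h2
  rw [h2]
  simp [brW]

lemma brMeans_eq {n : ℕ} (hn : 1 ≤ n) {δ : ℝ} (hδ : 0 < δ) (hδ' : ((n : ℝ) - 1) / 2 < δ)
    {ε : ℝ} (hε : 0 < ε) {η : 𝓢(En n, ℂ)} (hη : ∀ ξ, 𝓕 η ξ = chi n ξ) (f : 𝓢(En n, ℂ)) (x : En n) :
    brMeans n δ ε f x = brMeans n δ ε (cv η ε f) x := by
  set K := brKernelDil n δ ε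
  have hK : Integrable K := brKernelDil_int n hn hδ hδ' hε
  have hKc : Continuous K := by
    exact brKernelDil_cont n hδ ε
  have hbr : ∀ g : 𝓢(En n, ℂ), ∀ x, brMeans n δ ε g x = (K ⋆[ContinuousLinearMap.mul ℂ ℂ] g) x := by
    intro g x
    rw [← convolution_flip]
    unfold brMeans convolution
    congr 1; ext y
    simp [mul_comm, K]
  set g := f - cv η ε f with hg
  have hz : ∀ ξ, 𝓕 (K ⋆[ContinuousLinearMap.mul ℂ ℂ] g) ξ = 0 := by
    intro ξ
    rw [Real.fourier_mul_convolution_eq hK g.integrable, brKernelDil_fourier n hn hδ hδ' hε,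
      ← SchwartzMap.fourier_coe, hg, sub_eq_add_neg, FourierTransform.fourier_add, FourierTransform.fourier_neg, add_apply, neg_apply,
      cv_fourier _ hε, hη]
    rcases le_or_gt 1 ‖ε • ξ‖ with h | h
    · rw [brW_zero n hδ h]; simp
    · rw [chi_one h.le]; simp
  have hz' : 𝓕 (K ⋆[ContinuousLinearMap.mul ℂ ℂ] g) = 0 := by ext ξ; exact hz ξ
  have hcont : Continuous (K ⋆[ContinuousLinearMap.mul ℂ ℂ] g) := by
    refine BddAbove.continuous_convolution_right_of_integrable _ ?_ hK g.continuous
    exact ⟨SchwartzMap.seminorm ℝ 0 0 g, fun x ⟨y, hy⟩ ↦ hy ▸ SchwartzMap.norm_le_seminorm ℝ g y⟩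
  have h3 := Continuous.fourierInv_fourier_eq hcont
    (hK.integrable_convolution _ g.integrable) (by rw [hz']; exact integrable_zero _ _ _)
  rw [hz'] at h3
  have h4 : (K ⋆[ContinuousLinearMap.mul ℂ ℂ] g) x = 0 := by
    rw [← h3, Real.fourierInv_eq]; simp
  have h5 : brMeans n δ ε g x = brMeans n δ ε f x - brMeans n δ ε (cv η ε f) x := by
    have hb : ∃ M, ∀ y, ‖K y‖ ≤ M := by
      obtain ⟨C, hC⟩ := brKernel_decay n hn hδ
      refine ⟨(ε ^ n)⁻¹ * C, fun y => ?_⟩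
      simp only [K]; unfold brKernelDil
      rw [norm_smul, Real.norm_eq_abs, abs_of_pos (by positivity)]
      gcongr
      refine (hC.2 _).trans ?_
      calc _ ≤ C * 1 := by
            gcongr
            · exact hC.1.le
            · apply Real.rpow_le_one_of_one_le_of_nonpos
              · linarith [norm_nonneg (ε⁻¹ • y)]
              · have : (0:ℝ) ≤ n := by positivity
                linarith
        _ = C := mul_one C
    obtain ⟨M, hM⟩ := hb
    have hi : ∀ g : 𝓢(En n, ℂ), Integrable (fun y => g y * K (x - y)) := by
      intro g
      refine g.integrable.mul_bdd (c := M) ?_ ?_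
      · exact (hKc.comp (by fun_prop)).aestronglyMeasurable
      · filter_upwards with y using hM _
    unfold brMeans
    rw [← integral_sub (hi _) (hi _)]
    congr 1; ext y
    rw [hg, sub_apply, sub_mul]
  rw [hbr g, h4] at h5
  exact (sub_eq_zero.1 h5.symm)

lemma brMeans_le {n : ℕ} (hn : 1 ≤ n) {δ : ℝ} (hδ : 0 < δ) (hδ' : ((n : ℝ) - 1) / 2 < δ) :
    ∃ C : ℝ≥0, ∀ {η : 𝓢(En n, ℂ)} (_ : ∀ ξ, 𝓕 η ξ = chi n ξ) (f : 𝓢(En n, ℂ)) (ε : ℝ), 0 < ε →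
      ∀ x, ‖brMeans n δ ε f x‖ₑ ≤
        C * ∫⁻ y, ker n (((n:ℝ)+1)/2+δ) ε (x - y) * ‖cv η ε f y‖ₑ := by
  obtain ⟨C, hC⟩ := brKernelDil_le n hn hδ
  refine ⟨C, fun {η} hη f ε hε x => ?_⟩
  rw [brMeans_eq hn hδ hδ' hε hη]
  refine (enorm_integral_le_lintegral_enorm _).trans ?_
  rw [← lintegral_const_mul' _ _ ENNReal.coe_ne_top]
  apply lintegral_mono; intro y
  dsimp only
  rw [enorm_mul, ← mul_assoc, mul_comm]
  exact mul_le_mul' (hC ε hε _) le_rfl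
end P6body

section P7body
open MeasureTheory Real Set
open scoped ENNReal NNReal

/-- dyadic level -/
def dy (k : ℤ) : ℝ≥0∞ := (2:ℝ≥0∞) ^ k

lemma dy_pos (k : ℤ) : dy k ≠ 0 := (ENNReal.zpow_pos (by norm_num) (by norm_num) k).ne'
lemma dy_ne_top (k : ℤ) : dy k ≠ ⊤ := (ENNReal.zpow_lt_top (by norm_num) (by norm_num) k).ne
lemma dy_add (k m : ℤ) : dy (k + m) = dy k * dy m := ENNReal.zpow_add (by norm_num) (by norm_num) k m
lemma dy_succ (k : ℤ) : dy (k + 1) = 2 * dy k := by rw [dy_add, mul_comm]; simp [dy]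
lemma dy_mono {k m : ℤ} (h : k ≤ m) : dy k ≤ dy m := ENNReal.zpow_le_of_le (by norm_num) h
lemma dy_lt {k m : ℤ} (h : dy k < dy m) : k < m := by
  by_contra h'; exact absurd (dy_mono (not_lt.1 h')) (not_le.2 h)
lemma dy_zero : dy 0 = 1 := by simp [dy]

lemma dy_exists {a : ℝ≥0∞} (h0 : a ≠ 0) (h1 : a ≠ ⊤) : ∃ k : ℤ, dy k < a ∧ a ≤ 2 * dy k := by
  obtain ⟨k, hk1, hk2⟩ := ENNReal.exists_mem_Ioc_zpow h0 h1 (y := 2) (by norm_num) (by norm_num)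
  refine ⟨k, hk1, ?_⟩
  rw [← dy_succ]; exact hk2

open Classical in
lemma dy_lower {q : ℝ} (hq : 0 < q) (a : ℝ≥0∞) :
    a ^ q ≤ 2 ^ q * ∑' k : ℤ, (if dy k < a then (dy k) ^ q else 0) := by
  rcases eq_or_ne a 0 with h0 | h0
  · rw [h0, ENNReal.zero_rpow_of_pos hq]; exact bot_le
  rcases eq_or_ne a ⊤ with h1 | h1
  · have : ∑' k : ℤ, (if dy k < a then (dy k) ^ q else 0) = ⊤ := by
      rw [eq_top_iff]
      calc ⊤ = ∑' _ : ℕ, (1:ℝ≥0∞) := (ENNReal.tsum_const_eq_top_of_ne_zero one_ne_zero).symm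
        _ ≤ ∑' k : ℕ, (if dy ((k:ℕ):ℤ) < a then (dy ((k:ℕ):ℤ)) ^ q else 0) := by
            apply ENNReal.tsum_le_tsum
            intro k
            rw [h1, if_pos (dy_ne_top _).lt_top]
            apply ENNReal.one_le_rpow _ hq
            rw [← dy_zero]; exact dy_mono (by positivity)
        _ ≤ _ := ENNReal.tsum_comp_le_tsum_of_injective Nat.cast_injective _
    rw [this, ENNReal.mul_top]
    · exact le_top
    · exact (ENNReal.rpow_pos (by norm_num) (by norm_num)).ne'
  · obtain ⟨k, hk1, hk2⟩ := dy_exists h0 h1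
    calc a ^ q ≤ (2 * dy k) ^ q := by gcongr
      _ = 2 ^ q * (dy k) ^ q := ENNReal.mul_rpow_of_nonneg _ _ hq.le
      _ ≤ _ := by
        gcongr
        refine le_trans ?_ (ENNReal.le_tsum k)
        rw [if_pos hk1]

/-- geometric constant -/
def geoC (q : ℝ) : ℝ≥0∞ := ∑' j : ℕ, ((2:ℝ≥0∞) ^ (-q)) ^ j

lemma geoC_lt_top {q : ℝ} (hq : 0 < q) : geoC q < ⊤ := by
  unfold geoC
  rw [ENNReal.tsum_geometric, ENNReal.inv_lt_top, tsub_pos_iff_lt]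
  exact ENNReal.rpow_lt_one_of_one_lt_of_neg (by norm_num) (by linarith)

lemma geoC_one_le (q : ℝ) : 1 ≤ geoC q := by
  refine le_trans ?_ (ENNReal.le_tsum 0)
  simp

lemma dy_natsub (m : ℤ) (j : ℕ) (q : ℝ) :
    dy (m - j) ^ q = dy m ^ q * ((2:ℝ≥0∞) ^ (-q)) ^ j := by
  rw [sub_eq_add_neg, dy_add, ENNReal.mul_rpow_of_ne_top (dy_ne_top _) (dy_ne_top _)]
  congr 1
  unfold dy
  rw [← ENNReal.rpow_intCast, ← ENNReal.rpow_mul, ← ENNReal.rpow_natCast, ← ENNReal.rpow_mul]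
  congr 1; push_cast; ring

/-- sum of a geometric series up to `m` -/
lemma dy_sum_le {q : ℝ} (m : ℤ) (F : ℤ → ℝ≥0∞) (h1 : ∀ k, m < k → F k = 0)
    (h2 : ∀ k, k ≤ m → F k ≤ dy k ^ q) : ∑' k, F k ≤ geoC q * dy m ^ q := by
  have hinj : Function.Injective (fun j : ℕ => m - (j:ℤ)) := by
    intro a b h; simpa using h
  have hs : Function.support F ⊆ range (fun j : ℕ => m - (j:ℤ)) := by
    intro k hk
    have : k ≤ m := by
      by_contra h; exact hk (h1 k (not_le.1 h))
    exact ⟨(m - k).toNat, by simp [Int.toNat_of_nonneg (sub_nonneg.2 this)]⟩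
  rw [← hinj.tsum_eq hs, mul_comm, geoC, ← ENNReal.tsum_mul_left]
  apply ENNReal.tsum_le_tsum
  intro j
  rw [← dy_natsub]
  exact h2 _ (by simp)

open Classical in
lemma dy_upper {q : ℝ} (hq : 0 < q) (a : ℝ≥0∞) :
    ∑' k : ℤ, (if dy k < a then (dy k) ^ q else 0) ≤ geoC q * a ^ q := by
  rcases eq_or_ne a 0 with h0 | h0
  · simp [h0]
  rcases eq_or_ne a ⊤ with h1 | h1
  · rw [h1, ENNReal.top_rpow_of_pos hq, ENNReal.mul_top]
    · exact le_top
    · exact (lt_of_lt_of_le one_pos (geoC_one_le q)).ne'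
  obtain ⟨m, hk1, hk2⟩ := dy_exists h0 h1
  refine (dy_sum_le (q := q) m _ ?_ ?_).trans (by gcongr)
  · intro k hk
    rw [if_neg]
    rw [not_lt]
    refine hk2.trans ?_
    rw [← dy_succ]; exact dy_mono hk
  · intro k hk
    split_ifs
    · exact le_rfl
    · exact bot_le

/-- volume of the unit ball -/
def vb (n : ℕ) : ℝ≥0∞ := volume (Metric.ball (0 : En n) 1)

lemma vb_pos (n : ℕ) : vb n ≠ 0 := (Metric.measure_ball_pos _ _ one_pos).ne'
lemma vb_ne_top (n : ℕ) : vb n ≠ ⊤ := measure_ball_lt_top.ne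
lemma vol_ball (n : ℕ) (x : En n) {r : ℝ} (hr : 0 < r) :
    volume (Metric.ball x r) = ENNReal.ofReal (r ^ n) * vb n := by
  rw [Measure.addHaar_ball_of_pos _ _ hr, finrank_euclideanSpace, Fintype.card_fin]; rfl
lemma vol_cball (n : ℕ) (x : En n) {r : ℝ} (hr : 0 < r) :
    volume (Metric.closedBall x r) = ENNReal.ofReal (r ^ n) * vb n := by
  rw [Measure.addHaar_closedBall _ _ hr.le, finrank_euclideanSpace, Fintype.card_fin]; rfl
lemma vol_ball_ne_zero (n : ℕ) (x : En n) {r : ℝ} (hr : 0 < r) :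
    volume (Metric.ball x r) ≠ 0 := (Metric.measure_ball_pos _ _ hr).ne'
lemma vol_ball_ne_top (n : ℕ) (x : En n) (r : ℝ) :
    volume (Metric.ball x r) ≠ ⊤ := measure_ball_lt_top.ne
lemma vol_ball_mul (n : ℕ) (x y : En n) {r c : ℝ} (hr : 0 < r) (hc : 0 < c) :
    volume (Metric.ball x (c * r)) = ENNReal.ofReal (c ^ n) * volume (Metric.ball y r) := by
  rw [vol_ball n x (by positivity), vol_ball n y hr, mul_pow, ENNReal.ofReal_mul (by positivity),
    mul_assoc]

/-- Hardy–Littlewood maximal function -/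
def hl (n : ℕ) (v : En n → ℝ≥0∞) (x : En n) : ℝ≥0∞ :=
  ⨆ (r : ℝ) (_ : 0 < r), (volume (Metric.ball x r))⁻¹ * ∫⁻ y in Metric.ball x r, v y

lemma hl_ball {n : ℕ} (v : En n → ℝ≥0∞) (x : En n) {r : ℝ} (hr : 0 < r) :
    ∫⁻ y in Metric.ball x r, v y ≤ volume (Metric.ball x r) * hl n v x := by
  have : (volume (Metric.ball x r))⁻¹ * ∫⁻ y in Metric.ball x r, v y ≤ hl n v x :=
    le_iSup₂_of_le r hr le_rfl
  calc _ = volume (Metric.ball x r) * ((volume (Metric.ball x r))⁻¹ * ∫⁻ y in Metric.ball x r, v y) := by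
        rw [← mul_assoc, ENNReal.mul_inv_cancel (vol_ball_ne_zero n x hr) (vol_ball_ne_top n x r),
          one_mul]
    _ ≤ _ := by gcongr

lemma hl_weak {n : ℕ} (hn : 1 ≤ n) (v : En n → ℝ≥0∞) (l : ℝ≥0∞) :
    l * volume {x | l < hl n v x} ≤ 5 ^ n * ∫⁻ y, v y := by
  rcases eq_or_ne l 0 with h0 | h0
  · simp [h0]
  rcases eq_or_ne l ⊤ with h1 | h1
  · simp [h1]
  rcases eq_or_ne (∫⁻ y, v y) ⊤ with hv | hv
  · rw [hv, ENNReal.mul_top (by positivity)]; exact le_top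
  have hex : ∀ x ∈ {x | l < hl n v x}, ∃ r : ℝ, 0 < r ∧
      l * volume (Metric.ball x r) ≤ ∫⁻ y in Metric.ball x r, v y := by
    intro x hx
    simp only [mem_ofPred_eq, hl, lt_iSup_iff] at hx
    obtain ⟨r, hr, hlt⟩ := hx
    refine ⟨r, hr, ?_⟩
    calc l * volume (Metric.ball x r) ≤
        ((volume (Metric.ball x r))⁻¹ * ∫⁻ y in Metric.ball x r, v y) * volume (Metric.ball x r) := by
          gcongr
      _ = _ := by
          rw [mul_comm, ← mul_assoc, ENNReal.mul_inv_cancel (vol_ball_ne_zero n x hr)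
            (vol_ball_ne_top n x r), one_mul]
  choose! r hr hlr using hex
  set S := ((∫⁻ y, v y) / (l * vb n)).toReal with hS
  have hb : ∀ x ∈ {x | l < hl n v x}, r x ≤ max 1 S := by
    intro x hx
    by_contra hcon
    rw [not_le, max_lt_iff] at hcon
    have h2 := (hlr x hx).trans (setLIntegral_le_lintegral _ _)
    rw [vol_ball n x (hr x hx)] at h2
    have h3 : ENNReal.ofReal (r x ^ n) ≤ (∫⁻ y, v y) / (l * vb n) := by
      rw [ENNReal.le_div_iff_mul_le (Or.inl (mul_ne_zero h0 (vb_pos n)))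
        (Or.inl (ENNReal.mul_ne_top h1 (vb_ne_top n)))]
      calc _ = _ := by ring
        _ ≤ _ := h2
    have h4 : r x ^ n ≤ S := by
      rw [hS]
      exact (ENNReal.ofReal_le_iff_le_toReal
        (ENNReal.div_ne_top hv (mul_ne_zero h0 (vb_pos n)))).1 h3
    have h5 : r x ≤ r x ^ n := le_self_pow₀ hcon.1.le (by omega)
    linarith [hcon.2]
  obtain ⟨u, hu, hdis, hcov⟩ := Vitali.exists_disjoint_subfamily_covering_enlargement_closedBall
    {x | l < hl n v x} id r _ hb 5 (by norm_num)
  have hcount : u.Countable := by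
    apply hdis.countable_of_nonempty_interior
    intro a ha
    refine ⟨a, mem_interior.2 ⟨Metric.ball a (r a), Metric.ball_subset_closedBall, Metric.isOpen_ball,
      Metric.mem_ball_self (hr a (hu ha))⟩⟩
  have hsub : {x | l < hl n v x} ⊆ ⋃ b ∈ u, Metric.closedBall b (5 * r b) := by
    intro x hx
    obtain ⟨b, hb, hb2⟩ := hcov x hx
    exact mem_iUnion₂.2 ⟨b, hb, hb2 (Metric.mem_closedBall_self (hr x hx).le)⟩
  have hdis' : u.PairwiseDisjoint (fun a => Metric.ball a (r a)) :=
    hdis.mono_on (fun a _ => Metric.ball_subset_closedBall)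
  have : Countable u := hcount.to_subtype
  calc l * volume {x | l < hl n v x} ≤ l * ∑' b : u, volume (Metric.closedBall (b : En n) (5 * r b)) := by
        gcongr
        exact (measure_mono hsub).trans (measure_biUnion_le _ hcount _)
    _ = ∑' b : u, l * volume (Metric.closedBall (b : En n) (5 * r b)) := ENNReal.tsum_mul_left.symm
    _ ≤ ∑' b : u, 5 ^ n * ∫⁻ y in Metric.ball (b : En n) (r b), v y := by
        apply ENNReal.tsum_le_tsum
        intro b
        have hrb := hr b (hu b.2)
        have h6 := hlr b (hu b.2)
        rw [vol_ball n _ hrb] at h6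
        rw [vol_cball n _ (by positivity), mul_pow, ENNReal.ofReal_mul (by positivity)]
        rw [show ENNReal.ofReal ((5:ℝ) ^ n) = 5 ^ n by
          rw [ENNReal.ofReal_pow (by norm_num)]; norm_num]
        calc _ = 5 ^ n * (l * (ENNReal.ofReal (r b ^ n) * vb n)) := by ring
          _ ≤ _ := by gcongr
    _ = 5 ^ n * ∑' b : u, ∫⁻ y in Metric.ball (b : En n) (r b), v y := ENNReal.tsum_mul_left
    _ = 5 ^ n * ∫⁻ y in ⋃ b ∈ u, Metric.ball b (r b), v y := by
        rw [lintegral_biUnion hcount (fun _ _ => Metric.isOpen_ball.measurableSet) hdis']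
    _ ≤ _ := by
        gcongr
        exact Measure.restrict_le_self
end P7body

section P8body
open MeasureTheory Real Set
open scoped ENNReal NNReal FourierTransform SchwartzMap

lemma ker_le_sum {n : ℕ} {a t : ℝ} (ha : 0 ≤ a) (ht : 0 < t) (z : En n) :
    ker n a t z ≤ ∑' i : ℕ, ENNReal.ofReal ((t ^ n)⁻¹ * (2 ^ a * 2 ^ (-(i * a)))) *
      (Metric.ball (0 : En n) (2 ^ i * t)).indicator 1 z := by
  have hex : ∃ i : ℕ, ‖z‖ < 2 ^ i * t := by
    obtain ⟨i, hi⟩ := pow_unbounded_of_one_lt (‖z‖ / t) (one_lt_two)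
    exact ⟨i, by rwa [div_lt_iff₀ ht] at hi⟩
  classical
  set i := Nat.find hex with hi
  have h1 : ‖z‖ < 2 ^ i * t := Nat.find_spec hex
  refine le_trans ?_ (ENNReal.le_tsum i)
  rw [indicator_of_mem (by simpa using h1)]
  simp only [Pi.one_apply, mul_one]
  unfold ker
  apply ENNReal.ofReal_le_ofReal
  gcongr
  rw [← Real.rpow_add two_pos]
  rcases Nat.eq_zero_or_pos i with h0 | h0
  · rw [h0]
    calc (1 + ‖z‖ / t) ^ (-a) ≤ 1 := by
          apply Real.rpow_le_one_of_one_le_of_nonpos _ (by linarith)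
          have : 0 ≤ ‖z‖ / t := by positivity
          linarith
      _ ≤ _ := by
          apply Real.one_le_rpow (by norm_num)
          simp [ha]
  · have h2 : ¬ (‖z‖ < 2 ^ (i-1) * t) := Nat.find_min hex (by omega)
    rw [not_lt] at h2
    have h3 : (2:ℝ) ^ (i - 1) ≤ 1 + ‖z‖ / t := by
      rw [← le_div_iff₀ ht] at h2; linarith
    calc (1 + ‖z‖ / t) ^ (-a) ≤ ((2:ℝ) ^ (i-1)) ^ (-a) :=
          Real.rpow_le_rpow_of_nonpos (by positivity) h3 (by linarith)
      _ = 2 ^ (a + -(i * a)) := by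
          rw [← Real.rpow_natCast, ← Real.rpow_mul (by norm_num)]
          congr 1
          rw [Nat.cast_sub (by omega)]; push_cast; ring

lemma ker_avg {n : ℕ} {a : ℝ} (ha : n < a) : ∃ C : ℝ≥0, ∀ (t : ℝ), 0 < t →
    ∀ (v : En n → ℝ≥0∞), Measurable v → ∀ (x : En n) (M : ℝ≥0∞),
      (∀ s, t ≤ s → ∫⁻ y in Metric.ball x s, v y ≤ volume (Metric.ball x s) * M) →
      ∫⁻ y, ker n a t (x - y) * v y ≤ C * M := by
  have ha0 : 0 ≤ a := le_trans (by positivity) ha.le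
  have hg := geoC_lt_top (q := a - n) (by linarith)
  set K := ENNReal.ofReal (2 ^ a) * vb n * geoC (a - n) with hK
  have hKt : K ≠ ⊤ := ENNReal.mul_ne_top (ENNReal.mul_ne_top ENNReal.ofReal_ne_top (vb_ne_top n)) hg.ne
  refine ⟨K.toNNReal, fun t ht v hv x M hM => ?_⟩
  rw [ENNReal.coe_toNNReal hKt]
  calc ∫⁻ y, ker n a t (x - y) * v y ≤ ∫⁻ y, ∑' i : ℕ,
        ENNReal.ofReal ((t ^ n)⁻¹ * (2 ^ a * 2 ^ (-(i * a)))) *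
        (Metric.ball x (2 ^ i * t)).indicator v y := by
        apply lintegral_mono; intro y
        dsimp only
        refine (mul_le_mul' (ker_le_sum ha0 ht (x - y)) le_rfl).trans ?_
        rw [← ENNReal.tsum_mul_right]
        apply ENNReal.tsum_le_tsum
        intro i
        rw [mul_assoc]
        gcongr
        by_cases h : y ∈ Metric.ball x (2 ^ i * t)
        · rw [indicator_of_mem h]
          refine (mul_le_mul' (indicator_le_self _ _ _) le_rfl).trans ?_
          simp
        · rw [indicator_of_notMem (s := Metric.ball (0 : En n) (2 ^ i * t))]
          · simp
          · intro h'; apply h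
            rw [Metric.mem_ball, dist_comm, dist_eq_norm]; simpa using h'
    _ = ∑' i : ℕ, ENNReal.ofReal ((t ^ n)⁻¹ * (2 ^ a * 2 ^ (-(i * a)))) *
        ∫⁻ y in Metric.ball x (2 ^ i * t), v y := by
        rw [lintegral_tsum]
        · congr 1; ext i
          rw [lintegral_const_mul' _ _ ENNReal.ofReal_ne_top,
            lintegral_indicator Metric.isOpen_ball.measurableSet]
        · intro i
          exact ((hv.indicator Metric.isOpen_ball.measurableSet).const_mul _).aemeasurable
    _ ≤ ∑' i : ℕ, ENNReal.ofReal (2 ^ a) * vb n * M * ((2:ℝ≥0∞) ^ (-(a - n))) ^ i := by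
        apply ENNReal.tsum_le_tsum
        intro i
        refine (mul_le_mul' le_rfl (hM _ (le_mul_of_one_le_left ht.le (one_le_pow₀ one_le_two)))).trans ?_
        rw [vol_ball n x (by positivity)]
        have e1 : ENNReal.ofReal ((t ^ n)⁻¹ * (2 ^ a * 2 ^ (-(i * a)))) * ENNReal.ofReal ((2 ^ i * t) ^ n)
            = ENNReal.ofReal (2 ^ a) * ((2:ℝ≥0∞) ^ (-(a - n))) ^ i := by
          have : ((2:ℝ≥0∞) ^ (-(a - n))) ^ i = ENNReal.ofReal (2 ^ (-(a - n) * i)) := by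
            rw [← ENNReal.ofReal_rpow_of_pos two_pos, ENNReal.rpow_mul, ENNReal.rpow_natCast]
            simp
          rw [this, ← ENNReal.ofReal_mul (by positivity), ← ENNReal.ofReal_mul (by positivity)]
          congr 1
          have e2 : (2:ℝ) ^ (-(a - n) * i) = 2 ^ (-(i * a)) * (2 ^ i) ^ n := by
            rw [← pow_mul, ← Real.rpow_natCast, ← Real.rpow_add two_pos]
            congr 1; push_cast; ring
          rw [e2, mul_pow]; field_simp
        rw [← mul_assoc, ← mul_assoc, e1]
        apply le_of_eq; ring
    _ = K * M := by
        rw [ENNReal.tsum_mul_left, hK]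
        change _ * geoC (a - n) = _
        ring

lemma ker_hl {n : ℕ} {a : ℝ} (ha : n < a) : ∃ C : ℝ≥0, ∀ (t : ℝ), 0 < t →
    ∀ (v : En n → ℝ≥0∞), Measurable v → ∀ x,
      ∫⁻ y, ker n a t (x - y) * v y ≤ C * hl n v x := by
  obtain ⟨C, hC⟩ := ker_avg ha
  exact ⟨C, fun t ht v hv x => hC t ht v hv x _ fun s hs => hl_ball v x (ht.trans_le hs)⟩

/-- the Peetre maximal function -/
def mss {n : ℕ} (L : ℕ) (Φ f : 𝓢(En n, ℂ)) (x : En n) : ℝ≥0∞ :=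
  ⨆ (t : ℝ) (_ : 0 < t) (z : En n), ‖cv Φ t f z‖ₑ * ENNReal.ofReal ((1 + ‖x - z‖ / t) ^ (-(L:ℝ)))

lemma mss_ge {n : ℕ} (L : ℕ) (Φ f : 𝓢(En n, ℂ)) (x z : En n) {t : ℝ} (ht : 0 < t) :
    ‖cv Φ t f z‖ₑ ≤ mss L Φ f x * ENNReal.ofReal ((1 + ‖x - z‖ / t) ^ (L:ℝ)) := by
  have h : ‖cv Φ t f z‖ₑ * ENNReal.ofReal ((1 + ‖x - z‖ / t) ^ (-(L:ℝ))) ≤ mss L Φ f x :=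
    le_iSup₂_of_le t ht (le_iSup_of_le z le_rfl)
  refine le_trans ?_ (mul_le_mul' h le_rfl)
  rw [mul_assoc, ← ENNReal.ofReal_mul (by positivity), ← Real.rpow_add (by positivity)]
  simp

lemma mss_lt_top {n : ℕ} (L : ℕ) (Φ f : 𝓢(En n, ℂ)) (x : En n) : mss L Φ f x < ⊤ := by
  obtain ⟨C, hC⟩ := cv_le Φ ((n:ℝ) + 1)
  have hS : ∀ y, ‖f y‖ₑ ≤ ENNReal.ofReal (SchwartzMap.seminorm ℝ 0 0 f) := by
    intro y
    rw [← ofReal_norm]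
    exact ENNReal.ofReal_le_ofReal (SchwartzMap.norm_le_seminorm ℝ f y)
  have hm : kerMass n ((n:ℝ) + 1) < ⊤ := kerMass_lt_top n (by linarith)
  refine lt_of_le_of_lt (b := C * (kerMass n ((n:ℝ)+1) * ENNReal.ofReal (SchwartzMap.seminorm ℝ 0 0 f))) ?_ ?_
  · refine iSup₂_le fun t ht => iSup_le fun z => ?_
    calc _ ≤ ‖cv Φ t f z‖ₑ * 1 := by
          gcongr
          rw [← ENNReal.ofReal_one]
          apply ENNReal.ofReal_le_ofReal
          apply Real.rpow_le_one_of_one_le_of_nonpos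
          · have : 0 ≤ ‖x - z‖ / t := by positivity
            linarith
          · simp
      _ ≤ C * ∫⁻ y, ker n ((n:ℝ)+1) t (z - y) * ‖f y‖ₑ := by rw [mul_one]; exact hC t ht f z
      _ ≤ _ := by
          gcongr
          rw [← ker_lint_sub n ((n:ℝ)+1) ht z, ← lintegral_mul_const' _ _ ENNReal.ofReal_ne_top]
          apply lintegral_mono; intro y
          exact mul_le_mul' le_rfl (hS y)
  · exact ENNReal.mul_lt_top ENNReal.coe_lt_top (ENNReal.mul_lt_top hm ENNReal.ofReal_lt_top)

lemma rpow_split {a : ℝ≥0∞} {r : ℝ} (h0 : 0 ≤ r) (h1 : r ≤ 1) : a = a ^ r * a ^ (1 - r) := by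
  rw [← ENNReal.rpow_add_of_nonneg _ _ h0 (by linarith)]; simp

lemma mss_hl {n : ℕ} (Φ : 𝓢(En n, ℂ)) (hΦ : ∀ ξ, ‖ξ‖ ≤ 2 → 𝓕 Φ ξ ≠ 0) (L : ℕ) {r : ℝ}
    (hr0 : 0 < r) (hr1 : r ≤ 1) (hL : 1 ≤ L) (hLr : n < L * r) :
    ∃ C : ℝ≥0, ∀ (f : 𝓢(En n, ℂ)) (u : En n → ℝ≥0∞), Measurable u →
      (∀ t, 0 < t → ∀ y, ‖cv Φ t f y‖ₑ ≤ u y) → ∀ x,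
      mss L Φ f x ^ r ≤ C * hl n (fun y => u y ^ r) x := by
  obtain ⟨C, hC⟩ := repro Φ hΦ L
  obtain ⟨D, hD⟩ := ker_hl hLr
  refine ⟨C * 2 * D, fun f u hu hfu x => ?_⟩
  set M := mss L Φ f x with hM
  have hMt : M ≠ ⊤ := (mss_lt_top L Φ f x).ne
  set H := hl n (fun y => u y ^ r) x with hH
  have main : M ≤ (C * 2 * D : ℝ≥0) * H * M ^ (1 - r) := by
    refine iSup₂_le fun t ht => iSup_le fun z => ?_
    refine (mul_le_mul' (hC f t ht z) le_rfl).trans ?_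
    have key : ∀ j : ℕ, (((4:ℝ≥0∞) ^ L)⁻¹) ^ j *
        (∫⁻ y, ker n L t (z - y) * ‖cv Φ (t / 2 ^ j) f y‖ₑ) *
          ENNReal.ofReal ((1 + ‖x - z‖ / t) ^ (-(L:ℝ))) ≤ (2⁻¹:ℝ≥0∞) ^ j * (M ^ (1-r) * (D * H)) := by
      intro j
      have hpt : ∀ y, ker n L t (z - y) * ‖cv Φ (t / 2 ^ j) f y‖ₑ *
          ENNReal.ofReal ((1 + ‖x - z‖ / t) ^ (-(L:ℝ))) ≤
          (2 ^ (j * L) * M ^ (1-r)) * (ker n (L * r) t (x - y) * u y ^ r) := by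
        intro y
        have htj : 0 < t / 2 ^ j := by positivity
        have hb := mss_ge L Φ f x y htj
        have p1 : 0 < 1 + ‖x - y‖ / t := by positivity
        have hb2 : ‖cv Φ (t / 2 ^ j) f y‖ₑ ^ (1-r) ≤ M ^ (1-r) * (2 ^ (j * L) *
            ENNReal.ofReal ((1 + ‖x - y‖ / t) ^ (L * (1 - r)))) := by
          refine (ENNReal.rpow_le_rpow hb (by linarith : 0 ≤ 1 - r)).trans ?_
          rw [ENNReal.mul_rpow_of_nonneg _ _ (by linarith : 0 ≤ 1 - r)]
          gcongr
          rw [ENNReal.ofReal_rpow_of_nonneg (by positivity) (by linarith), ← Real.rpow_mul (by positivity)]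
          rw [show (2:ℝ≥0∞) ^ (j * L) = ENNReal.ofReal (2 ^ (j * L)) by
            rw [ENNReal.ofReal_pow (by norm_num)]; norm_num, ← ENNReal.ofReal_mul (by positivity)]
          apply ENNReal.ofReal_le_ofReal
          have h2 : 1 + ‖x - y‖ / (t / 2 ^ j) ≤ 2 ^ j * (1 + ‖x - y‖ / t) := by
            have e : ‖x - y‖ / (t / 2 ^ j) = 2 ^ j * (‖x - y‖ / t) := by field_simp
            rw [e, mul_add]
            have : (1:ℝ) ≤ 2 ^ j := one_le_pow₀ (by norm_num)
            linarith
          have hL1 : 0 ≤ (L:ℝ) * (1 - r) := mul_nonneg (by positivity) (by linarith)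
          calc _ ≤ (2 ^ j * (1 + ‖x - y‖ / t)) ^ ((L:ℝ) * (1 - r)) := by
                exact Real.rpow_le_rpow (by positivity) h2 hL1
            _ = (2 ^ j) ^ ((L:ℝ) * (1 - r)) * (1 + ‖x - y‖ / t) ^ ((L:ℝ) * (1 - r)) :=
                Real.mul_rpow (by positivity) (by positivity)
            _ ≤ _ := by
                gcongr
                calc ((2:ℝ) ^ j) ^ ((L:ℝ) * (1 - r)) ≤ (2 ^ j) ^ (L:ℝ) := by
                      apply Real.rpow_le_rpow_of_exponent_le (one_le_pow₀ (by norm_num))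
                      have : (0:ℝ) ≤ L * r := by positivity
                      nlinarith
                  _ = _ := by rw [Real.rpow_natCast, pow_mul]
        have hk : ker n L t (z - y) * ENNReal.ofReal ((1 + ‖x - z‖ / t) ^ (-(L:ℝ))) *
            ENNReal.ofReal ((1 + ‖x - y‖ / t) ^ (L * (1 - r))) ≤ ker n (L * r) t (x - y) := by
          unfold ker
          rw [← ENNReal.ofReal_mul (by positivity), ← ENNReal.ofReal_mul (by positivity)]
          apply ENNReal.ofReal_le_ofReal
          have tr := ker_triangle ht x y z
          have h4 : (1 + ‖z - y‖ / t) ^ (-(L:ℝ)) * (1 + ‖x - z‖ / t) ^ (-(L:ℝ)) ≤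
              (1 + ‖x - y‖ / t) ^ (-(L:ℝ)) := by
            rw [← Real.mul_rpow (by positivity) (by positivity)]
            apply Real.rpow_le_rpow_of_nonpos p1 _ (by simp)
            rw [mul_comm]; exact tr
          calc _ = (t ^ n)⁻¹ * ((1 + ‖z - y‖ / t) ^ (-(L:ℝ)) * (1 + ‖x - z‖ / t) ^ (-(L:ℝ))) *
                (1 + ‖x - y‖ / t) ^ (L * (1 - r)) := by ring
            _ ≤ (t ^ n)⁻¹ * (1 + ‖x - y‖ / t) ^ (-(L:ℝ)) * (1 + ‖x - y‖ / t) ^ (L * (1 - r)) := by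
                gcongr
            _ = _ := by
                rw [mul_assoc, ← Real.rpow_add p1]
                congr 2; ring
        calc _ = ker n L t (z - y) * (‖cv Φ (t / 2 ^ j) f y‖ₑ ^ r * ‖cv Φ (t / 2 ^ j) f y‖ₑ ^ (1-r)) *
              ENNReal.ofReal ((1 + ‖x - z‖ / t) ^ (-(L:ℝ))) := by
                rw [← rpow_split hr0.le hr1]
          _ ≤ ker n L t (z - y) * (u y ^ r * (M ^ (1-r) * (2 ^ (j * L) *
                ENNReal.ofReal ((1 + ‖x - y‖ / t) ^ (L * (1 - r)))))) *
              ENNReal.ofReal ((1 + ‖x - z‖ / t) ^ (-(L:ℝ))) := by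
                gcongr
                exact hfu _ htj y
          _ = (2 ^ (j * L) * M ^ (1-r)) * ((ker n L t (z - y) * ENNReal.ofReal ((1 + ‖x - z‖ / t) ^ (-(L:ℝ))) *
            ENNReal.ofReal ((1 + ‖x - y‖ / t) ^ (L * (1 - r)))) * u y ^ r) := by ring
          _ ≤ _ := by
                exact mul_le_mul' le_rfl (mul_le_mul' hk le_rfl)
      have hIntg0 : (∫⁻ y, ker n L t (z - y) * ‖cv Φ (t / 2 ^ j) f y‖ₑ) *
          ENNReal.ofReal ((1 + ‖x - z‖ / t) ^ (-(L:ℝ))) ≤ (2 ^ (j * L) * M ^ (1-r)) * (D * H) := by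
        rw [← lintegral_mul_const' _ _ ENNReal.ofReal_ne_top]
        refine (lintegral_mono hpt).trans ?_
        have hne : (2:ℝ≥0∞) ^ (j * L) * M ^ (1-r) ≠ ⊤ :=
          ENNReal.mul_ne_top (by simp) (ENNReal.rpow_ne_top_of_nonneg (by linarith) hMt)
        rw [lintegral_const_mul' _ _ hne]
        exact mul_le_mul' le_rfl (hD t ht _ (hu.pow_const r) x)
      rw [mul_assoc]
      refine (mul_le_mul' le_rfl hIntg0).trans ?_
      have e5 : (((4:ℝ≥0∞) ^ L)⁻¹) ^ j * 2 ^ (j * L) ≤ 2⁻¹ ^ j := by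
        have : (((4:ℝ≥0∞) ^ L)⁻¹) ^ j * 2 ^ (j * L) = ((2⁻¹:ℝ≥0∞) ^ L) ^ j := by
          rw [mul_comm j L, pow_mul, ← mul_pow]
          congr 1
          rw [show ((4:ℝ≥0∞) ^ L)⁻¹ = (4⁻¹) ^ L by simp only [ENNReal.inv_pow], ← mul_pow]
          congr 1
          rw [show (4:ℝ≥0∞) = 2 * 2 by norm_num, ENNReal.mul_inv (by simp) (by simp), mul_assoc,
            ENNReal.inv_mul_cancel (by simp) (by simp), mul_one]
        rw [this]
        gcongr
        calc (2⁻¹:ℝ≥0∞) ^ L ≤ 2⁻¹ ^ 1 := pow_le_pow_of_le_one (by simp) (by simp) hL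
          _ = _ := pow_one _
      calc _ = ((((4:ℝ≥0∞) ^ L)⁻¹) ^ j * 2 ^ (j * L)) * (M ^ (1-r) * (D * H)) := by ring
        _ ≤ 2⁻¹ ^ j * (M ^ (1-r) * (D * H)) := by gcongr
        _ = _ := by ring
    rw [mul_assoc, ← ENNReal.tsum_mul_right]
    calc _ ≤ C * ∑' j : ℕ, (2⁻¹:ℝ≥0∞) ^ j * (M ^ (1-r) * (D * H)) := by
          exact mul_le_mul' le_rfl (ENNReal.tsum_le_tsum key)
      _ = _ := by
          rw [ENNReal.tsum_mul_right, ENNReal.tsum_geometric, ENNReal.one_sub_inv_two, inv_inv]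
          push_cast; ring
  rcases eq_or_ne M 0 with h0 | h0
  · rw [h0, ENNReal.zero_rpow_of_pos hr0]; exact bot_le
  · have hne : M ^ (1 - r) ≠ 0 := (ENNReal.rpow_pos (pos_iff_ne_zero.2 h0) hMt).ne'
    have hnt : M ^ (1 - r) ≠ ⊤ := ENNReal.rpow_ne_top_of_nonneg (by linarith) hMt
    rw [← ENNReal.mul_le_mul_iff_left hne hnt, ← rpow_split hr0.le hr1]
    exact main

/-- nontangential maximal function -/
def gmax {n : ℕ} (η f : 𝓢(En n, ℂ)) (x : En n) : ℝ≥0∞ :=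
  ⨆ (t : ℝ) (_ : 0 < t) (z : En n) (_ : dist x z < t), ‖cv η t f z‖ₑ

lemma gmax_ge {n : ℕ} (η f : 𝓢(En n, ℂ)) (x z : En n) {t : ℝ} (ht : 0 < t) (h : dist x z < t) :
    ‖cv η t f z‖ₑ ≤ gmax η f x :=
  le_iSup₂_of_le t ht (le_iSup₂_of_le z h le_rfl)

lemma gmax_open {n : ℕ} (η f : 𝓢(En n, ℂ)) (l : ℝ≥0∞) : IsOpen {x | l < gmax η f x} := by
  rw [Metric.isOpen_iff]
  intro x hx
  simp only [mem_ofPred_eq, gmax, lt_iSup_iff] at hx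
  obtain ⟨t, ht, z, hz, hlt⟩ := hx
  refine ⟨t - dist x z, by linarith, fun y hy => ?_⟩
  have : dist y z < t := by
    have := dist_triangle y x z
    rw [Metric.mem_ball] at hy
    linarith
  exact lt_of_lt_of_le hlt (gmax_ge η f y z ht this)

lemma gmax_meas {n : ℕ} (η f : 𝓢(En n, ℂ)) : Measurable (gmax η f) :=
  measurable_of_Ioi (fun l => (gmax_open η f l).measurableSet)

lemma radMax_meas {n : ℕ} (Φ f : 𝓢(En n, ℂ)) : Measurable (radMax n Φ f) := by
  have : LowerSemicontinuous (radMax n Φ f) := by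
    have e : radMax n Φ f = fun x => ⨆ (t : ℝ) (_ : 0 < t), ‖cv Φ t f x‖ₑ := by
      ext x; exact radMax_eq Φ f x
    rw [e]
    exact lowerSemicontinuous_iSup fun t => lowerSemicontinuous_iSup fun _ =>
      (cv Φ t f).continuous.enorm.lowerSemicontinuous
  exact this.measurable

lemma gmax_mss {n : ℕ} {Φ η Θ : 𝓢(En n, ℂ)} (hη : ∀ ξ, 𝓕 η ξ = chi n ξ)
    (hΘ : ∀ ξ, chi n ξ = 𝓕 Θ ξ * 𝓕 Φ ξ) (L : ℕ) :
    ∃ C : ℝ≥0, ∀ (f : 𝓢(En n, ℂ)) x, gmax η f x ≤ C * mss L Φ f x := by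
  obtain ⟨C, hC⟩ := cv_le Θ ((L:ℝ) + (n + 1))
  have hm : kerMass n ((n:ℝ) + 1) < ⊤ := kerMass_lt_top n (by linarith)
  refine ⟨C * 2 ^ L * (kerMass n ((n:ℝ) + 1)).toNNReal, fun f x => ?_⟩
  push_cast
  rw [ENNReal.coe_toNNReal hm.ne]
  refine iSup₂_le fun t ht => iSup₂_le fun z hz => ?_
  rw [cv_eta_eq hη hΘ ht]
  refine (hC t ht _ z).trans ?_
  rw [mul_assoc, mul_assoc]
  gcongr
  have hpt : ∀ y, ker n ((L:ℝ) + (n + 1)) t (z - y) * ‖cv Φ t f y‖ₑ ≤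
      (2 ^ L * mss L Φ f x) * ker n ((n:ℝ)+1) t (z - y) := by
    intro y
    refine (mul_le_mul' le_rfl (mss_ge L Φ f x y ht)).trans ?_
    have : ker n ((L:ℝ) + (n + 1)) t (z - y) * ENNReal.ofReal ((1 + ‖x - y‖ / t) ^ (L:ℝ)) ≤
        2 ^ L * ker n ((n:ℝ)+1) t (z - y) := by
      unfold ker
      rw [show (2:ℝ≥0∞) ^ L = ENNReal.ofReal (2 ^ L) by
            rw [ENNReal.ofReal_pow (by norm_num)]; norm_num, ← ENNReal.ofReal_mul (by positivity),
            ← ENNReal.ofReal_mul (by positivity)]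
      apply ENNReal.ofReal_le_ofReal
      have p1 : 0 < 1 + ‖z - y‖ / t := by positivity
      have h1 : 1 + ‖x - y‖ / t ≤ 2 * (1 + ‖z - y‖ / t) := by
        refine (ker_triangle ht x y z).trans ?_
        gcongr
        have : ‖x - z‖ / t ≤ 1 := by
          rw [div_le_one ht, ← dist_eq_norm]; exact hz.le
        linarith
      have h2 : (1 + ‖x - y‖ / t) ^ (L:ℝ) ≤ 2 ^ L * (1 + ‖z - y‖ / t) ^ (L:ℝ) := by
        refine (Real.rpow_le_rpow (by positivity) h1 (by positivity)).trans ?_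
        rw [Real.mul_rpow (by norm_num) p1.le, Real.rpow_natCast 2]
      calc _ ≤ (t ^ n)⁻¹ * (1 + ‖z - y‖ / t) ^ (-((L:ℝ) + (n + 1))) * (2 ^ L * (1 + ‖z - y‖ / t) ^ (L:ℝ)) := by
            gcongr
        _ = 2 ^ L * ((t ^ n)⁻¹ * ((1 + ‖z - y‖ / t) ^ (-((L:ℝ) + (n + 1))) * (1 + ‖z - y‖ / t) ^ (L:ℝ))) := by
            ring
        _ = _ := by
            rw [← Real.rpow_add p1]; congr 3; ring
    calc _ = mss L Φ f x * (ker n ((L:ℝ) + (n + 1)) t (z - y) * ENNReal.ofReal ((1 + ‖x - y‖ / t) ^ (L:ℝ))) := by ring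
      _ ≤ mss L Φ f x * (2 ^ L * ker n ((n:ℝ)+1) t (z - y)) := mul_le_mul' le_rfl this
      _ = _ := by ring
  refine (lintegral_mono hpt).trans ?_
  rw [lintegral_const_mul' _ _ (ENNReal.mul_ne_top (by simp) (mss_lt_top L Φ f x).ne),
    ker_lint_sub n _ ht]
  apply le_of_eq; ring

/-- The conclusion of the Fourier-analytic part. -/
lemma gmax_hl {n : ℕ} (Φ : 𝓢(En n, ℂ)) (hΦ : (∫ x, Φ x) ≠ 0) {r : ℝ}
    (hr0 : 0 < r) (hr1 : r ≤ 1) :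
    ∃ C : ℝ≥0, ∀ (η : 𝓢(En n, ℂ)), (∀ ξ, 𝓕 η ξ = chi n ξ) → ∀ (f : 𝓢(En n, ℂ)) x,
      gmax η f x ^ r ≤ C * hl n (fun y => radMax n Φ f y ^ r) x := by
  obtain ⟨Φ₁, h1, h2⟩ := exists_rescale Φ hΦ
  obtain ⟨L, hL⟩ := exists_nat_gt (n / r + 1)
  have hn0 : 0 ≤ (n:ℝ) / r := by positivity
  have hL1 : 1 ≤ L := by
    have : (1:ℝ) ≤ L := by linarith
    exact_mod_cast this
  have hLr : (n:ℝ) < L * r := by rw [← div_lt_iff₀ hr0]; linarith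
  obtain ⟨Θ, hΘ⟩ := exists_theta Φ₁ h1
  obtain ⟨η₀, hη₀⟩ := exists_eta n
  obtain ⟨C, hC⟩ := mss_hl Φ₁ h1 L hr0 hr1 hL1 hLr
  obtain ⟨D, hD⟩ := gmax_mss hη₀ hΘ L
  refine ⟨D ^ r * C, fun η hη f x => ?_⟩
  have : η = η₀ := schwartz_ext_fourier (fun ξ => by rw [hη, hη₀])
  subst this
  calc gmax η f x ^ r ≤ (D * mss L Φ₁ f x) ^ r := by gcongr; exact hD f x
    _ = D ^ r * mss L Φ₁ f x ^ r := ENNReal.mul_rpow_of_nonneg _ _ hr0.le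
    _ ≤ D ^ r * (C * hl n (fun y => radMax n Φ f y ^ r) x) := by
        gcongr
        exact hC f _ (radMax_meas Φ f) (h2 f) x
    _ = _ := by
        rw [← mul_assoc, ENNReal.coe_mul, ENNReal.coe_rpow_of_nonneg _ hr0.le]
end P8body

section P9body
open MeasureTheory Real Set
open scoped ENNReal NNReal FourierTransform SchwartzMap Convolution

lemma hl_add_const {n : ℕ} {v w : En n → ℝ≥0∞} (hw : Measurable w) (l : ℝ≥0∞)
    (h : ∀ x, v x ≤ w x + l) (x : En n) : hl n v x ≤ hl n w x + l := by
  refine iSup₂_le fun r hr => ?_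
  have h1 : ∫⁻ y in Metric.ball x r, v y ≤
      (∫⁻ y in Metric.ball x r, w y) + l * volume (Metric.ball x r) := by
    calc _ ≤ ∫⁻ y in Metric.ball x r, (w y + l) := lintegral_mono fun y => h y
      _ = _ := by rw [lintegral_add_left hw, setLIntegral_const]
  calc _ ≤ (volume (Metric.ball x r))⁻¹ * ((∫⁻ y in Metric.ball x r, w y) +
        l * volume (Metric.ball x r)) := by gcongr
    _ = (volume (Metric.ball x r))⁻¹ * (∫⁻ y in Metric.ball x r, w y) +
        l * ((volume (Metric.ball x r))⁻¹ * volume (Metric.ball x r)) := by ring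
    _ ≤ _ := by
      rw [ENNReal.inv_mul_cancel (vol_ball_ne_zero n x hr) (vol_ball_ne_top n x r), mul_one]
      gcongr
      exact le_iSup₂_of_le r hr le_rfl

lemma hl_level {n : ℕ} (hn : 1 ≤ n) {v : En n → ℝ≥0∞} (hv : Measurable v) (l : ℝ≥0∞) :
    l * volume {x | 2 * l < hl n v x} ≤ 5 ^ n * ∫⁻ y, ({y | l < v y}.indicator v) y := by
  refine le_trans ?_ (hl_weak hn ({y | l < v y}.indicator v) l)
  refine mul_le_mul' le_rfl (measure_mono ?_)
  intro x hx
  simp only [mem_ofPred_eq] at hx ⊢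
  have hm : MeasurableSet {y | l < v y} := measurableSet_lt measurable_const hv
  have := hl_add_const (v := v) (hv.indicator hm) l (fun y => by
    by_cases hy : l < v y
    · rw [indicator_of_mem (by exact hy)]; exact le_self_add
    · rw [indicator_of_notMem (by exact hy), zero_add]; exact not_lt.1 hy) x
  by_contra hc
  rw [not_lt] at hc
  have h2 := hx.trans_le (this.trans (add_le_add_left hc l))
  rw [two_mul] at h2
  exact lt_irrefl _ h2

open Classical in
lemma hl_L2 {n : ℕ} (hn : 1 ≤ n) : ∃ C : ℝ≥0, ∀ v H : En n → ℝ≥0∞, Measurable v →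
    Measurable H → (∀ x, H x ≤ hl n v x) →
    ∫⁻ x, H x ^ (2:ℝ) ≤ C * ∫⁻ x, v x ^ (2:ℝ) := by
  refine ⟨4 * 4 * 5 ^ n * (geoC 1).toNNReal, fun v H hv hH hle => ?_⟩
  push_cast
  rw [ENNReal.coe_toNNReal (geoC_lt_top one_pos).ne]
  have hm : ∀ k, MeasurableSet {y | dy k < v y} := fun k => measurableSet_lt measurable_const hv
  have hmH : ∀ k, MeasurableSet {y | dy k < H y} := fun k => measurableSet_lt measurable_const hH
  have step : ∀ k : ℤ, (dy (k+1)) ^ (2:ℝ) * volume {x | dy (k+1) < H x} ≤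
      4 * 5 ^ n * ∫⁻ y, (dy k * ({y | dy k < v y}.indicator v) y) := by
    intro k
    have h1 := hl_level hn hv (dy k)
    rw [lintegral_const_mul' _ _ (dy_ne_top k)]
    have h2 : volume {x | dy (k+1) < H x} ≤ volume {x | 2 * dy k < hl n v x} := by
      apply measure_mono
      intro x hx
      simp only [mem_ofPred_eq] at hx ⊢
      rw [← dy_succ]
      exact hx.trans_le (hle x)
    calc _ ≤ (dy (k+1)) ^ (2:ℝ) * volume {x | 2 * dy k < hl n v x} := by gcongr
      _ = 4 * dy k * (dy k * volume {x | 2 * dy k < hl n v x}) := by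
        rw [dy_succ, ENNReal.rpow_two]; ring
      _ ≤ 4 * dy k * (5 ^ n * ∫⁻ y, ({y | dy k < v y}.indicator v) y) := by gcongr
      _ = _ := by ring
  calc ∫⁻ x, H x ^ (2:ℝ) ≤ ∫⁻ x, 4 * ∑' k : ℤ, (if dy k < H x then (dy k) ^ (2:ℝ) else 0) := by
        refine lintegral_mono fun x => (dy_lower (by norm_num) _).trans (le_of_eq ?_)
        rw [ENNReal.rpow_two]; norm_num
    _ = 4 * ∑' k : ℤ, (dy k) ^ (2:ℝ) * volume {x | dy k < H x} := by
        rw [lintegral_const_mul' _ _ (by simp), lintegral_tsum]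
        · congr 2; ext k
          have : (fun x => if dy k < H x then (dy k) ^ (2:ℝ) else 0) =
              {x | dy k < H x}.indicator (fun _ => (dy k) ^ (2:ℝ)) := by
            ext x; simp [indicator_apply]
          rw [this, lintegral_indicator_const (hmH k)]
        · exact fun k => (Measurable.ite (hmH k) measurable_const measurable_const).aemeasurable
    _ = 4 * ∑' k : ℤ, (dy (k+1)) ^ (2:ℝ) * volume {x | dy (k+1) < H x} := by
        congr 1
        exact ((Equiv.addRight (1:ℤ)).tsum_eq
          (fun k => (dy k) ^ (2:ℝ) * volume {x | dy k < H x})).symm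
    _ ≤ 4 * ∑' k : ℤ, 4 * 5 ^ n * ∫⁻ y, (dy k * ({y | dy k < v y}.indicator v) y) := by
        exact mul_le_mul' le_rfl (ENNReal.tsum_le_tsum step)
    _ = 4 * (4 * 5 ^ n * ∫⁻ y, ∑' k : ℤ, (dy k * ({y | dy k < v y}.indicator v) y)) := by
        rw [ENNReal.tsum_mul_left, lintegral_tsum]
        exact fun k => ((hv.indicator (hm k)).const_mul _).aemeasurable
    _ ≤ 4 * (4 * 5 ^ n * ∫⁻ y, geoC 1 * v y ^ (2:ℝ)) := by
        gcongr with y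
        have := dy_upper (q := 1) one_pos (v y)
        simp only [ENNReal.rpow_one] at this
        calc _ = (∑' k : ℤ, (if dy k < v y then dy k else 0)) * v y := by
              rw [← ENNReal.tsum_mul_right]
              congr 1; ext k
              by_cases h : dy k < v y
              · rw [indicator_of_mem (by exact h)]; simp [h]
              · rw [indicator_of_notMem (by exact h)]; simp [h]
          _ ≤ geoC 1 * v y * v y := by gcongr
          _ = _ := by rw [ENNReal.rpow_two]; ring
    _ = _ := by
        rw [lintegral_const_mul' _ _ (geoC_lt_top one_pos).ne]; ring

lemma cs_set {n : ℕ} {v : En n → ℝ≥0∞} (hv : Measurable v) (S : Set (En n)) :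
    (∫⁻ y in S, v y) ^ (2:ℝ) ≤ volume S * ∫⁻ y in S, v y ^ (2:ℝ) := by
  have := ENNReal.lintegral_mul_le_Lp_mul_Lq (volume.restrict S)
    (Real.HolderConjugate.two_two) (f := v) (g := 1) hv.aemeasurable aemeasurable_one
  simp only [mul_one, Pi.one_apply, ENNReal.one_rpow, lintegral_one,
    Measure.restrict_apply_univ] at this
  calc _ ≤ ((∫⁻ y in S, v y ^ (2:ℝ)) ^ (1/2:ℝ) * volume S ^ (1/2:ℝ)) ^ (2:ℝ) := by
        gcongr
    _ = _ := by
      rw [ENNReal.mul_rpow_of_nonneg _ _ (by norm_num), ← ENNReal.rpow_mul, ← ENNReal.rpow_mul]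
      norm_num
      ring

def MB (n : ℕ) (A : ℝ≥0∞) (σ : ℝ) (w : En n → ℝ≥0∞) : Prop :=
  ∀ (x : En n) (s : ℝ), 0 < s → ∫⁻ y in Metric.ball x s, w y ≤ A * volume (Metric.ball x s) ^ σ

lemma hl_far {n : ℕ} {v : En n → ℝ≥0∞} (hv : Measurable v) {A : ℝ≥0∞} {σ : ℝ}
    (h0 : 0 ≤ σ) (h1 : σ ≤ 1) (hA : MB n A σ (fun y => v y ^ (2:ℝ))) (x0 x : En n) {ρ : ℝ}
    (hρ : 0 < ρ) (hx : x ∈ Metric.ball x0 ρ) :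
    (hl n ((Metric.ball x0 (2*ρ))ᶜ.indicator v) x) ^ (2:ℝ) ≤
      4 ^ n * (A * volume (Metric.ball x0 ρ) ^ (σ - 1)) := by
  rw [Metric.mem_ball] at hx
  have key : hl n ((Metric.ball x0 (2*ρ))ᶜ.indicator v) x ≤
      (4 ^ n * (A * volume (Metric.ball x0 ρ) ^ (σ - 1))) ^ (1/2:ℝ) := by
    refine iSup₂_le fun s hs => ?_
    rcases le_or_gt s ρ with hsρ | hsρ
    · have : ∫⁻ y in Metric.ball x s, ((Metric.ball x0 (2*ρ))ᶜ.indicator v) y = 0 := by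
        rw [setLIntegral_congr_fun (g := fun _ => 0) measurableSet_ball]
        · simp
        · intro y hy
          apply indicator_of_notMem
          rw [Metric.mem_ball] at hy
          simp only [mem_compl_iff, not_not, Metric.mem_ball]
          have := dist_triangle y x x0
          linarith
      rw [this, mul_zero]; exact zero_le
    · have hsub : Metric.ball x s ⊆ Metric.ball x0 (2*s) := by
        intro y hy
        rw [Metric.mem_ball] at hy ⊢
        have := dist_triangle y x x0
        linarith
      have h2 : volume (Metric.ball x0 (2*s)) = 2 ^ n * volume (Metric.ball x0 s) := by
        rw [vol_ball n _ (by positivity), vol_ball n _ hs, mul_pow, ENNReal.ofReal_mul (by positivity),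
          ENNReal.ofReal_pow (by norm_num)]
        norm_num [mul_assoc]
      have hVx : volume (Metric.ball x s) = volume (Metric.ball x0 s) := by
        rw [vol_ball n _ hs, vol_ball n _ hs]
      have hVs0 := vol_ball_ne_zero n x0 hs
      have hVst := vol_ball_ne_top n x0 s
      rw [one_div, ENNReal.le_rpow_inv_iff (by norm_num), hVx]
      set V := volume (Metric.ball x0 s) with hV
      have hI : ∫⁻ y in Metric.ball x s, ((Metric.ball x0 (2*ρ))ᶜ.indicator v) y ≤
          ∫⁻ y in Metric.ball x0 (2*s), v y :=
        (lintegral_mono fun y => indicator_le_self _ _ y).trans (lintegral_mono_set hsub)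
      have h2σ : ((2:ℝ≥0∞) ^ n * V) ^ σ ≤ 2 ^ n * V ^ σ := by
        rw [ENNReal.mul_rpow_of_nonneg _ _ h0]
        gcongr
        calc ((2:ℝ≥0∞) ^ n) ^ σ ≤ (2 ^ n) ^ (1:ℝ) :=
              ENNReal.rpow_le_rpow_of_exponent_le (one_le_pow₀ (by norm_num)) h1
          _ = _ := ENNReal.rpow_one _
      have hVV : (V⁻¹) ^ (2:ℝ) * (V * V ^ σ) = V ^ (σ - 1) := by
        rw [← ENNReal.rpow_neg_one, ← ENNReal.rpow_mul]
        nth_rewrite 2 [← ENNReal.rpow_one V]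
        rw [← ENNReal.rpow_add _ _ hVs0 hVst, ← ENNReal.rpow_add _ _ hVs0 hVst]
        congr 1; ring
      calc _ ≤ (V⁻¹ * ∫⁻ y in Metric.ball x0 (2*s), v y) ^ (2:ℝ) := by gcongr
        _ = (V⁻¹) ^ (2:ℝ) * (∫⁻ y in Metric.ball x0 (2*s), v y) ^ (2:ℝ) :=
            ENNReal.mul_rpow_of_nonneg _ _ (by norm_num)
        _ ≤ (V⁻¹) ^ (2:ℝ) * (2 ^ n * V * (A * (2 ^ n * V ^ σ))) := by
            gcongr
            refine (cs_set hv _).trans ?_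
            rw [h2]
            gcongr
            refine (hA x0 (2*s) (by positivity)).trans ?_
            rw [h2]
            gcongr
        _ = (2 ^ n * 2 ^ n) * (A * ((V⁻¹) ^ (2:ℝ) * (V * V ^ σ))) := by ring
        _ = 4 ^ n * (A * V ^ (σ - 1)) := by rw [hVV, ← mul_pow]; norm_num
        _ ≤ _ := by
            gcongr 4 ^ n * (A * ?_)
            rw [show σ - 1 = -(1 - σ) by ring, ENNReal.rpow_neg, ENNReal.rpow_neg]
            apply ENNReal.inv_le_inv.2
            apply ENNReal.rpow_le_rpow _ (by linarith)
            exact measure_mono (Metric.ball_subset_ball hsρ.le)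
  calc _ ≤ ((4 ^ n * (A * volume (Metric.ball x0 ρ) ^ (σ - 1))) ^ (1/2:ℝ)) ^ (2:ℝ) := by gcongr
    _ = _ := by rw [← ENNReal.rpow_mul]; norm_num

lemma hl_morrey {n : ℕ} (hn : 1 ≤ n) (K : ℝ≥0) : ∃ C : ℝ≥0, ∀ v G : En n → ℝ≥0∞, Measurable v →
    Measurable G → (∀ x, G x ≤ K * hl n v x) → ∀ (A : ℝ≥0∞) (σ : ℝ), 0 ≤ σ → σ ≤ 1 →
    MB n A σ (fun y => v y ^ (2:ℝ)) → MB n (C * A) σ (fun y => G y ^ (2:ℝ)) := by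
  obtain ⟨D, hD⟩ := hl_L2 hn
  refine ⟨(K + 1) ^ 2 * (2 * (D * 2 ^ n) + 2 * 4 ^ n), fun v G hv hG hle A σ h0 h1 hA x0 ρ hρ => ?_⟩
  set K' : ℝ≥0∞ := (K:ℝ≥0∞) + 1 with hK'
  have hK0 : K' ≠ 0 := by simp [hK']
  have hKt : K' ≠ ⊤ := by simp [hK']
  set M : ℝ≥0∞ := (4 ^ n * (A * volume (Metric.ball x0 ρ) ^ (σ - 1))) ^ (1/2:ℝ) with hM
  have hM2 : M ^ (2:ℝ) = 4 ^ n * (A * volume (Metric.ball x0 ρ) ^ (σ - 1)) := by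
    rw [hM, ← ENNReal.rpow_mul]; norm_num
  have hB2 : MeasurableSet (Metric.ball x0 (2*ρ)) := measurableSet_ball
  have hfar : ∀ x ∈ Metric.ball x0 ρ, hl n ((Metric.ball x0 (2*ρ))ᶜ.indicator v) x ≤ M := by
    intro x hx
    rw [hM, one_div, ENNReal.le_rpow_inv_iff (by norm_num)]
    exact hl_far hv h0 h1 hA x0 x hρ hx
  set v1 := (Metric.ball x0 (2*ρ)).indicator v with hv1
  have hv1m : Measurable v1 := hv.indicator hB2
  set H : En n → ℝ≥0∞ := (Metric.ball x0 ρ).indicator (fun x => K'⁻¹ * G x - M) with hH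
  have hHm : Measurable H :=
    ((hG.const_mul _).sub measurable_const).indicator measurableSet_ball
  have hadd : ∀ x, hl n v x ≤ hl n v1 x + hl n ((Metric.ball x0 (2*ρ))ᶜ.indicator v) x := by
    intro x
    refine iSup₂_le fun r hr => ?_
    have : ∫⁻ y in Metric.ball x r, v y = (∫⁻ y in Metric.ball x r, v1 y) +
        ∫⁻ y in Metric.ball x r, ((Metric.ball x0 (2*ρ))ᶜ.indicator v) y := by
      rw [← lintegral_add_left hv1m]
      congr 1; ext y
      exact (congrFun (indicator_self_add_compl (Metric.ball x0 (2*ρ)) v) y).symm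
    rw [this, mul_add]
    exact add_le_add (le_iSup₂_of_le r hr le_rfl) (le_iSup₂_of_le r hr le_rfl)
  have hGK : ∀ x, K'⁻¹ * G x ≤ hl n v x := by
    intro x
    calc K'⁻¹ * G x ≤ K'⁻¹ * (K' * hl n v x) := by
          gcongr
          exact (hle x).trans (by gcongr; exact le_self_add)
      _ = _ := by rw [← mul_assoc, ENNReal.inv_mul_cancel hK0 hKt, one_mul]
  have hHle : ∀ x, H x ≤ hl n v1 x := by
    intro x
    by_cases hx : x ∈ Metric.ball x0 ρ
    · rw [hH, indicator_of_mem hx, tsub_le_iff_right]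
      exact (hGK x).trans ((hadd x).trans (by gcongr; exact hfar x hx))
    · rw [hH, indicator_of_notMem hx]; exact zero_le
  have hL2 := hD v1 H hv1m hHm hHle
  have hV1 : ∫⁻ x, v1 x ^ (2:ℝ) ≤ 2 ^ n * (A * volume (Metric.ball x0 ρ) ^ σ) := by
    have e : (fun x => v1 x ^ (2:ℝ)) = (Metric.ball x0 (2*ρ)).indicator (fun x => v x ^ (2:ℝ)) := by
      ext x
      by_cases hx : x ∈ Metric.ball x0 (2*ρ)
      · rw [hv1, indicator_of_mem hx, indicator_of_mem hx]
      · rw [hv1, indicator_of_notMem hx, indicator_of_notMem hx]; simp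
    rw [e, lintegral_indicator hB2]
    refine (hA x0 (2*ρ) (by positivity)).trans ?_
    rw [vol_ball_mul n x0 x0 hρ two_pos, ENNReal.mul_rpow_of_nonneg _ _ h0,
      ENNReal.ofReal_pow (by norm_num)]
    have : (ENNReal.ofReal 2 ^ n) ^ σ ≤ (2:ℝ≥0∞) ^ n := by
      rw [ENNReal.ofReal_ofNat]
      calc ((2:ℝ≥0∞) ^ n) ^ σ ≤ (2 ^ n) ^ (1:ℝ) :=
            ENNReal.rpow_le_rpow_of_exponent_le (one_le_pow₀ (by norm_num)) h1
        _ = _ := ENNReal.rpow_one _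
    calc _ ≤ A * (2 ^ n * volume (Metric.ball x0 ρ) ^ σ) := by gcongr
      _ = _ := by ring
  have hpt : ∀ x ∈ Metric.ball x0 ρ, G x ^ (2:ℝ) ≤
      K' ^ 2 * (2 * H x ^ (2:ℝ) + 2 * M ^ (2:ℝ)) := by
    intro x hx
    have h3 : K'⁻¹ * G x ≤ H x + M := by
      rw [hH, indicator_of_mem hx]; exact le_tsub_add
    have h4 : G x ≤ K' * (H x + M) := by
      calc G x = K' * (K'⁻¹ * G x) := by
            rw [← mul_assoc, ENNReal.mul_inv_cancel hK0 hKt, one_mul]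
        _ ≤ _ := by gcongr
    calc _ ≤ (K' * (H x + M)) ^ (2:ℝ) := by gcongr
      _ = K' ^ 2 * (H x + M) ^ 2 := by rw [ENNReal.rpow_two, mul_pow]
      _ ≤ K' ^ 2 * (2 * H x ^ 2 + 2 * M ^ 2) := by
        gcongr
        have := ENNReal.rpow_add_le_mul_rpow_add_rpow (H x) M (p := 2) (by norm_num)
        norm_num at this
        rw [← mul_add]; exact this
      _ = _ := by rw [ENNReal.rpow_two, ENNReal.rpow_two]
  set V := volume (Metric.ball x0 ρ) with hV
  have hV0 : V ≠ 0 := vol_ball_ne_zero n x0 hρ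
  have hVt : V ≠ ⊤ := vol_ball_ne_top n x0 ρ
  have hVV : V ^ (σ - 1) * V = V ^ σ := by
    nth_rewrite 2 [← ENNReal.rpow_one V]
    rw [← ENNReal.rpow_add _ _ hV0 hVt]; congr 1; ring
  calc ∫⁻ y in Metric.ball x0 ρ, G y ^ (2:ℝ) ≤
      ∫⁻ y in Metric.ball x0 ρ, K' ^ 2 * (2 * H y ^ (2:ℝ) + 2 * M ^ (2:ℝ)) :=
        setLIntegral_mono' measurableSet_ball hpt
    _ = K' ^ 2 * (2 * (∫⁻ y in Metric.ball x0 ρ, H y ^ (2:ℝ)) + 2 * M ^ (2:ℝ) * V) := by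
        rw [lintegral_const_mul' _ _ (by simp [hKt]),
          lintegral_add_left ((hHm.pow_const _).const_mul _), lintegral_const_mul' _ _ (by simp),
          setLIntegral_const]
    _ ≤ K' ^ 2 * (2 * (D * (2 ^ n * (A * V ^ σ))) + 2 * (4 ^ n * (A * V ^ (σ - 1))) * V) := by
        rw [hM2]
        gcongr
        exact (setLIntegral_le_lintegral _ _).trans (hL2.trans (by gcongr))
    _ = K' ^ 2 * (2 * (D * (2 ^ n * (A * V ^ σ))) + 2 * (4 ^ n * (A * (V ^ (σ - 1) * V)))) := by
        ring
    _ = _ := by rw [hVV]; push_cast; rw [hK']; ring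

lemma morrey_to_MB {n : ℕ} {p q : ℝ} (hq : 0 < q) (u : En n → ℝ≥0∞) :
    MB n (morreyQ n p q u ^ q) (1 - q / p) (fun y => u y ^ q) := by
  intro x s hs
  have h : volume (Metric.ball x s) ^ (1/p - 1/q) *
      (∫⁻ y in Metric.ball x s, u y ^ q) ^ (1/q) ≤ morreyQ n p q u :=
    le_iSup_of_le x (le_iSup₂_of_le s hs le_rfl)
  set V := volume (Metric.ball x s) with hV
  have hV0 : V ≠ 0 := vol_ball_ne_zero n x hs
  have hVt : V ≠ ⊤ := vol_ball_ne_top n x s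
  have h2 := ENNReal.rpow_le_rpow h hq.le
  rw [ENNReal.mul_rpow_of_nonneg _ _ hq.le, ← ENNReal.rpow_mul, ← ENNReal.rpow_mul,
    one_div_mul_cancel hq.ne', ENNReal.rpow_one,
    show (1/p - 1/q) * q = -(1 - q/p) by field_simp; ring] at h2
  calc _ = (V ^ (-(1 - q/p)) * V ^ (1 - q/p)) * (∫⁻ y in Metric.ball x s, u y ^ q) := by
        rw [← ENNReal.rpow_add _ _ hV0 hVt]; simp
    _ = (V ^ (-(1 - q/p)) * (∫⁻ y in Metric.ball x s, u y ^ q)) * V ^ (1 - q/p) := by ring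
    _ ≤ _ := by gcongr

lemma gmax_MB {n : ℕ} (hn : 1 ≤ n) {p q : ℝ} (hq : 0 < q) (hq1 : q ≤ 1) (hqp : q ≤ p)
    (Φ : 𝓢(En n, ℂ)) (hΦ : (∫ x, Φ x) ≠ 0) :
    ∃ C : ℝ≥0, ∀ (η : 𝓢(En n, ℂ)), (∀ ξ, 𝓕 η ξ = chi n ξ) → ∀ (f : 𝓢(En n, ℂ)),
      MB n (C * morreyQ n p q (radMax n Φ f) ^ q) (1 - q / p) (fun y => gmax η f y ^ q) := by
  obtain ⟨K, hK⟩ := gmax_hl Φ hΦ (r := q/2) (by positivity) (by linarith)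
  obtain ⟨C, hC⟩ := hl_morrey hn K
  refine ⟨C, fun η hη f => ?_⟩
  have hp : 0 < p := hq.trans_le hqp
  have h := hC _ _ ((radMax_meas Φ f).pow_const (q/2)) ((gmax_meas η f).pow_const (q/2))
    (hK η hη f) (morreyQ n p q (radMax n Φ f) ^ q) (1 - q/p)
    (by rw [sub_nonneg, div_le_one hp]; exact hqp) (by have : 0 < q/p := by positivity
                                                       linarith)
  simp only [← ENNReal.rpow_mul, div_mul_cancel₀ q (two_ne_zero)] at h
  exact h (morrey_to_MB hq _)
end P9body

section P10body
open MeasureTheory Real Set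
open scoped ENNReal NNReal

lemma ker_compare {n : ℕ} {N s t : ℝ} (hN : 0 ≤ N) (hs : 0 < s) (ht : 0 < t) (z : En n)
    (hz : t ≤ ‖z‖) :
    ker n N s z ≤ ENNReal.ofReal (2 ^ N * (s / t) ^ (N - n)) * ker n N t z := by
  unfold ker
  rw [← ENNReal.ofReal_mul (by positivity)]
  apply ENNReal.ofReal_le_ofReal
  have hz0 : 0 < ‖z‖ := ht.trans_le hz
  have h1 : (1 + ‖z‖ / s) ^ (-N) ≤ (‖z‖ / s) ^ (-N) :=
    Real.rpow_le_rpow_of_nonpos (by positivity) (by linarith) (by linarith)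
  have h2 : (2 * (‖z‖ / t)) ^ (-N) ≤ (1 + ‖z‖ / t) ^ (-N) := by
    apply Real.rpow_le_rpow_of_nonpos (by positivity) _ (by linarith)
    have : 1 ≤ ‖z‖ / t := by rwa [one_le_div ht]
    linarith
  have hn : ∀ a : ℝ, 0 < a → (a ^ n)⁻¹ = a ^ (-(n:ℝ)) := by
    intro a ha; rw [Real.rpow_neg ha.le, Real.rpow_natCast]
  calc (s ^ n)⁻¹ * (1 + ‖z‖ / s) ^ (-N) ≤ (s ^ n)⁻¹ * (‖z‖ / s) ^ (-N) := by gcongr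
    _ = (2 ^ N * (s / t) ^ (N - n)) * ((t ^ n)⁻¹ * (2 * (‖z‖ / t)) ^ (-N)) := by
      rw [hn s hs, hn t ht, Real.mul_rpow (by norm_num) (by positivity),
        Real.div_rpow hz0.le hs.le, Real.div_rpow hz0.le ht.le, Real.div_rpow hs.le ht.le,
        Real.rpow_sub hs, Real.rpow_sub ht, Real.rpow_neg hs.le, Real.rpow_neg hs.le,
        Real.rpow_neg ht.le, Real.rpow_neg ht.le, Real.rpow_neg zero_le_two,
        Real.rpow_neg hz0.le]
      have := Real.rpow_pos_of_pos hs N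
      have := Real.rpow_pos_of_pos hs (n:ℝ)
      have := Real.rpow_pos_of_pos ht N
      have := Real.rpow_pos_of_pos ht (n:ℝ)
      have := Real.rpow_pos_of_pos (two_pos (α := ℝ)) N
      have := Real.rpow_pos_of_pos hz0 N
      field_simp
    _ ≤ _ := by gcongr

lemma dy_rpow (k : ℤ) (s : ℝ) : dy k ^ s = (2:ℝ≥0∞) ^ ((k:ℝ) * s) := by
  rw [ENNReal.rpow_mul, dy, ENNReal.rpow_intCast]

lemma dy_eq (k : ℤ) : dy k = (2:ℝ≥0∞) ^ (k:ℝ) := by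
  rw [dy, ENNReal.rpow_intCast]

lemma two_rpow_add (x y : ℝ) : (2:ℝ≥0∞) ^ x * 2 ^ y = 2 ^ (x + y) :=
  (ENNReal.rpow_add _ _ (by norm_num) (by norm_num)).symm

/-- expansion factor -/
def rhok (n : ℕ) (q : ℝ) (m k : ℤ) : ℝ := 2 ^ ((max 0 ((k:ℝ) - m)) * q / n)

lemma rhok_one_le {n : ℕ} {q : ℝ} (hq : 0 < q) (m k : ℤ) : 1 ≤ rhok n q m k := by
  apply Real.one_le_rpow (by norm_num)
  have : 0 ≤ max 0 ((k:ℝ) - m) := le_max_left _ _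
  positivity

lemma rhok_of_le {n : ℕ} {q : ℝ} {m k : ℤ} (h : k ≤ m) : rhok n q m k = 1 := by
  have : ((k:ℝ) - m) ≤ 0 := by rw [sub_nonpos]; exact_mod_cast h
  rw [rhok, max_eq_left this]; simp

lemma rhok_pow {n : ℕ} (hn : 1 ≤ n) {q : ℝ} {m k : ℤ} (h : m ≤ k) :
    ENNReal.ofReal (rhok n q m k ^ n) * dy m ^ q = dy k ^ q := by
  have : 0 ≤ ((k:ℝ) - m) := by rw [sub_nonneg]; exact_mod_cast h
  have hn' : (n:ℝ) ≠ 0 := by positivity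
  rw [rhok, max_eq_right this, ← Real.rpow_natCast, ← Real.rpow_mul zero_le_two,
    div_mul_cancel₀ _ hn', ← ENNReal.ofReal_rpow_of_pos two_pos, ENNReal.ofReal_ofNat, dy_rpow, dy_rpow,
    two_rpow_add]
  congr 1; ring

lemma rhok_decay {n : ℕ} (hn : 1 ≤ n) {q N : ℝ} (hq : 0 < q) (hq1 : q ≤ 1) (hNq : n ≤ N * q)
    (m k : ℤ) : dy k * ENNReal.ofReal (rhok n q m k ^ (-(N - n))) ≤ dy k ^ q * dy m ^ (1 - q) := by
  have hn' : (0:ℝ) < n := by positivity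
  rw [rhok, ← Real.rpow_mul zero_le_two, ← ENNReal.ofReal_rpow_of_pos two_pos, ENNReal.ofReal_ofNat,
    dy_rpow, dy_rpow, dy_eq, two_rpow_add, two_rpow_add]
  apply ENNReal.rpow_le_rpow_of_exponent_le (by norm_num)
  have e : q / n * (N - n) ≥ 1 - q := by
    rw [ge_iff_le, div_mul_eq_mul_div, le_div_iff₀ hn']; nlinarith
  have e2 : (k:ℝ) + max 0 ((k:ℝ) - m) * q / n * -(N - n) =
    k - max 0 ((k:ℝ) - m) * (q / n * (N - n)) := by ring
  rw [e2]
  have h0 : 0 ≤ max 0 ((k:ℝ) - m) := le_max_left _ _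
  have h1 : (k:ℝ) - m ≤ max 0 ((k:ℝ) - m) := le_max_right _ _
  have h2 := mul_le_mul_of_nonneg_left e h0
  have h3 := mul_le_mul_of_nonneg_right h1 (sub_nonneg.2 hq1)
  nlinarith

/-- enlarged set -/
def enl {n : ℕ} (E : Set (En n)) (R : ℝ) : Set (En n) :=
  {x | ∃ y ∈ E, dist x y < R * Metric.infDist y Eᶜ}

lemma ball_infDist_subset {n : ℕ} (E : Set (En n)) (y : En n) :
    Metric.ball y (Metric.infDist y Eᶜ) ⊆ E := by
  intro z hz
  by_contra hc
  rw [Metric.mem_ball, dist_comm] at hz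
  exact absurd (Metric.infDist_le_dist_of_mem (x := y) (s := Eᶜ) hc) (not_le.2 hz)

lemma enl_one {n : ℕ} (E : Set (En n)) : enl E 1 ⊆ E := by
  rintro x ⟨y, hy, h⟩
  rw [one_mul] at h
  exact ball_infDist_subset E y h

lemma enl_vol {n : ℕ} (hn : 1 ≤ n) (E : Set (En n)) (hE : IsOpen E) {R : ℝ} (hR : 1 ≤ R) :
    volume (enl E R) ≤ 2 * 10 ^ n * ENNReal.ofReal (R ^ n) * volume E := by
  set l : ℝ≥0∞ := (2 * ENNReal.ofReal ((2*R) ^ n))⁻¹ with hl'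
  have hR0 : 0 < R := by linarith
  have hp : ENNReal.ofReal ((2*R) ^ n) ≠ 0 := by
    rw [ENNReal.ofReal_ne_zero_iff]; positivity
  have hpt : ENNReal.ofReal ((2*R) ^ n) ≠ ⊤ := ENNReal.ofReal_ne_top
  have h2p : 2 * ENNReal.ofReal ((2*R) ^ n) ≠ 0 := mul_ne_zero (by norm_num) hp
  have h2pt : 2 * ENNReal.ofReal ((2*R) ^ n) ≠ ⊤ := ENNReal.mul_ne_top (by norm_num) hpt
  have hsub : enl E R ⊆ {x | l < hl n (E.indicator 1) x} := by
    rintro x ⟨y, hy, h⟩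
    have hd : 0 < Metric.infDist y Eᶜ := by
      by_contra hc
      have : Metric.infDist y Eᶜ = 0 := le_antisymm (not_lt.1 hc) Metric.infDist_nonneg
      rw [this, mul_zero] at h
      exact absurd dist_nonneg (not_le.2 h)
    set d := Metric.infDist y Eᶜ with hd'
    have hsub2 : Metric.ball y d ⊆ E ∩ Metric.ball x ((2*R) * d) := by
      refine subset_inter (ball_infDist_subset E y) (fun z hz => ?_)
      rw [Metric.mem_ball] at hz ⊢
      have := dist_triangle z y x
      rw [dist_comm y x] at this
      nlinarith
    have hb := hl_ball (E.indicator 1) x (r := (2*R)*d) (by positivity)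
    rw [lintegral_indicator_one hE.measurableSet, Measure.restrict_apply hE.measurableSet,
      vol_ball_mul n x y hd (by positivity)] at hb
    have h3 := (measure_mono hsub2).trans hb
    set V := volume (Metric.ball y d)
    have hV0 : V ≠ 0 := vol_ball_ne_zero n y hd
    have hVt : V ≠ ⊤ := vol_ball_ne_top n y d
    have h4 : 1 ≤ ENNReal.ofReal ((2*R) ^ n) * hl n (E.indicator 1) x := by
      have : V * 1 ≤ V * (ENNReal.ofReal ((2*R) ^ n) * hl n (E.indicator 1) x) := by
        rw [mul_one]; refine h3.trans (le_of_eq ?_); ring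
      exact (ENNReal.mul_le_mul_iff_right hV0 hVt).1 this
    show l < _
    by_contra hc
    rw [not_lt] at hc
    have h5 : (1:ℝ≥0∞) ≤ 2⁻¹ := by
      calc 1 ≤ ENNReal.ofReal ((2*R) ^ n) * l := h4.trans (by gcongr)
        _ = 2⁻¹ := by
          rw [hl', ENNReal.mul_inv (by simp) (by simp), mul_comm, mul_assoc,
            ENNReal.inv_mul_cancel hp hpt, mul_one]
    norm_num at h5
  have h := hl_weak hn (E.indicator 1) l
  rw [lintegral_indicator_one hE.measurableSet] at h
  have h' : l * volume (enl E R) ≤ 5 ^ n * volume E :=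
    le_trans (mul_le_mul' le_rfl (measure_mono hsub)) h
  calc volume (enl E R) = (2 * ENNReal.ofReal ((2*R) ^ n)) * (l * volume (enl E R)) := by
        rw [← mul_assoc, hl', ENNReal.mul_inv_cancel h2p h2pt, one_mul]
    _ ≤ (2 * ENNReal.ofReal ((2*R) ^ n)) * (5 ^ n * volume E) := by gcongr
    _ = _ := by
      rw [mul_pow, ENNReal.ofReal_mul (by positivity), ENNReal.ofReal_pow (by norm_num),
        ENNReal.ofReal_ofNat, show (10:ℝ≥0∞) = 2 * 5 by norm_num, mul_pow]
      ring
end P10body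

section P11body
open MeasureTheory Real Set
open scoped ENNReal NNReal

/-- good part integral -/
def Jk {n : ℕ} (N : ℝ) (E : Set (En n)) (R : ℝ) (x : En n) : ℝ≥0∞ :=
  ∫⁻ y in E, ker n N (R * Metric.infDist y Eᶜ) (x - y)

lemma infDist_pos' {n : ℕ} {E : Set (En n)} (hE : IsOpen E) (hne : Eᶜ.Nonempty) {y : En n}
    (hy : y ∈ E) : 0 < Metric.infDist y Eᶜ :=
  (hE.isClosed_compl.notMem_iff_infDist_pos hne).1 (by simpa using hy)

lemma ker_joint {n : ℕ} (N R : ℝ) (E : Set (En n)) :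
    Measurable (fun z : En n × En n => ker n N (R * Metric.infDist z.2 Eᶜ) (z.1 - z.2)) := by
  unfold ker
  have : Measurable (fun z : En n × En n => Metric.infDist z.2 Eᶜ) :=
    ((Metric.continuous_infDist_pt _).comp continuous_snd).measurable
  fun_prop

lemma Jk_meas {n : ℕ} (N R : ℝ) (E : Set (En n)) : Measurable (Jk N E R) :=
  (ker_joint N R E).lintegral_prod_right'

lemma Jk_int {n : ℕ} (N : ℝ) {R : ℝ} (hR : 0 < R) (E : Set (En n)) (hE : IsOpen E)
    (hne : Eᶜ.Nonempty) : ∫⁻ x, Jk N E R x = kerMass n N * volume E := by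
  unfold Jk
  rw [lintegral_lintegral_swap (ker_joint N R E).aemeasurable,
    setLIntegral_congr_fun (g := fun _ => kerMass n N) hE.measurableSet, setLIntegral_const]
  intro y hy
  have hp : 0 < R * Metric.infDist y Eᶜ := mul_pos hR (infDist_pos' hE hne hy)
  show ∫⁻ x, ker n N (R * Metric.infDist y Eᶜ) (x - y) = kerMass n N
  rw [← ker_lint_sub n N hp y]
  congr 1; ext x
  exact ker_sub_comm _ _ _ _ _

open Classical in
lemma part_le {n : ℕ} {N ε R : ℝ} (hN : (n:ℝ) < N) (hε : 0 < ε) (hR : 1 ≤ R) (E : Set (En n))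
    (hE : IsOpen E) (x : En n) :
    ∫⁻ y in {y | y ∈ E ∧ ε ≤ Metric.infDist y Eᶜ}, ker n N ε (x - y) ≤
      (if x ∈ enl E R then kerMass n N else 0) +
        ENNReal.ofReal (2 ^ N) * (ENNReal.ofReal (R ^ (-(N - n))) * Jk N E R x) := by
  have hn0 : (0:ℝ) ≤ n := Nat.cast_nonneg n
  by_cases hx : x ∈ enl E R
  · rw [if_pos hx]
    refine le_trans ?_ le_self_add
    rw [← ker_lint_sub n N hε x]
    exact setLIntegral_le_lintegral _ _
  · rw [if_neg hx, zero_add, ← mul_assoc, Jk, ← lintegral_const_mul' _ _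
      (ENNReal.mul_ne_top ENNReal.ofReal_ne_top ENNReal.ofReal_ne_top)]
    have hms : MeasurableSet {y | y ∈ E ∧ ε ≤ Metric.infDist y Eᶜ} :=
      hE.measurableSet.inter (measurableSet_le measurable_const
        (Metric.continuous_infDist_pt _).measurable)
    refine (setLIntegral_mono' hms ?_).trans (lintegral_mono_set (fun y hy => hy.1))
    rintro y ⟨hy, hd⟩
    set d := Metric.infDist y Eᶜ
    have hd0 : 0 < d := hε.trans_le hd
    have hR0 : 0 < R := by linarith
    have hxy : R * d ≤ ‖x - y‖ := by
      rw [← dist_eq_norm]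
      by_contra hc
      exact hx ⟨y, hy, not_le.1 hc⟩
    refine (ker_compare (by linarith) hε (mul_pos hR0 hd0) _ hxy).trans ?_
    gcongr
    rw [← ENNReal.ofReal_mul (by positivity)]
    apply ENNReal.ofReal_le_ofReal
    gcongr
    rw [Real.rpow_neg hR0.le, ← Real.inv_rpow hR0.le]
    apply Real.rpow_le_rpow (by positivity) _ (by linarith)
    rw [div_le_iff₀ (by positivity)]
    field_simp
    exact hd

lemma cheb_sum {n : ℕ} {q : ℝ} (hq : 0 < q) {h : En n → ℝ≥0∞} (hh : Measurable h) :
    ∑' k : ℤ, dy k ^ q * volume {x | dy k < h x} ≤ geoC q * ∫⁻ x, h x ^ q := by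
  classical
  have hm : ∀ k, MeasurableSet {y | dy k < h y} := fun k => measurableSet_lt measurable_const hh
  calc _ = ∫⁻ x, ∑' k : ℤ, (if dy k < h x then (dy k) ^ q else 0) := by
        rw [lintegral_tsum]
        · congr 1; ext k
          have : (fun x => if dy k < h x then (dy k) ^ q else 0) =
              {x | dy k < h x}.indicator (fun _ => (dy k) ^ q) := by
            ext x; simp [indicator_apply]
          rw [this, lintegral_indicator_const (hm k)]
        · exact fun k => (Measurable.ite (hm k) measurable_const measurable_const).aemeasurable
    _ ≤ ∫⁻ x, geoC q * h x ^ q := lintegral_mono fun x => dy_upper hq _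
    _ = _ := lintegral_const_mul' _ _ (geoC_lt_top hq).ne

/-- the maximal operator -/
def Tm (n : ℕ) (N : ℝ) (a : ℝ → En n → ℝ≥0∞) (x : En n) : ℝ≥0∞ :=
  ⨆ (ε : ℝ) (_ : 0 < ε), ∫⁻ y, ker n N ε (x - y) * a ε y

open Classical in
lemma Tm_point {n : ℕ} {N q : ℝ} (hN : (n:ℝ) < N) (hq : 0 < q)
    {h : En n → ℝ≥0∞} (hho : ∀ l, IsOpen {x | l < h x}) (hne : ∀ k : ℤ, ({x | dy k < h x}ᶜ).Nonempty)
    {a : ℝ → En n → ℝ≥0∞} (ha : ∀ ε, 0 < ε → ∀ y y', dist y' y < ε → a ε y ≤ h y') (m : ℤ) (x : En n)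
    (hx : ∀ k, m < k → x ∉ enl {x | dy k < h x} (rhok n q m k)) :
    Tm n N a x ≤ 2 * (kerMass n N * geoC 1) * h x + 2 * ENNReal.ofReal (2 ^ N) *
      ∑' k : ℤ, dy k * ENNReal.ofReal (rhok n q m k ^ (-(N - n))) *
        Jk N {x | dy k < h x} (rhok n q m k) x := by
  refine iSup₂_le fun ε hε => ?_
  set E : ℤ → Set (En n) := fun k => {x | dy k < h x} with hE
  set P : ℤ → Set (En n) := fun k => {y | y ∈ E k ∧ ε ≤ Metric.infDist y (E k)ᶜ} with hP
  have hPm : ∀ k, MeasurableSet (P k) := fun k => (hho (dy k)).measurableSet.inter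
    (measurableSet_le measurable_const (Metric.continuous_infDist_pt _).measurable)
  have hap : ∀ y, a ε y ≤ 2 * ∑' k : ℤ, (P k).indicator (fun _ => dy k) y := by
    intro y
    have h1 := dy_lower one_pos (a ε y)
    simp only [ENNReal.rpow_one] at h1
    refine h1.trans ?_
    refine mul_le_mul' le_rfl (ENNReal.tsum_le_tsum fun k => ?_)
    split_ifs with hk
    · rw [indicator_of_mem]
      have hb : ∀ y', dist y' y < ε → y' ∈ E k := fun y' hy' => hk.trans_le (ha ε hε y y' hy')
      refine ⟨hb y (by simpa using hε), ?_⟩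
      rw [Metric.le_infDist (hne k)]
      intro z hz
      by_contra hc
      exact hz (hb z (by rw [dist_comm]; exact not_le.1 hc))
    · exact zero_le
  have hsum : ∫⁻ y, ker n N ε (x - y) * a ε y ≤
      2 * ∑' k : ℤ, dy k * ∫⁻ y in P k, ker n N ε (x - y) := by
    have hkm : Measurable (fun y => ker n N ε (x - y)) :=
      (ker_meas n N hε).comp (measurable_const.sub measurable_id)
    calc _ ≤ ∫⁻ y, 2 * ∑' k : ℤ, (P k).indicator (fun y => dy k * ker n N ε (x - y)) y := by
          refine lintegral_mono fun y => ?_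
          calc _ ≤ ker n N ε (x - y) * (2 * ∑' k : ℤ, (P k).indicator (fun _ => dy k) y) := by
                gcongr; exact hap y
            _ = 2 * ∑' k : ℤ, ker n N ε (x - y) * (P k).indicator (fun _ => dy k) y := by
                rw [ENNReal.tsum_mul_left]; ring
            _ = _ := by
                congr 2; ext k
                by_cases hk : y ∈ P k
                · rw [indicator_of_mem hk, indicator_of_mem hk, mul_comm]
                · rw [indicator_of_notMem hk, indicator_of_notMem hk, mul_zero]
      _ = _ := by
          rw [lintegral_const_mul' _ _ (by norm_num), lintegral_tsum]
          · congr 2; ext k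
            rw [lintegral_indicator (hPm k), lintegral_const_mul' _ _ (dy_ne_top k)]
          · exact fun k => ((hkm.const_mul _).indicator (hPm k)).aemeasurable
  refine hsum.trans ?_
  have hk : ∀ k, dy k * ∫⁻ y in P k, ker n N ε (x - y) ≤
      kerMass n N * (if dy k < h x then dy k else 0) + ENNReal.ofReal (2 ^ N) *
        (dy k * ENNReal.ofReal (rhok n q m k ^ (-(N - n))) * Jk N (E k) (rhok n q m k) x) := by
    intro k
    have h1 := part_le (N := N) hN hε (rhok_one_le (n := n) hq m k) (E k) (hho (dy k)) x
    have h2 : (if x ∈ enl (E k) (rhok n q m k) then kerMass n N else 0) ≤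
        kerMass n N * (if dy k < h x then 1 else 0) := by
      split_ifs with h3 h4 h4
      · simp
      · exfalso
        rcases le_or_gt k m with hkm | hkm
        · rw [rhok_of_le hkm] at h3
          exact h4 (enl_one _ h3)
        · exact hx k hkm h3
      · exact zero_le
      · exact zero_le
    calc _ ≤ dy k * (kerMass n N * (if dy k < h x then 1 else 0) +
        ENNReal.ofReal (2 ^ N) * (ENNReal.ofReal (rhok n q m k ^ (-(N - n))) *
          Jk N (E k) (rhok n q m k) x)) := by
          exact mul_le_mul' le_rfl (h1.trans (add_le_add_left h2 _))
      _ = kerMass n N * (dy k * (if dy k < h x then 1 else 0)) + ENNReal.ofReal (2 ^ N) *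
        (dy k * ENNReal.ofReal (rhok n q m k ^ (-(N - n))) * Jk N (E k) (rhok n q m k) x) := by ring
      _ = _ := by
        congr 2
        split_ifs <;> simp
  calc _ ≤ 2 * ∑' k : ℤ, (kerMass n N * (if dy k < h x then dy k else 0) + ENNReal.ofReal (2 ^ N) *
        (dy k * ENNReal.ofReal (rhok n q m k ^ (-(N - n))) * Jk N (E k) (rhok n q m k) x)) :=
        mul_le_mul' le_rfl (ENNReal.tsum_le_tsum hk)
    _ = 2 * (kerMass n N * ∑' k : ℤ, (if dy k < h x then dy k else 0)) +
        2 * ENNReal.ofReal (2 ^ N) * ∑' k : ℤ,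
        (dy k * ENNReal.ofReal (rhok n q m k ^ (-(N - n))) * Jk N (E k) (rhok n q m k) x) := by
        rw [ENNReal.tsum_add, ENNReal.tsum_mul_left, ENNReal.tsum_mul_left]; ring
    _ ≤ 2 * (kerMass n N * (geoC 1 * h x)) + 2 * ENNReal.ofReal (2 ^ N) * ∑' k : ℤ,
        (dy k * ENNReal.ofReal (rhok n q m k ^ (-(N - n))) * Jk N (E k) (rhok n q m k) x) := by
        have := dy_upper (q := 1) one_pos (h x)
        simp only [ENNReal.rpow_one] at this
        gcongr
    _ = _ := by ring

lemma weakW_dy {n : ℕ} (hn : 1 ≤ n) {N q : ℝ} (hN : (n:ℝ) < N) (hq : 0 < q) (hq1 : q ≤ 1)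
    (hNq : n ≤ N * q) : ∃ C : ℝ≥0, 0 < C ∧ ∀ (h : En n → ℝ≥0∞), (∀ l, IsOpen {x | l < h x}) →
    ∀ (a : ℝ → En n → ℝ≥0∞), (∀ ε, 0 < ε → ∀ y y', dist y' y < ε → a ε y ≤ h y') →
    ∀ m : ℤ, dy m ^ q * volume {x | dy m < Tm n N a x} ≤ C * ∫⁻ x, h x ^ q := by
  have hMt := (kerMass_lt_top n hN).ne
  have hgt := (geoC_lt_top hq).ne
  have hg1t := (geoC_lt_top one_pos).ne
  set c1 : ℝ≥0∞ := 2 * (kerMass n N * geoC 1) with hc1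
  set c2 : ℝ≥0∞ := 2 * ENNReal.ofReal (2 ^ N) with hc2
  have hc1t : c1 ≠ ⊤ := ENNReal.mul_ne_top (by norm_num) (ENNReal.mul_ne_top hMt hg1t)
  have hc2t : c2 ≠ ⊤ := ENNReal.mul_ne_top (by norm_num) ENNReal.ofReal_ne_top
  set C : ℝ≥0∞ := 2 * 10 ^ n * geoC q + (2 * c1) ^ q + 2 * c2 * kerMass n N * geoC q with hC
  have hCt : C ≠ ⊤ := by
    refine ENNReal.add_ne_top.2 ⟨ENNReal.add_ne_top.2 ⟨?_, ?_⟩, ?_⟩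
    · exact ENNReal.mul_ne_top (ENNReal.mul_ne_top (by norm_num) (by simp)) hgt
    · exact ENNReal.rpow_ne_top_of_nonneg hq.le (ENNReal.mul_ne_top (by norm_num) hc1t)
    · exact ENNReal.mul_ne_top (ENNReal.mul_ne_top (ENNReal.mul_ne_top (by norm_num) hc2t) hMt) hgt
  refine ⟨C.toNNReal + 1, by positivity, fun h hho a ha m => ?_⟩
  push_cast
  rw [ENNReal.coe_toNNReal hCt]
  rcases eq_or_ne (∫⁻ x, h x ^ q) ⊤ with hI | hI
  · rw [hI, ENNReal.mul_top (by positivity)]; exact le_top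
  refine le_trans ?_ (mul_le_mul' (le_self_add (a := C) (b := 1)) le_rfl)
  have hh : Measurable h := measurable_of_Ioi (fun l => (hho l).measurableSet)
  set I := ∫⁻ x, h x ^ q with hIdef
  have hch := cheb_sum hq hh
  set E : ℤ → Set (En n) := fun k => {x | dy k < h x} with hE
  have hdq0 : ∀ k, dy k ^ q ≠ 0 := fun k => by
    simp [ENNReal.rpow_eq_zero_iff, dy_pos, dy_ne_top]
  have hdqt : ∀ k, dy k ^ q ≠ ⊤ := fun k => ENNReal.rpow_ne_top_of_nonneg hq.le (dy_ne_top k)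
  have : Nontrivial (En n) := by
    have : Nonempty (Fin n) := ⟨⟨0, hn⟩⟩
    infer_instance
  have hnc : NoncompactSpace (En n) := NormedSpace.noncompactSpace ℝ (En n)
  have hne : ∀ k, ((E k)ᶜ).Nonempty := by
    intro k
    rw [nonempty_compl]
    intro hu
    have h1 : dy k ^ q * volume (E k) ≤ geoC q * I := (ENNReal.le_tsum k).trans hch
    rw [hu, measure_univ_of_isAddLeftInvariant, ENNReal.mul_top (hdq0 k), top_le_iff] at h1
    exact ENNReal.mul_ne_top hgt hI h1
  set S : En n → ℝ≥0∞ := fun x => ∑' k : ℤ, dy k * ENNReal.ofReal (rhok n q m k ^ (-(N - n))) *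
        Jk N (E k) (rhok n q m k) x with hS
  have hSm : Measurable S := Measurable.tsum fun k => (Jk_meas _ _ _).const_mul _
  set B : Set (En n) := ⋃ k ∈ {k : ℤ | m < k}, enl (E k) (rhok n q m k) with hB
  have hsub : {x | dy m < Tm n N a x} ⊆ B ∪ ({x | dy m ≤ 2 * c1 * h x} ∪ {x | dy m ≤ 2 * c2 * S x}) := by
    intro x hx
    by_contra hc
    simp only [mem_union, not_or, mem_ofPred_eq, not_le] at hc
    obtain ⟨hcB, hc1, hc2⟩ := hc
    have hp := Tm_point hN hq hho hne ha m x (fun k hk hxk => hcB (mem_biUnion hk hxk))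
    have h3 : 2 * Tm n N a x < 2 * dy m := by
      calc 2 * Tm n N a x ≤ 2 * (c1 * h x + c2 * S x) := by gcongr
        _ = 2 * c1 * h x + 2 * c2 * S x := by ring
        _ < dy m + dy m := ENNReal.add_lt_add hc1 hc2
        _ = _ := by ring
    have h4 : 2 * dy m ≤ 2 * Tm n N a x := by gcongr; exact le_of_lt hx
    exact absurd h4 (not_le.2 h3)
  have b1 : dy m ^ q * volume B ≤ 2 * 10 ^ n * geoC q * I := by
    have : volume B ≤ ∑' k : {k : ℤ | m < k}, volume (enl (E k) (rhok n q m k)) :=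
      measure_biUnion_le _ (to_countable _) _
    calc dy m ^ q * volume B ≤ dy m ^ q * ∑' k : {k : ℤ | m < k}, volume (enl (E k) (rhok n q m k)) := by
          gcongr
      _ = ∑' k : {k : ℤ | m < k}, dy m ^ q * volume (enl (E k) (rhok n q m k)) :=
          ENNReal.tsum_mul_left.symm
      _ ≤ ∑' k : {k : ℤ | m < k}, 2 * 10 ^ n * (dy (k:ℤ) ^ q * volume (E k)) := by
          refine ENNReal.tsum_le_tsum fun k => ?_
          calc _ ≤ dy m ^ q * (2 * 10 ^ n * ENNReal.ofReal (rhok n q m k ^ n) * volume (E k)) :=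
                mul_le_mul' le_rfl (enl_vol hn _ (hho _) (rhok_one_le hq m k))
            _ = 2 * 10 ^ n * ((ENNReal.ofReal (rhok n q m k ^ n) * dy m ^ q) * volume (E k)) := by ring
            _ = _ := by rw [rhok_pow hn (le_of_lt k.2)]
      _ ≤ ∑' k : ℤ, 2 * 10 ^ n * (dy (k:ℤ) ^ q * volume (E k)) :=
          ENNReal.tsum_comp_le_tsum_of_injective Subtype.val_injective
            (fun k : ℤ => 2 * 10 ^ n * (dy k ^ q * volume (E k)))
      _ = 2 * 10 ^ n * ∑' k : ℤ, dy (k:ℤ) ^ q * volume (E k) := ENNReal.tsum_mul_left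
      _ ≤ 2 * 10 ^ n * (geoC q * I) := by gcongr
      _ = _ := by ring
  have b2 : dy m ^ q * volume {x | dy m ≤ 2 * c1 * h x} ≤ (2 * c1) ^ q * I := by
    have hset : {x | dy m ≤ 2 * c1 * h x} ⊆ {x | dy m ^ q ≤ (2 * c1) ^ q * h x ^ q} := by
      intro x hx
      simp only [mem_ofPred_eq] at hx ⊢
      rw [← ENNReal.mul_rpow_of_nonneg _ _ hq.le]
      gcongr
    calc _ ≤ dy m ^ q * volume {x | dy m ^ q ≤ (2 * c1) ^ q * h x ^ q} :=
          mul_le_mul' le_rfl (measure_mono hset)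
      _ ≤ ∫⁻ x, (2 * c1) ^ q * h x ^ q := mul_meas_ge_le_lintegral ((hh.pow_const q).const_mul _) _
      _ = _ := lintegral_const_mul _ (hh.pow_const q)
  have hSint : ∫⁻ x, S x ≤ kerMass n N * dy m ^ (1 - q) * (geoC q * I) := by
    calc ∫⁻ x, S x = ∑' k : ℤ, dy k * ENNReal.ofReal (rhok n q m k ^ (-(N - n))) *
            (kerMass n N * volume (E k)) := by
          rw [hS, lintegral_tsum (fun k => ((Jk_meas _ _ _).const_mul _).aemeasurable)]
          congr 1; ext k
          rw [lintegral_const_mul _ (Jk_meas _ _ _),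
            Jk_int N (by linarith [rhok_one_le (n := n) hq m k]) _ (hho _) (hne k)]
      _ ≤ ∑' k : ℤ, kerMass n N * dy m ^ (1 - q) * (dy k ^ q * volume (E k)) := by
          refine ENNReal.tsum_le_tsum fun k => ?_
          calc _ ≤ (dy k ^ q * dy m ^ (1 - q)) * (kerMass n N * volume (E k)) := by
                gcongr ?_ * _
                exact rhok_decay hn hq hq1 hNq m k
            _ = _ := by ring
      _ = kerMass n N * dy m ^ (1 - q) * ∑' k : ℤ, (dy k ^ q * volume (E k)) := ENNReal.tsum_mul_left
      _ ≤ _ := by gcongr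
  have b3 : dy m ^ q * volume {x | dy m ≤ 2 * c2 * S x} ≤ 2 * c2 * kerMass n N * geoC q * I := by
    have h1 : dy m * volume {x | dy m ≤ 2 * c2 * S x} ≤
        2 * c2 * (kerMass n N * dy m ^ (1 - q) * (geoC q * I)) := by
      calc _ ≤ ∫⁻ x, 2 * c2 * S x := mul_meas_ge_le_lintegral (hSm.const_mul _) _
        _ = 2 * c2 * ∫⁻ x, S x := lintegral_const_mul _ hSm
        _ ≤ _ := by gcongr
    have e1 : dy m ^ q = dy m ^ (q - 1) * dy m := by
      nth_rewrite 3 [← ENNReal.rpow_one (dy m)]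
      rw [← ENNReal.rpow_add _ _ (dy_pos m) (dy_ne_top m)]; congr 1; ring
    have e2 : dy m ^ (q - 1) * dy m ^ (1 - q) = 1 := by
      rw [← ENNReal.rpow_add _ _ (dy_pos m) (dy_ne_top m)]; simp
    calc _ = dy m ^ (q - 1) * (dy m * volume {x | dy m ≤ 2 * c2 * S x}) := by rw [e1]; ring
      _ ≤ dy m ^ (q - 1) * (2 * c2 * (kerMass n N * dy m ^ (1 - q) * (geoC q * I))) := by gcongr
      _ = (dy m ^ (q - 1) * dy m ^ (1 - q)) * (2 * c2 * kerMass n N * geoC q * I) := by ring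
      _ = _ := by rw [e2, one_mul]
  calc _ ≤ dy m ^ q * (volume B + (volume {x | dy m ≤ 2 * c1 * h x} +
        volume {x | dy m ≤ 2 * c2 * S x})) := by
        gcongr
        exact (measure_mono hsub).trans ((measure_union_le _ _).trans
          (add_le_add_right (measure_union_le _ _) _))
    _ = dy m ^ q * volume B + (dy m ^ q * volume {x | dy m ≤ 2 * c1 * h x} +
        dy m ^ q * volume {x | dy m ≤ 2 * c2 * S x}) := by ring
    _ ≤ 2 * 10 ^ n * geoC q * I + ((2 * c1) ^ q * I + 2 * c2 * kerMass n N * geoC q * I) := by gcongr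
    _ = _ := by rw [hC]; ring

lemma weakW {n : ℕ} (hn : 1 ≤ n) {N q : ℝ} (hN : (n:ℝ) < N) (hq : 0 < q) (hq1 : q ≤ 1)
    (hNq : n ≤ N * q) : ∃ C : ℝ≥0, 0 < C ∧ ∀ (h : En n → ℝ≥0∞), (∀ l, IsOpen {x | l < h x}) →
    ∀ (a : ℝ → En n → ℝ≥0∞), (∀ ε, 0 < ε → ∀ y y', dist y' y < ε → a ε y ≤ h y') →
    ∀ l : ℝ≥0∞, l ≠ 0 → l ≠ ⊤ → l ^ q * volume {x | l < Tm n N a x} ≤ C * ∫⁻ x, h x ^ q := by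
  obtain ⟨C, hC0, hC⟩ := weakW_dy hn hN hq hq1 hNq
  refine ⟨2 * C, by positivity, fun h hho a ha l hl0 hlt => ?_⟩
  obtain ⟨m, hm1, hm2⟩ := dy_exists hl0 hlt
  have h1 : l ^ q ≤ 2 * dy m ^ q := by
    calc l ^ q ≤ (2 * dy m) ^ q := by gcongr
      _ = 2 ^ q * dy m ^ q := ENNReal.mul_rpow_of_nonneg _ _ hq.le
      _ ≤ 2 ^ (1:ℝ) * dy m ^ q := by
        gcongr
        · norm_num
      _ = _ := by rw [ENNReal.rpow_one]
  calc _ ≤ (2 * dy m ^ q) * volume {x | dy m < Tm n N a x} := by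
        refine mul_le_mul' h1 (measure_mono fun x hx => ?_)
        exact hm1.trans hx
    _ = 2 * (dy m ^ q * volume {x | dy m < Tm n N a x}) := by ring
    _ ≤ 2 * (C * ∫⁻ x, h x ^ q) := mul_le_mul' le_rfl (hC h hho a ha m)
    _ = _ := by push_cast; ring
end P11body

section P12body
open MeasureTheory Real Set
open scoped ENNReal NNReal FourierTransform SchwartzMap Convolution

lemma rpow_anti {a b : ℝ≥0∞} {s : ℝ} (hs : s ≤ 0) (h : a ≤ b) : b ^ s ≤ a ^ s := by
  have e : ∀ c : ℝ≥0∞, c ^ s = (c ^ (-s))⁻¹ := fun c => by rw [← ENNReal.rpow_neg, neg_neg]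
  rw [e b, e a]
  exact ENNReal.inv_le_inv.2 (ENNReal.rpow_le_rpow h (neg_nonneg.2 hs))

lemma vol_eq {n : ℕ} (x y : En n) (s : ℝ) :
    volume (Metric.ball x s) = volume (Metric.ball y s) := by
  rcases le_or_gt s 0 with h | h
  · rw [Metric.ball_eq_empty.2 h, Metric.ball_eq_empty.2 h]
  · rw [vol_ball n x h, vol_ball n y h]

lemma MB_avg {n : ℕ} {A : ℝ≥0∞} {σ : ℝ} {w : En n → ℝ≥0∞} (h1 : σ ≤ 1) (hw : MB n A σ w)
    (x x0 : En n) {t s : ℝ} (ht : 0 < t) (hs : t ≤ s) :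
    ∫⁻ y in Metric.ball x s, w y ≤
      volume (Metric.ball x s) * (A * volume (Metric.ball x0 t) ^ (σ - 1)) := by
  have hs0 := ht.trans_le hs
  refine (hw x s hs0).trans ?_
  have hV0 := vol_ball_ne_zero n x hs0
  have hVt := vol_ball_ne_top n x s
  have e : volume (Metric.ball x s) ^ σ =
      volume (Metric.ball x s) * volume (Metric.ball x s) ^ (σ - 1) := by
    nth_rewrite 2 [← ENNReal.rpow_one (volume (Metric.ball x s))]
    rw [← ENNReal.rpow_add _ _ hV0 hVt]; congr 1; ring
  rw [e, mul_left_comm]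
  gcongr volume (Metric.ball x s) * (A * ?_)
  apply rpow_anti (by linarith)
  rw [vol_eq x x0]
  exact measure_mono (Metric.ball_subset_ball hs)

lemma F_le {n : ℕ} {A : ℝ≥0∞} {σ q : ℝ} (hq : 0 < q) (h1 : σ ≤ 1) {g : En n → ℝ≥0∞}
    (hg : MB n A σ (fun y => g y ^ q)) (y x0 : En n) {ε t : ℝ} (ht : 0 < t) (hs : t ≤ ε)
    (c : ℝ≥0∞) (hc : ∀ y', dist y' y < ε → c ≤ g y') :
    c ^ q ≤ A * volume (Metric.ball x0 t) ^ (σ - 1) := by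
  have h := MB_avg h1 hg y x0 ht hs
  have h2 : volume (Metric.ball y ε) * c ^ q ≤ ∫⁻ y' in Metric.ball y ε, g y' ^ q := by
    rw [mul_comm, ← setLIntegral_const]
    refine setLIntegral_mono' measurableSet_ball fun y' hy' => ?_
    exact ENNReal.rpow_le_rpow (hc y' hy') hq.le
  exact (ENNReal.mul_le_mul_iff_right (vol_ball_ne_zero n y (ht.trans_le hs))
    (vol_ball_ne_top n y ε)).1 (h2.trans h)

/-- the constant `M_ρ` -/
def Mr (n : ℕ) (A : ℝ≥0∞) (σ q ρ : ℝ) : ℝ≥0∞ :=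
  (A * volume (Metric.ball (0 : En n) ρ) ^ (σ - 1)) ^ q⁻¹

lemma Mr_pow {n : ℕ} {A : ℝ≥0∞} {σ q ρ : ℝ} (hq : 0 < q) :
    Mr n A σ q ρ ^ q = A * volume (Metric.ball (0 : En n) ρ) ^ (σ - 1) := by
  rw [Mr, ← ENNReal.rpow_mul, inv_mul_cancel₀ hq.ne', ENNReal.rpow_one]

lemma Mr_scale {n : ℕ} {A : ℝ≥0∞} {σ q ρ ε N : ℝ} (hq : 0 < q) (hq1 : q ≤ 1) (h0 : 0 ≤ σ)
    (h1 : σ ≤ 1) (hNq : n ≤ N * q) (hε : 0 < ε) (hερ : ε ≤ ρ) :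
    Mr n A σ q ε ^ (1 - q) * ENNReal.ofReal ((ε / ρ) ^ (N - n)) ≤ Mr n A σ q ρ ^ (1 - q) := by
  have hρ : 0 < ρ := hε.trans_le hερ
  have hr : 0 ≤ q⁻¹ * (1 - q) := mul_nonneg (by positivity) (by linarith)
  unfold Mr
  rw [← ENNReal.rpow_mul, ← ENNReal.rpow_mul, ENNReal.mul_rpow_of_nonneg _ _ hr,
    ENNReal.mul_rpow_of_nonneg _ _ hr, ← ENNReal.rpow_mul, ← ENNReal.rpow_mul, mul_assoc]
  gcongr A ^ (q⁻¹ * (1 - q)) * ?_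
  set c := (1 - σ) * (q⁻¹ * (1 - q)) with hc
  have hc0 : 0 ≤ c := mul_nonneg (by linarith) hr
  have hcN : n * c ≤ N - n := by
    have h2 : c ≤ q⁻¹ * (1 - q) := by
      rw [hc]; exact mul_le_of_le_one_left hr (by linarith)
    have h3 : (n:ℝ) * c ≤ n * (q⁻¹ * (1 - q)) := by gcongr
    have h4 : (n:ℝ) * (q⁻¹ * (1 - q)) = n / q - n := by field_simp
    have h5 : (n:ℝ) / q ≤ N := by rw [div_le_iff₀ hq]; exact hNq
    linarith
  have e : volume (Metric.ball (0 : En n) ε) =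
      ENNReal.ofReal ((ε / ρ) ^ n) * volume (Metric.ball (0 : En n) ρ) := by
    rw [← vol_ball_mul n 0 0 hρ (by positivity), div_mul_cancel₀ _ hρ.ne']
  have hx0 : 0 < ε / ρ := by positivity
  have hx1 : ε / ρ ≤ 1 := by rw [div_le_one hρ]; exact hερ
  rw [show (σ - 1) * (q⁻¹ * (1 - q)) = -c by rw [hc]; ring, e,
    ENNReal.mul_rpow_of_ne_zero (by rw [ENNReal.ofReal_ne_zero_iff]; positivity)
      (vol_ball_ne_zero n 0 hρ), ENNReal.ofReal_rpow_of_pos (by positivity), mul_right_comm,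
    ← ENNReal.ofReal_mul (by positivity)]
  refine mul_le_of_le_one_left (zero_le) ?_
  rw [ENNReal.ofReal_le_one, ← Real.rpow_natCast, ← Real.rpow_mul hx0.le, ← Real.rpow_add hx0]
  apply Real.rpow_le_one hx0.le hx1
  linarith

open Classical in
/-- local part of the family -/
def locF {n : ℕ} (F : ℝ → En n → ℝ≥0∞) (x0 : En n) (ρ : ℝ) (ε : ℝ) (y : En n) : ℝ≥0∞ :=
  if ε < ρ ∧ y ∈ Metric.ball x0 (3 * ρ) then F ε y else 0

lemma local_bound {n : ℕ} {N : ℝ} (hN : (n:ℝ) < N) : ∃ C : ℝ≥0, ∀ {q : ℝ} (_ : 0 < q) (_ : q ≤ 1)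
    (_ : n ≤ N * q) {A : ℝ≥0∞} {σ : ℝ} (_ : 0 ≤ σ) (_ : σ ≤ 1) (g : En n → ℝ≥0∞) (_ : Measurable g)
    (_ : MB n A σ (fun y => g y ^ q)) (F : ℝ → En n → ℝ≥0∞) (_ : ∀ ε, 0 < ε → Measurable (F ε))
    (_ : ∀ ε, 0 < ε → ∀ y y', dist y' y < ε → F ε y ≤ g y') (x0 x : En n) (ρ : ℝ) (_ : 0 < ρ)
    (_ : x ∈ Metric.ball x0 ρ),
    Tm n N F x ≤ Tm n N (locF F x0 ρ) x + C * Mr n A σ q ρ := by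
  obtain ⟨K, hK⟩ := ker_avg hN
  have hn0 : (0:ℝ) ≤ n := Nat.cast_nonneg n
  have hMt := (kerMass_lt_top n hN).ne
  refine ⟨(kerMass n N).toNNReal + Real.toNNReal (2 ^ N) * K, fun {q} hq hq1 hNq {A σ} h0 h1 g hgm hg
    F hFm hF x0 x ρ hρ hx => ?_⟩
  push_cast
  rw [ENNReal.coe_toNNReal hMt]
  change _ ≤ _ + (kerMass n N + ENNReal.ofReal (2 ^ N) * K) * _
  set M := Mr n A σ q ρ with hM
  refine iSup₂_le fun ε hε => ?_
  have hkm : Measurable (fun y => ker n N ε (x - y)) :=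
    (ker_meas n N hε).comp (measurable_const.sub measurable_id)
  rcases le_or_gt ρ ε with hc | hc
  · have hp : ∀ y, F ε y ≤ M := by
      intro y
      rw [hM, Mr, ENNReal.le_rpow_inv_iff hq]
      exact F_le hq h1 hg y 0 hρ hc _ (fun y' hy' => hF ε hε y y' hy')
    calc _ ≤ ∫⁻ y, ker n N ε (x - y) * M := lintegral_mono fun y => mul_le_mul' le_rfl (hp y)
      _ = kerMass n N * M := by rw [lintegral_mul_const _ hkm, ker_lint_sub n N hε]
      _ ≤ (kerMass n N + ENNReal.ofReal (2 ^ N) * K) * M := by gcongr; exact le_self_add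
      _ ≤ _ := le_add_self
  · set m := Mr n A σ q ε with hm
    have hFm' : ∀ y, F ε y ≤ m ^ (1 - q) * F ε y ^ q := by
      intro y
      have h2 : F ε y ≤ m := by
        rw [hm, Mr, ENNReal.le_rpow_inv_iff hq]
        exact F_le hq h1 hg y 0 hε le_rfl _ (fun y' hy' => hF ε hε y y' hy')
      calc F ε y = F ε y ^ q * F ε y ^ (1 - q) := rpow_split hq.le hq1
        _ ≤ F ε y ^ q * m ^ (1 - q) := by gcongr
        _ = _ := mul_comm _ _
    have hpt : ∀ y, ker n N ε (x - y) * F ε y ≤ ker n N ε (x - y) * locF F x0 ρ ε y +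
        (ENNReal.ofReal (2 ^ N) * M ^ (1 - q)) * (ker n N ρ (x - y) * g y ^ q) := by
      intro y
      by_cases hy : y ∈ Metric.ball x0 (3 * ρ)
      · rw [locF, if_pos ⟨hc, hy⟩]; exact le_self_add
      · refine le_trans ?_ le_add_self
        have hxy : ρ ≤ ‖x - y‖ := by
          rw [Metric.mem_ball, not_lt] at hy
          rw [Metric.mem_ball] at hx
          rw [← dist_eq_norm]
          have := dist_triangle y x x0
          rw [dist_comm y x] at this
          linarith
        have hk := ker_compare (n := n) (N := N) (by linarith) hε hρ _ hxy
        rw [ENNReal.ofReal_mul (by positivity)] at hk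
        calc _ ≤ (ENNReal.ofReal (2 ^ N) * ENNReal.ofReal ((ε / ρ) ^ (N - n)) * ker n N ρ (x - y)) *
              (m ^ (1 - q) * g y ^ q) := by
              refine mul_le_mul' hk ((hFm' y).trans ?_)
              gcongr
              exact hF ε hε y y (by simpa using hε)
          _ = ENNReal.ofReal (2 ^ N) * (m ^ (1 - q) * ENNReal.ofReal ((ε / ρ) ^ (N - n))) *
              (ker n N ρ (x - y) * g y ^ q) := by ring
          _ ≤ _ := by
              gcongr
              exact Mr_scale hq hq1 h0 h1 hNq hε hc.le
    have hkg : ∫⁻ y, ker n N ρ (x - y) * g y ^ q ≤ K * M ^ q := by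
      rw [hM, Mr_pow hq]
      exact hK ρ hρ _ (hgm.pow_const q) x _ (fun s hs => MB_avg h1 hg x 0 hρ hs)
    have hgk : Measurable (fun y => ker n N ρ (x - y) * g y ^ q) :=
      ((ker_meas n N hρ).comp (measurable_const.sub measurable_id)).mul (hgm.pow_const q)
    calc _ ≤ ∫⁻ y, (ker n N ε (x - y) * locF F x0 ρ ε y +
        (ENNReal.ofReal (2 ^ N) * M ^ (1 - q)) * (ker n N ρ (x - y) * g y ^ q)) := lintegral_mono hpt
      _ = (∫⁻ y, ker n N ε (x - y) * locF F x0 ρ ε y) +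
        (ENNReal.ofReal (2 ^ N) * M ^ (1 - q)) * ∫⁻ y, (ker n N ρ (x - y) * g y ^ q) := by
          rw [lintegral_add_right _ (hgk.const_mul _), lintegral_const_mul _ hgk]
      _ ≤ Tm n N (locF F x0 ρ) x + (ENNReal.ofReal (2 ^ N) * M ^ (1 - q)) * (K * M ^ q) := by
          gcongr
          exact le_iSup₂_of_le ε hε le_rfl
      _ = Tm n N (locF F x0 ρ) x + (ENNReal.ofReal (2 ^ N) * K) * (M ^ q * M ^ (1 - q)) := by ring
      _ = Tm n N (locF F x0 ρ) x + (ENNReal.ofReal (2 ^ N) * K) * M := by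
          rw [← rpow_split hq.le hq1]
      _ ≤ _ := by gcongr; exact le_add_self
end P12body

section P13body
open MeasureTheory Real Set
open scoped ENNReal NNReal FourierTransform SchwartzMap Convolution

lemma weak_ball {n : ℕ} (hn : 1 ≤ n) {N q : ℝ} (hN : (n:ℝ) < N) (hq : 0 < q) (hq1 : q ≤ 1)
    (hNq : n ≤ N * q) (D : ℝ≥0) (hD : 0 < D) : ∃ C : ℝ≥0, 0 < C ∧ ∀ {A : ℝ≥0∞} {σ : ℝ} (_ : 0 ≤ σ)
    (_ : σ ≤ 1) (g : En n → ℝ≥0∞)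
    (_ : ∀ l, IsOpen {x | l < g x}) (_ : MB n A σ (fun y => g y ^ q))
    (F : ℝ → En n → ℝ≥0∞) (_ : ∀ ε, 0 < ε → Measurable (F ε))
    (_ : ∀ ε, 0 < ε → ∀ y y', dist y' y < ε → F ε y ≤ g y') (b : En n → ℝ≥0∞)
    (_ : ∀ x, b x ≤ D * Tm n N F x) (x0 : En n) (ρ : ℝ) (_ : 0 < ρ) (β : ℝ≥0) (_ : 0 < β),
    (β:ℝ≥0∞) ^ q * volume ({x | (β:ℝ≥0∞) < b x} ∩ Metric.ball x0 ρ) ≤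
      C * (A * volume (Metric.ball x0 ρ) ^ σ) := by
  obtain ⟨C1, hC1⟩ := local_bound hN
  obtain ⟨C2, hC20, hC2⟩ := weakW hn hN hq hq1 hNq
  refine ⟨(2 * D * C1) ^ q + (2 * D) ^ q * (C2 * 4 ^ n), by positivity,
    fun {A σ} h0 h1 g hgo hg F hFm hF b hb x0 ρ hρ β hβ => ?_⟩
  have hgm : Measurable g := measurable_of_Ioi (fun l => (hgo l).measurableSet)
  set V := volume (Metric.ball x0 ρ) with hV
  have hV0 : V ≠ 0 := vol_ball_ne_zero n x0 hρ
  have hVt : V ≠ ⊤ := vol_ball_ne_top n x0 ρ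
  have hVV : V ^ (σ - 1) * V = V ^ σ := by
    nth_rewrite 2 [← ENNReal.rpow_one V]
    rw [← ENNReal.rpow_add _ _ hV0 hVt]; congr 1; ring
  set M := Mr n A σ q ρ with hM
  have hMq : M ^ q = A * V ^ (σ - 1) := by rw [hM, Mr_pow hq, vol_eq 0 x0]
  have hloc : ∀ x ∈ Metric.ball x0 ρ, Tm n N F x ≤ Tm n N (locF F x0 ρ) x + C1 * M := fun x hx =>
    hC1 hq hq1 hNq h0 h1 g hgm hg F hFm hF x0 x ρ hρ hx
  have hpush : (((2 * D * C1) ^ q + (2 * D) ^ q * (C2 * 4 ^ n) : ℝ≥0) : ℝ≥0∞) =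
      (2 * D * C1 : ℝ≥0∞) ^ q + (2 * D : ℝ≥0∞) ^ q * (C2 * 4 ^ n) := by
    push_cast [ENNReal.coe_rpow_of_nonneg _ hq.le]; rfl
  rw [hpush]
  rcases le_or_gt (β:ℝ≥0∞) (2 * D * C1 * M) with hc | hc
  · calc _ ≤ (2 * D * C1 * M) ^ q * V := by
          gcongr
          exact measure_mono inter_subset_right
      _ = (2 * D * C1) ^ q * (A * (V ^ (σ - 1) * V)) := by
          rw [ENNReal.mul_rpow_of_nonneg _ _ hq.le, hMq]; ring
      _ = (2 * D * C1) ^ q * (A * V ^ σ) := by rw [hVV]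
      _ ≤ _ := by gcongr; exact le_self_add
  · have hD0 : (D:ℝ≥0∞) ≠ 0 := by simpa using hD.ne'
    have h2D0 : (2 * D : ℝ≥0∞) ≠ 0 := mul_ne_zero (by norm_num) hD0
    have h2Dt : (2 * D : ℝ≥0∞) ≠ ⊤ := ENNReal.mul_ne_top (by norm_num) (by simp)
    set l : ℝ≥0∞ := β / (2 * D) with hl'
    have hl0 : l ≠ 0 := by
      rw [hl', ENNReal.div_ne_zero]; exact ⟨by simpa using hβ.ne', h2Dt⟩
    have hlt : l ≠ ⊤ := ENNReal.div_ne_top (by simp) h2D0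
    have hlD : (2 * D : ℝ≥0∞) * l = β := ENNReal.mul_div_cancel h2D0 h2Dt
    set h : En n → ℝ≥0∞ := (Metric.ball x0 (4 * ρ)).indicator g with hh
    have hho : ∀ l, IsOpen {x | l < h x} := by
      intro l
      have : {x | l < h x} = {x | l < g x} ∩ Metric.ball x0 (4 * ρ) := by
        ext x
        simp only [mem_ofPred_eq, mem_inter_iff]
        by_cases hx : x ∈ Metric.ball x0 (4 * ρ)
        · rw [hh, indicator_of_mem hx]; simp [hx]
        · rw [hh, indicator_of_notMem hx]; simp [hx]
      rw [this]; exact (hgo l).inter Metric.isOpen_ball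
    have hah : ∀ ε, 0 < ε → ∀ y y', dist y' y < ε → locF F x0 ρ ε y ≤ h y' := by
      intro ε hε y y' hy'
      unfold locF
      split_ifs with hcase
      · rw [hh, indicator_of_mem]
        · exact hF ε hε y y' hy'
        · have h3 := hcase.2
          rw [Metric.mem_ball] at h3 ⊢
          have := dist_triangle y' y x0
          linarith [hcase.1]
      · exact zero_le
    have hW := hC2 h hho _ hah l hl0 hlt
    have hIntg0 : ∫⁻ x, h x ^ q ≤ 4 ^ n * (A * V ^ σ) := by
      have e : (fun x => h x ^ q) = (Metric.ball x0 (4*ρ)).indicator (fun x => g x ^ q) := by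
        ext x
        by_cases hx : x ∈ Metric.ball x0 (4*ρ)
        · rw [hh, indicator_of_mem hx, indicator_of_mem hx]
        · rw [hh, indicator_of_notMem hx, indicator_of_notMem hx, ENNReal.zero_rpow_of_pos hq]
      rw [e, lintegral_indicator measurableSet_ball]
      refine (hg x0 (4*ρ) (by positivity)).trans ?_
      rw [vol_ball_mul n x0 x0 hρ four_pos, ENNReal.mul_rpow_of_nonneg _ _ h0,
        ENNReal.ofReal_pow (by norm_num)]
      have : (ENNReal.ofReal 4 ^ n) ^ σ ≤ (4:ℝ≥0∞) ^ n := by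
        rw [ENNReal.ofReal_ofNat]
        calc ((4:ℝ≥0∞) ^ n) ^ σ ≤ (4 ^ n) ^ (1:ℝ) :=
              ENNReal.rpow_le_rpow_of_exponent_le (one_le_pow₀ (by norm_num)) h1
          _ = _ := ENNReal.rpow_one _
      calc _ ≤ A * (4 ^ n * V ^ σ) := by gcongr
        _ = _ := by ring
    have hsub : {x | (β:ℝ≥0∞) < b x} ∩ Metric.ball x0 ρ ⊆ {x | l < Tm n N (locF F x0 ρ) x} := by
      rintro x ⟨hx1, hx2⟩
      show l < _
      by_contra hcon
      rw [not_lt] at hcon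
      have h3 : (β:ℝ≥0∞) < D * (Tm n N (locF F x0 ρ) x + C1 * M) :=
        lt_of_lt_of_le hx1 ((hb x).trans (by gcongr; exact hloc x hx2))
      have h4 : 2 * (D * (Tm n N (locF F x0 ρ) x + C1 * M)) ≤ 2 * β := by
        calc _ = 2 * D * Tm n N (locF F x0 ρ) x + 2 * D * C1 * M := by ring
          _ ≤ 2 * D * l + β := by gcongr
          _ = 2 * β := by rw [hlD]; ring
      have h5 := (ENNReal.mul_le_mul_iff_right (by norm_num) (by norm_num)).1 h4
      exact absurd h3 (not_lt.2 h5)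
    calc _ ≤ (2 * D * l) ^ q * volume {x | l < Tm n N (locF F x0 ρ) x} := by
          rw [hlD]
          exact mul_le_mul' le_rfl (measure_mono hsub)
      _ = (2 * D) ^ q * (l ^ q * volume {x | l < Tm n N (locF F x0 ρ) x}) := by
          rw [ENNReal.mul_rpow_of_nonneg _ _ hq.le, mul_assoc]
      _ ≤ (2 * D) ^ q * (C2 * (4 ^ n * (A * V ^ σ))) := by
          refine mul_le_mul' le_rfl (hW.trans ?_)
          gcongr
      _ = (2 * D) ^ q * (C2 * 4 ^ n) * (A * V ^ σ) := by ring
      _ ≤ _ := by gcongr; exact le_add_self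

theorem brMain {n : ℕ} (hn : 1 ≤ n) (δ p q : ℝ)
    (hδ : ((n : ℝ) - 1) / 2 < δ)
    (hq0 : 0 < q) (hq1 : q ≤ 1) (hqp : q ≤ p)
    (hlow : 2 * (n : ℝ) / ((n : ℝ) + 1 + 2 * δ) ≤ q)
    (Φ : SchwartzMap (En n) ℂ) (hΦ : (∫ x, Φ x) ≠ 0) :
    ∃ C : ℝ≥0, 0 < C ∧ ∀ f : SchwartzMap (En n) ℂ,
      morreyWQ n p q (brMax n δ (⇑f)) ≤
        (C : ℝ≥0∞) * morreyQ n p q (radMax n (⇑Φ) (⇑f)) := by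
  have hn1 : (1:ℝ) ≤ n := by exact_mod_cast hn
  have hδ0 : 0 < δ := lt_of_le_of_lt (by linarith) hδ
  have hp : 0 < p := hq0.trans_le hqp
  set N : ℝ := ((n:ℝ) + 1) / 2 + δ with hNdef
  have hN : (n:ℝ) < N := by rw [hNdef]; linarith
  have hNq : (n:ℝ) ≤ N * q := by
    rw [div_le_iff₀ (by positivity)] at hlow
    rw [hNdef]; linarith
  have hσ0 : 0 ≤ 1 - q / p := by rw [sub_nonneg, div_le_one hp]; exact hqp
  have hσ1 : 1 - q / p ≤ 1 := by have : 0 < q / p := by positivity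
                                 linarith
  obtain ⟨η, hη⟩ := exists_eta n
  obtain ⟨D, hD⟩ := brMeans_le hn hδ0 hδ
  obtain ⟨C1, hC1⟩ := gmax_MB hn hq0 hq1 hqp Φ hΦ
  obtain ⟨C2, hC20, hC2⟩ := weak_ball hn hN hq0 hq1 hNq (D + 1) (by positivity)
  refine ⟨(C2 * C1) ^ (1 / q) + 1, by positivity, fun f => ?_⟩
  set 𝒩 := morreyQ n p q (radMax n Φ f) with h𝒩
  have hb : ∀ x, brMax n δ f x ≤ ((D + 1 : ℝ≥0) : ℝ≥0∞) * Tm n N (fun ε y => ‖cv η ε f y‖ₑ) x := by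
    intro x
    refine iSup₂_le fun ε hε => ?_
    refine (hD hη f ε hε x).trans ?_
    refine mul_le_mul' (by push_cast; exact le_self_add) ?_
    exact le_iSup₂_of_le (f := fun (ε : ℝ) (_ : 0 < ε) => ∫⁻ y, ker n N ε (x - y) * ‖cv η ε f y‖ₑ)
      ε hε le_rfl
  refine iSup₂_le fun β hβ => ?_
  have key : morreyQ n p q ({x | (β : ℝ≥0∞) < brMax n δ f x}.indicator 1) ≤
      (β:ℝ≥0∞)⁻¹ * ((C2 * C1 : ℝ≥0) ^ (1/q) * 𝒩) := by
    refine iSup_le fun x0 => iSup₂_le fun ρ hρ => ?_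
    have h := hC2 hσ0 hσ1 (gmax η f) (gmax_open η f) (hC1 η hη f) (fun ε y => ‖cv η ε f y‖ₑ)
      (fun ε _ => (cv η ε f).continuous.enorm.measurable)
      (fun ε hε y y' hy => gmax_ge η f y' y hε hy) _ hb x0 ρ hρ β hβ
    have hi : ∫⁻ y in Metric.ball x0 ρ,
        ({x | (β : ℝ≥0∞) < brMax n δ f x}.indicator (1 : En n → ℝ≥0∞) y) ^ q ≤
        volume ({x | (β:ℝ≥0∞) < brMax n δ f x} ∩ Metric.ball x0 ρ) := by
      rw [← Measure.restrict_apply' measurableSet_ball]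
      refine le_trans (lintegral_mono fun y => ?_) (lintegral_indicator_one_le _)
      by_cases hy : y ∈ {x | (β : ℝ≥0∞) < brMax n δ f x}
      · rw [indicator_of_mem hy]; simp
      · rw [indicator_of_notMem hy, ENNReal.zero_rpow_of_pos hq0]
    set W := volume ({x | (β:ℝ≥0∞) < brMax n δ f x} ∩ Metric.ball x0 ρ) with hW
    set V := volume (Metric.ball x0 ρ) with hV
    have hV0 : V ≠ 0 := vol_ball_ne_zero n x0 hρ
    have hVt : V ≠ ⊤ := vol_ball_ne_top n x0 ρ
    have hβ0 : (β:ℝ≥0∞) ≠ 0 := by simpa using hβ.ne'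
    have hβt : (β:ℝ≥0∞) ≠ ⊤ := by simp
    have hiq : 0 ≤ 1 / q := by positivity
    have h2 := ENNReal.rpow_le_rpow h hiq
    rw [ENNReal.mul_rpow_of_nonneg _ _ hiq, ← ENNReal.rpow_mul, mul_one_div_cancel hq0.ne',
      ENNReal.rpow_one] at h2
    have h3 : ((C2:ℝ≥0∞) * (C1 * 𝒩 ^ q * V ^ (1 - q / p))) ^ (1/q) =
        (C2 * C1 : ℝ≥0) ^ (1/q) * 𝒩 * V ^ (-(1/p - 1/q)) := by
      rw [show (C2:ℝ≥0∞) * (C1 * 𝒩 ^ q * V ^ (1 - q / p)) =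
        ((C2 * C1 : ℝ≥0) : ℝ≥0∞) * 𝒩 ^ q * V ^ (1 - q / p) by push_cast; ring,
        ENNReal.mul_rpow_of_nonneg _ _ hiq, ENNReal.mul_rpow_of_nonneg _ _ hiq,
        ← ENNReal.rpow_mul, ← ENNReal.rpow_mul, mul_one_div_cancel hq0.ne', ENNReal.rpow_one]
      congr 2
      field_simp; ring
    rw [h3] at h2
    calc _ ≤ V ^ (1/p - 1/q) * W ^ (1/q) := by gcongr
      _ = (β:ℝ≥0∞)⁻¹ * (V ^ (1/p - 1/q) * (β * W ^ (1/q))) := by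
          rw [mul_left_comm (V ^ (1/p - 1/q)), ← mul_assoc, ENNReal.inv_mul_cancel hβ0 hβt, one_mul]
      _ ≤ (β:ℝ≥0∞)⁻¹ * (V ^ (1/p - 1/q) * ((C2 * C1 : ℝ≥0) ^ (1/q) * 𝒩 * V ^ (-(1/p - 1/q)))) := by
          gcongr
      _ = (β:ℝ≥0∞)⁻¹ * ((V ^ (1/p - 1/q) * V ^ (-(1/p - 1/q))) * ((C2 * C1 : ℝ≥0) ^ (1/q) * 𝒩)) := by
          ring
      _ = _ := by rw [← ENNReal.rpow_add _ _ hV0 hVt, add_neg_cancel, ENNReal.rpow_zero, one_mul]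
  calc _ ≤ (β:ℝ≥0∞) * ((β:ℝ≥0∞)⁻¹ * ((C2 * C1 : ℝ≥0) ^ (1/q) * 𝒩)) := by gcongr
    _ = ((C2 * C1 : ℝ≥0) : ℝ≥0∞) ^ (1/q) * 𝒩 := by
        rw [← mul_assoc, ENNReal.mul_inv_cancel (by simpa using hβ.ne') (by simp), one_mul]
    _ ≤ _ := by
        rw [ENNReal.coe_add, ENNReal.coe_rpow_of_nonneg _ (by positivity)]
        gcongr
        exact le_self_add
end P13body

theorem maximalBochnerRiesz_hardyMorrey_to_weakMorrey {n : ℕ} (hn : 1 ≤ n) (δ p q : ℝ)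
    (hδ : ((n : ℝ) - 1) / 2 < δ)
    (hq0 : 0 < q) (hq1 : q ≤ 1) (hqp : q ≤ p)
    (hlow : 2 * (n : ℝ) / ((n : ℝ) + 1 + 2 * δ) ≤ q)
    (Φ : SchwartzMap (En n) ℂ) (hΦ : (∫ x, Φ x) ≠ 0) :
    ∃ C : ℝ≥0, 0 < C ∧ ∀ f : SchwartzMap (En n) ℂ,
      morreyWQ n p q (brMax n δ (⇑f)) ≤
        (C : ℝ≥0∞) * morreyQ n p q (radMax n (⇑Φ) (⇑f)) := by
  exact brMain hn δ p q hδ hq0 hq1 hqp hlow Φ hΦ
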